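/- arXiv:1311.7115 — 2 statements merged into one kernel-verified Lean document; each statement's English description precedes it below -/
import Mathlib

section
/- There is an absolute constant K > 0 such that the following holds. Let q : {-1,1}^n -> R be a tau-regular degree-d multilinear polynomial with Var[q] = 1, and let rho > 0. Then for every theta in R, Pr_{x uniform on {-1,1}^n}[ |q(x) - theta| <= rho ] <= K * ( d * tau^{1/(8d)} + d * rho^{1/d} ). -/
open scoped Classical
open MeasureTheory ProbabilityTheory

/-- The standard Gaussian measure `N(0,1)^n` on `ℝ^n`. -/
noncomputable def stdGaussian (n : ℕ) : Measure (Fin n → ℝ) :=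
  MeasureTheory.Measure.pi fun _ => ProbabilityTheory.gaussianReal 0 1

/-- Evaluation of the multilinear polynomial with Fourier coefficients `f` at `x ∈ ℝ^n`. -/
noncomputable def peval {n : ℕ} (f : Finset (Fin n) → ℝ) (x : Fin n → ℝ) : ℝ :=
  ∑ S : Finset (Fin n), f S * ∏ i ∈ S, x i

/-- `f` has degree at most `d`: coefficients of monomials with more than `d` variables vanish. -/
def degLE {n : ℕ} (f : Finset (Fin n) → ℝ) (d : ℕ) : Prop :=
  ∀ S : Finset (Fin n), d < S.card → f S = 0

/-- Influence of variable `i` on the multilinear polynomial with coefficients `f`. -/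
noncomputable def binf {n : ℕ} (f : Finset (Fin n) → ℝ) (i : Fin n) : ℝ :=
  ∑ S : Finset (Fin n), if i ∈ S then f S ^ 2 else 0

/-- Variance (under uniform `{-1,1}^n`) of the multilinear polynomial with coefficients `f`. -/
noncomputable def bvar {n : ℕ} (f : Finset (Fin n) → ℝ) : ℝ :=
  ∑ S : Finset (Fin n), if S ≠ ∅ then f S ^ 2 else 0

/-- Probability of `P` under the uniform distribution on `{-1,1}^n`. -/
noncomputable def bprob (n : ℕ) (P : (Fin n → ℝ) → Prop) : ℝ :=
  ((Finset.univ.filter fun x : Fin n → Bool =>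
      P (fun i => if x i then 1 else -1)).card : ℝ) / 2 ^ n

/-- Fourier coefficients of the restriction of `f` fixing the variables in `S` to the values
of `ρ`:  for `U` disjoint from `S`, the coefficient is
`∑_{T ⊆ S} f (T ∪ U) ∏_{i ∈ T} ρ i`, and coefficients of sets meeting `S` vanish. -/
noncomputable def restrictC {n : ℕ} (f : Finset (Fin n) → ℝ) (S : Finset (Fin n))
    (ρ : Fin n → ℝ) : Finset (Fin n) → ℝ :=
  fun U => if Disjoint U S then ∑ T ∈ S.powerset, f (T ∪ U) * ∏ i ∈ T, ρ i else 0

/-- `sign`: `1` if `z ≥ 0`, `-1` otherwise. -/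
noncomputable def sgn (z : ℝ) : ℝ := if 0 ≤ z then 1 else -1

/-- A probability law on `ℝ` matching three moments of a standard Gaussian, with bounded fourth
moment. -/
structure NiceLaw (ν : Measure ℝ) : Prop where
  prob : IsProbabilityMeasure ν
  int : ∀ k : ℕ, Integrable (fun y : ℝ => y ^ k) ν
  m1 : ∫ y, y ∂ν = 0
  m2 : ∫ y, y ^ 2 ∂ν = 1
  m3 : ∫ y, y ^ 3 ∂ν = 0
  m4 : ∫ y, y ^ 4 ∂ν ≤ 9

theorem map_update_pi {n : ℕ} (ν : Fin n → Measure ℝ) [∀ i, IsProbabilityMeasure (ν i)]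
    (m : Measure ℝ) [IsProbabilityMeasure m] (k : Fin n) :
    Measure.map (fun p : (Fin n → ℝ) × ℝ => Function.update p.1 k p.2) ((Measure.pi ν).prod m)
      = Measure.pi (Function.update ν k m) := by
  have : ∀ i, IsProbabilityMeasure (Function.update ν k m i) := by
    intro i
    by_cases h : i = k
    · subst h; simpa
    · simpa [h] using (inferInstance : IsProbabilityMeasure (ν i))
  symm
  apply Measure.pi_eq
  intro s hs
  have hmeas : Measurable (fun p : (Fin n → ℝ) × ℝ => Function.update p.1 k p.2) := by
    rw [measurable_pi_iff]
    intro i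
    by_cases h : i = k
    · subst h; simpa using measurable_snd
    · simp only [Function.update_of_ne h]; fun_prop
  rw [Measure.map_apply hmeas (MeasurableSet.univ_pi hs)]
  have : (fun p : (Fin n → ℝ) × ℝ => Function.update p.1 k p.2) ⁻¹' Set.univ.pi s
      = (Set.univ.pi (Function.update s k Set.univ)) ×ˢ s k := by
    ext p
    simp only [Set.mem_preimage, Set.mem_pi, Set.mem_univ, true_imp_iff, Set.mem_prod]
    constructor
    · intro h
      refine ⟨fun i => ?_, by simpa using h k⟩
      by_cases hi : i = k
      · subst hi; simp
      · simpa [hi] using h i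
    · rintro ⟨h1, h2⟩ i
      by_cases hi : i = k
      · subst hi; simpa using h2
      · simpa [hi] using h1 i
  rw [this, Measure.prod_prod, Measure.pi_pi]
  rw [← Finset.mul_prod_erase _ _ (Finset.mem_univ k),
    ← Finset.mul_prod_erase _ (fun i => (Function.update ν k m i) (s i)) (Finset.mem_univ k)]
  simp only [Function.update_self, measure_univ, one_mul]
  rw [mul_comm]
  congr 1
  apply Finset.prod_congr rfl
  intro i hi
  simp [Finset.ne_of_mem_erase hi]

theorem measurable_update_pair {n : ℕ} (k : Fin n) :
    Measurable (fun p : (Fin n → ℝ) × ℝ => Function.update p.1 k p.2) := by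
  rw [measurable_pi_iff]
  intro i
  by_cases h : i = k
  · subst h; simpa using measurable_snd
  · simp only [Function.update_of_ne h]; fun_prop

theorem integral_pi_update {n : ℕ} (ν : Fin n → Measure ℝ) [∀ i, IsProbabilityMeasure (ν i)]
    (m : Measure ℝ) [IsProbabilityMeasure m] (k : Fin n) (F : (Fin n → ℝ) → ℝ)
    (hF : Integrable F (Measure.pi (Function.update ν k m))) :
    ∫ x, F x ∂(Measure.pi (Function.update ν k m))
      = ∫ x, ∫ y, F (Function.update x k y) ∂m ∂(Measure.pi ν) := by
  have hm := (measurable_update_pair k).aemeasurable (μ := (Measure.pi ν).prod m)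
  rw [← map_update_pi] at hF ⊢
  rw [integral_map hm hF.aestronglyMeasurable, integral_prod]
  exact (integrable_map_measure hF.aestronglyMeasurable hm).1 hF

/-- The algebra of polynomial functions on `ℝ^n`. -/
noncomputable def polyFun (n : ℕ) : Subalgebra ℝ ((Fin n → ℝ) → ℝ) :=
  (MvPolynomial.aeval (R := ℝ) (fun (i : Fin n) (x : Fin n → ℝ) => x i)).range

theorem coord_mem_polyFun {n : ℕ} (i : Fin n) : (fun x : Fin n → ℝ => x i) ∈ polyFun n :=
  ⟨MvPolynomial.X i, by simp⟩

theorem const_mem_polyFun {n : ℕ} (c : ℝ) : (fun _ : Fin n → ℝ => c) ∈ polyFun n :=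
  (polyFun n).algebraMap_mem c

theorem mul_mem_polyFun {n : ℕ} {F G : (Fin n → ℝ) → ℝ} (hF : F ∈ polyFun n)
    (hG : G ∈ polyFun n) : (fun x => F x * G x) ∈ polyFun n := (polyFun n).mul_mem hF hG

theorem add_mem_polyFun {n : ℕ} {F G : (Fin n → ℝ) → ℝ} (hF : F ∈ polyFun n)
    (hG : G ∈ polyFun n) : (fun x => F x + G x) ∈ polyFun n := (polyFun n).add_mem hF hG

theorem pow_mem_polyFun {n : ℕ} {F : (Fin n → ℝ) → ℝ} (hF : F ∈ polyFun n) (k : ℕ) :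
    (fun x => F x ^ k) ∈ polyFun n := (polyFun n).pow_mem hF k

theorem sum_mem_polyFun {n : ℕ} {α : Type*} (s : Finset α) {F : α → (Fin n → ℝ) → ℝ}
    (hF : ∀ a ∈ s, F a ∈ polyFun n) : (fun x => ∑ a ∈ s, F a x) ∈ polyFun n := by
  have := (polyFun n).sum_mem hF
  convert this using 1
  ext x; simp

theorem prod_mem_polyFun {n : ℕ} {α : Type*} (s : Finset α) {F : α → (Fin n → ℝ) → ℝ}
    (hF : ∀ a ∈ s, F a ∈ polyFun n) : (fun x => ∏ a ∈ s, F a x) ∈ polyFun n := by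
  have := (polyFun n).prod_mem hF
  convert this using 1
  ext x; simp

theorem peval_mem_polyFun {n : ℕ} (f : Finset (Fin n) → ℝ) : peval f ∈ polyFun n :=
  sum_mem_polyFun _ fun _ _ => mul_mem_polyFun (const_mem_polyFun _)
    (prod_mem_polyFun _ fun i _ => coord_mem_polyFun i)

theorem measurable_peval {n : ℕ} (f : Finset (Fin n) → ℝ) : Measurable (peval f) := by
  unfold peval; fun_prop

theorem continuous_peval {n : ℕ} (f : Finset (Fin n) → ℝ) : Continuous (peval f) := by
  unfold peval; fun_prop

theorem integrable_polyFun {n : ℕ} {ν : Fin n → Measure ℝ} (hν : ∀ i, NiceLaw (ν i))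
    {F : (Fin n → ℝ) → ℝ} (hF : F ∈ polyFun n) : Integrable F (Measure.pi ν) := by
  have := fun i => (hν i).prob
  obtain ⟨p, rfl⟩ := hF
  induction p using MvPolynomial.induction_on' with
  | monomial u a =>
    have h : (MvPolynomial.aeval (R := ℝ) (fun (i : Fin n) (x : Fin n → ℝ) => x i))
        (MvPolynomial.monomial u a) = fun x => a * ∏ i, x i ^ u i := by
      ext x
      simp [MvPolynomial.aeval_monomial, Finsupp.prod_fintype]
    change Integrable ((MvPolynomial.aeval (R := ℝ) (fun (i : Fin n) (x : Fin n → ℝ) => x i))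
        (MvPolynomial.monomial u a)) _
    rw [h]
    exact (Integrable.fintype_prod (f := fun i (y : ℝ) => y ^ u i)
      (fun i => (hν i).int (u i))).const_mul a
  | add p q hp hq =>
    have := hp.add hq
    simpa using this

/-- The product integral of monomials. -/
theorem integral_prod_mul_prod {n : ℕ} {ν : Fin n → Measure ℝ} (hν : ∀ i, NiceLaw (ν i))
    (S T : Finset (Fin n)) :
    ∫ x, (∏ i ∈ S, x i) * (∏ i ∈ T, x i) ∂(Measure.pi ν) = if S = T then 1 else 0 := by
  have := fun i => (hν i).prob
  have h : ∀ x : Fin n → ℝ, (∏ i ∈ S, x i) * (∏ i ∈ T, x i)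
      = ∏ i, (if i ∈ S then x i else 1) * (if i ∈ T then x i else 1) := by
    intro x
    rw [Finset.prod_mul_distrib]
    simp [Finset.prod_ite_mem]
  simp_rw [h]
  rw [integral_fintype_prod_eq_prod (f := fun i (y : ℝ) =>
    (if i ∈ S then y else 1) * (if i ∈ T then y else 1))]
  split_ifs with hST
  · subst hST
    apply Finset.prod_eq_one
    intro i _
    by_cases hi : i ∈ S
    · simpa [hi, ← pow_two] using (hν i).m2
    · simp [hi]
  · obtain ⟨i, hi⟩ : ∃ i, ¬ (i ∈ S ↔ i ∈ T) := by
      by_contra hcon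
      push Not at hcon
      exact hST (Finset.ext hcon)
    apply Finset.prod_eq_zero (Finset.mem_univ i)
    by_cases h1 : i ∈ S <;> by_cases h2 : i ∈ T
    · simp_all
    · simpa [h1, h2] using (hν i).m1
    · simpa [h1, h2] using (hν i).m1
    · simp_all

theorem integral_peval_mul {n : ℕ} {ν : Fin n → Measure ℝ} (hν : ∀ i, NiceLaw (ν i))
    (f g : Finset (Fin n) → ℝ) :
    ∫ x, peval f x * peval g x ∂(Measure.pi ν) = ∑ S, f S * g S := by
  have h : ∀ x : Fin n → ℝ, peval f x * peval g x
      = ∑ S, ∑ T, f S * g T * ((∏ i ∈ S, x i) * (∏ i ∈ T, x i)) := by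
    intro x
    simp only [peval, Finset.sum_mul_sum]
    refine Finset.sum_congr rfl fun S _ => Finset.sum_congr rfl fun T _ => by ring
  have hint : ∀ S T : Finset (Fin n), Integrable
      (fun x : Fin n → ℝ => f S * g T * ((∏ i ∈ S, x i) * (∏ i ∈ T, x i))) (Measure.pi ν) := by
    intro S T
    exact integrable_polyFun hν (mul_mem_polyFun (const_mem_polyFun _) (mul_mem_polyFun
      (prod_mem_polyFun _ fun i _ => coord_mem_polyFun i)
      (prod_mem_polyFun _ fun i _ => coord_mem_polyFun i)))
  simp_rw [h]
  rw [integral_finsetSum _ (fun S _ => integrable_finsetSum _ fun T _ => hint S T)]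
  refine Finset.sum_congr rfl fun S _ => ?_
  rw [integral_finsetSum _ (fun T _ => hint S T)]
  simp_rw [integral_const_mul, integral_prod_mul_prod hν]
  simp

theorem integral_peval_sq {n : ℕ} {ν : Fin n → Measure ℝ} (hν : ∀ i, NiceLaw (ν i))
    (f : Finset (Fin n) → ℝ) :
    ∫ x, peval f x ^ 2 ∂(Measure.pi ν) = ∑ S, f S ^ 2 := by
  simp_rw [pow_two]
  exact integral_peval_mul hν f f

/-- Coefficients of the iterated partial derivative along the variables in `T`. -/
noncomputable def dcoef {n : ℕ} (f : Finset (Fin n) → ℝ) (T : Finset (Fin n)) :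
    Finset (Fin n) → ℝ :=
  fun U => if Disjoint U T then f (U ∪ T) else 0

/-- Coefficients of the part of the polynomial not involving the variable `k`. -/
noncomputable def freeCoef {n : ℕ} (f : Finset (Fin n) → ℝ) (k : Fin n) :
    Finset (Fin n) → ℝ :=
  fun U => if k ∈ U then 0 else f U

theorem dcoef_singleton {n : ℕ} (f : Finset (Fin n) → ℝ) (k : Fin n) (U : Finset (Fin n)) :
    dcoef f {k} U = if k ∈ U then 0 else f (insert k U) := by
  simp only [dcoef, Finset.disjoint_singleton_right, Finset.union_singleton]
  split_ifs <;> simp_all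

theorem sum_split_coord {n : ℕ} (k : Fin n) (F : Finset (Fin n) → ℝ) :
    ∑ S, F S = ∑ S, if k ∈ S then 0 else (F S + F (insert k S)) := by
  have h1 : ∑ S : Finset (Fin n), (if k ∈ S then 0 else F (insert k S))
      = ∑ S : Finset (Fin n), (if k ∈ S then F S else 0) := by
    have e1 : ∑ S : Finset (Fin n), (if k ∈ S then F S else 0)
        = ∑ S ∈ Finset.univ.filter (fun S : Finset (Fin n) => k ∈ S), F S := by
      rw [Finset.sum_filter]
    have e2 : ∑ S : Finset (Fin n), (if k ∈ S then 0 else F (insert k S))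
        = ∑ S ∈ Finset.univ.filter (fun S : Finset (Fin n) => ¬ k ∈ S), F (insert k S) := by
      rw [Finset.sum_filter]
      refine Finset.sum_congr rfl fun S _ => ?_
      split_ifs <;> simp_all
    rw [e1, e2]
    refine Finset.sum_nbij' (fun S => insert k S) (fun S => S.erase k) ?_ ?_ ?_ ?_ ?_
    · intro S hS; simp
    · intro S hS; simp
    · intro S hS
      exact Finset.erase_insert (by simpa using hS)
    · intro S hS
      exact Finset.insert_erase (by simpa using hS)
    · intro S hS; rfl
  have h2 : ∀ S : Finset (Fin n), (if k ∈ S then 0 else (F S + F (insert k S)))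
      = (F S - (if k ∈ S then F S else 0)) + (if k ∈ S then 0 else F (insert k S)) := by
    intro S; split_ifs <;> simp
  simp_rw [h2]
  rw [Finset.sum_add_distrib, Finset.sum_sub_distrib, h1]
  ring

theorem peval_split {n : ℕ} (f : Finset (Fin n) → ℝ) (k : Fin n) (x : Fin n → ℝ) :
    peval f x = peval (freeCoef f k) x + x k * peval (dcoef f {k}) x := by
  unfold peval
  rw [sum_split_coord k, Finset.mul_sum, ← Finset.sum_add_distrib]
  refine Finset.sum_congr rfl fun S _ => ?_
  rw [dcoef_singleton, freeCoef]
  split_ifs with h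
  · simp
  · rw [Finset.prod_insert h]; ring

theorem peval_update_of_free {n : ℕ} {f : Finset (Fin n) → ℝ} {k : Fin n}
    (hf : ∀ S, k ∈ S → f S = 0) (x : Fin n → ℝ) (y : ℝ) :
    peval f (Function.update x k y) = peval f x := by
  unfold peval
  refine Finset.sum_congr rfl fun S _ => ?_
  by_cases h : k ∈ S
  · simp [hf S h]
  · congr 1
    refine Finset.prod_congr rfl fun i hi => ?_
    rw [Function.update_of_ne]
    rintro rfl
    exact h hi

theorem freeCoef_free {n : ℕ} (f : Finset (Fin n) → ℝ) (k : Fin n) (S : Finset (Fin n))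
    (h : k ∈ S) : freeCoef f k S = 0 := by simp [freeCoef, h]

theorem dcoef_free {n : ℕ} (f : Finset (Fin n) → ℝ) (k : Fin n) (S : Finset (Fin n))
    (h : k ∈ S) : dcoef f {k} S = 0 := by simp [dcoef_singleton, h]

theorem peval_update {n : ℕ} (f : Finset (Fin n) → ℝ) (k : Fin n) (x : Fin n → ℝ) (y : ℝ) :
    peval f (Function.update x k y) = peval (freeCoef f k) x + y * peval (dcoef f {k}) x := by
  rw [peval_split f k, peval_update_of_free (freeCoef_free f k),
    peval_update_of_free (dcoef_free f k)]
  simp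

theorem sum_sq_split {n : ℕ} (f : Finset (Fin n) → ℝ) (k : Fin n) :
    ∑ S, f S ^ 2 = ∑ S, freeCoef f k S ^ 2 + ∑ S, dcoef f {k} S ^ 2 := by
  rw [sum_split_coord k, ← Finset.sum_add_distrib]
  refine Finset.sum_congr rfl fun S _ => ?_
  rw [dcoef_singleton, freeCoef]
  split_ifs <;> simp

theorem sum_sq_dcoef_singleton {n : ℕ} (f : Finset (Fin n) → ℝ) (k : Fin n) :
    ∑ S, dcoef f {k} S ^ 2 = binf f k := by
  unfold binf
  rw [sum_split_coord k (fun S => if k ∈ S then f S ^ 2 else 0)]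
  refine Finset.sum_congr rfl fun S _ => ?_
  rw [dcoef_singleton]
  split_ifs <;> simp_all

theorem degLE_freeCoef {n d : ℕ} {f : Finset (Fin n) → ℝ} (hf : degLE f d) (k : Fin n) :
    degLE (freeCoef f k) d := by
  intro S hS
  simp [freeCoef, hf S hS]

theorem degLE_dcoef {n d : ℕ} {f : Finset (Fin n) → ℝ} (hf : degLE f d) (T : Finset (Fin n)) :
    degLE (dcoef f T) (d - T.card) := by
  intro S hS
  simp only [dcoef]
  split_ifs with h
  · apply hf
    rw [Finset.card_union_of_disjoint h]
    omega
  · rfl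

theorem peval_of_degLE_zero {n : ℕ} {f : Finset (Fin n) → ℝ} (hf : degLE f 0) (x : Fin n → ℝ) :
    peval f x = f ∅ := by
  unfold peval
  rw [Finset.sum_eq_single ∅]
  · simp
  · intro S _ hS
    rw [hf S (Finset.card_pos.2 (Finset.nonempty_iff_ne_empty.2 hS))]; simp
  · simp

/-- Cauchy–Schwarz for polynomial functions. -/
theorem sq_integral_mul_le {n : ℕ} {ν : Fin n → Measure ℝ} (hν : ∀ i, NiceLaw (ν i))
    {F G : (Fin n → ℝ) → ℝ} (hF : F ∈ polyFun n) (hG : G ∈ polyFun n) :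
    (∫ x, F x * G x ∂(Measure.pi ν)) ^ 2
      ≤ (∫ x, F x ^ 2 ∂(Measure.pi ν)) * ∫ x, G x ^ 2 ∂(Measure.pi ν) := by
  have i1 := integrable_polyFun hν (pow_mem_polyFun hF 2)
  have i2 := integrable_polyFun hν (pow_mem_polyFun hG 2)
  have i3 := integrable_polyFun hν (mul_mem_polyFun hF hG)
  have h : ∀ t : ℝ, 0 ≤ (∫ x, F x ^ 2 ∂(Measure.pi ν)) * (t * t)
      + (2 * ∫ x, F x * G x ∂(Measure.pi ν)) * t + ∫ x, G x ^ 2 ∂(Measure.pi ν) := by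
    intro t
    have : ∫ x, (t * F x + G x) ^ 2 ∂(Measure.pi ν)
        = (∫ x, F x ^ 2 ∂(Measure.pi ν)) * (t * t)
      + (2 * ∫ x, F x * G x ∂(Measure.pi ν)) * t + ∫ x, G x ^ 2 ∂(Measure.pi ν) := by
      have e : ∀ x, (t * F x + G x) ^ 2
          = (t * t) * F x ^ 2 + (2 * t) * (F x * G x) + G x ^ 2 := fun x => by ring
      simp_rw [e]
      rw [integral_add ((i1.const_mul _).fun_add (i3.const_mul _)) i2,
        integral_add (i1.const_mul _) (i3.const_mul _), integral_const_mul, integral_const_mul]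
      ring
    rw [← this]
    exact integral_nonneg fun x => sq_nonneg _
  have := discrim_le_zero h
  unfold discrim at this
  nlinarith

theorem NiceLaw.integral_affine_pow_four {ν : Measure ℝ} (hν : NiceLaw ν) (a b : ℝ) :
    ∫ y, (a + y * b) ^ 4 ∂ν = a ^ 4 + 6 * (a ^ 2 * b ^ 2) + (∫ y, y ^ 4 ∂ν) * b ^ 4 := by
  have := hν.prob
  have e : ∀ y : ℝ, (a + y * b) ^ 4 = a ^ 4 + (4 * a ^ 3 * b) * y ^ 1 + (6 * (a ^ 2 * b ^ 2)) * y ^ 2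
      + (4 * a * b ^ 3) * y ^ 3 + b ^ 4 * y ^ 4 := fun y => by ring
  simp_rw [e]
  have j := fun k c => (hν.int k).const_mul c
  rw [integral_add ((((integrable_const _).fun_add (j 1 _)).fun_add (j 2 _)).fun_add (j 3 _)) (j 4 _),
    integral_add (((integrable_const _).fun_add (j 1 _)).fun_add (j 2 _)) (j 3 _),
    integral_add ((integrable_const _).fun_add (j 1 _)) (j 2 _),
    integral_add (integrable_const _) (j 1 _)]
  have m1 : ∫ y, y ^ 1 ∂ν = 0 := by simpa using hν.m1
  simp only [integral_const_mul, hν.m2, hν.m3, m1]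
  simp
  ring

theorem integral_peval_pow_four_aux {n : ℕ} {ν : Fin n → Measure ℝ} (hν : ∀ i, NiceLaw (ν i))
    (s : Finset (Fin n)) : ∀ (f : Finset (Fin n) → ℝ) (d : ℕ), degLE f d →
      (∀ S, ¬ S ⊆ s → f S = 0) →
      ∫ x, peval f x ^ 4 ∂(Measure.pi ν) ≤ 9 ^ d * (∑ S, f S ^ 2) ^ 2 := by
  have := fun i => (hν i).prob
  have hzero : ∀ (f : Finset (Fin n) → ℝ) (d : ℕ), degLE f 0 →
      ∫ x, peval f x ^ 4 ∂(Measure.pi ν) ≤ 9 ^ d * (∑ S, f S ^ 2) ^ 2 := by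
    intro f d hf
    simp_rw [peval_of_degLE_zero hf]
    have h1 : f ∅ ^ 2 ≤ ∑ S, f S ^ 2 :=
      Finset.single_le_sum (f := fun S => f S ^ 2) (fun S _ => sq_nonneg _) (Finset.mem_univ ∅)
    have h2 : (f ∅ ^ 2) ^ 2 ≤ (∑ S, f S ^ 2) ^ 2 := pow_le_pow_left₀ (sq_nonneg _) h1 2
    have h3 : (1 : ℝ) ≤ 9 ^ d := one_le_pow₀ (by norm_num)
    simp only [integral_const, probReal_univ, smul_eq_mul, one_mul]
    nlinarith [sq_nonneg (∑ S, f S ^ 2)]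
  induction s using Finset.induction_on with
  | empty =>
    intro f d _ hs
    apply hzero
    intro S hS
    apply hs
    rw [Finset.subset_empty]
    exact Finset.nonempty_iff_ne_empty.1 (Finset.card_pos.1 hS)
  | insert k s hk ih =>
    intro f d hf hs
    rcases d with _ | d
    · exact hzero f 0 hf
    have hA := ih (freeCoef f k) (d + 1) (degLE_freeCoef hf k) (by
      intro S hS
      simp only [freeCoef]
      split_ifs with h
      · rfl
      · apply hs
        intro h'
        exact hS ((Finset.subset_insert_iff_of_notMem h).1 h'))
    have hB := ih (dcoef f {k}) d (by simpa using degLE_dcoef hf {k}) (by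
      intro S hS
      rw [dcoef_singleton]
      split_ifs with h
      · rfl
      · apply hs
        intro h'
        exact hS ((Finset.subset_insert_iff_of_notMem h).1
          ((Finset.subset_insert _ _).trans h')))
    rw [sum_sq_split f k]
    set A := ∑ S, freeCoef f k S ^ 2
    set B := ∑ S, dcoef f {k} S ^ 2
    have hA0 : 0 ≤ A := Finset.sum_nonneg fun S _ => sq_nonneg _
    have hB0 : 0 ≤ B := Finset.sum_nonneg fun S _ => sq_nonneg _
    have hup : Function.update ν k (ν k) = ν := Function.update_eq_self k ν
    have pa := peval_mem_polyFun (freeCoef f k)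
    have pb := peval_mem_polyFun (dcoef f {k})
    have key : ∫ x, peval f x ^ 4 ∂(Measure.pi ν)
        = ∫ x, (peval (freeCoef f k) x ^ 4
          + 6 * (peval (freeCoef f k) x ^ 2 * peval (dcoef f {k}) x ^ 2)
          + (∫ y, y ^ 4 ∂(ν k)) * peval (dcoef f {k}) x ^ 4) ∂(Measure.pi ν) := by
      have := integral_pi_update ν (ν k) k (fun x => peval f x ^ 4) (by
        rw [hup]; exact integrable_polyFun hν (pow_mem_polyFun (peval_mem_polyFun f) 4))
      rw [hup] at this
      rw [this]
      simp_rw [peval_update, (hν k).integral_affine_pow_four]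
    rw [key]
    have i1 := integrable_polyFun hν (pow_mem_polyFun pa 4)
    have i2 := integrable_polyFun hν (mul_mem_polyFun (pow_mem_polyFun pa 2)
      (pow_mem_polyFun pb 2))
    have i3 := integrable_polyFun hν (pow_mem_polyFun pb 4)
    rw [integral_add (i1.fun_add (i2.const_mul _)) (i3.const_mul _), integral_add i1 (i2.const_mul _),
      integral_const_mul, integral_const_mul]
    have cs := sq_integral_mul_le hν (pow_mem_polyFun pa 2) (pow_mem_polyFun pb 2)
    simp_rw [← pow_mul] at cs
    norm_num at cs
    set I1 := ∫ x, peval (freeCoef f k) x ^ 4 ∂(Measure.pi ν)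
    set I3 := ∫ x, peval (dcoef f {k}) x ^ 4 ∂(Measure.pi ν)
    set I2 := ∫ x, peval (freeCoef f k) x ^ 2 * peval (dcoef f {k}) x ^ 2 ∂(Measure.pi ν)
    have hI3 : 0 ≤ I3 := integral_nonneg fun x => by positivity
    have h2 : I2 ≤ 9 ^ d * 3 * (A * B) := by
      apply le_of_sq_le_sq _ (by positivity)
      calc I2 ^ 2 ≤ I1 * I3 := cs
        _ ≤ (9 ^ (d + 1) * A ^ 2) * (9 ^ d * B ^ 2) := by gcongr
        _ = (9 ^ d * 3 * (A * B)) ^ 2 := by ring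
    have h3 : (∫ y, y ^ 4 ∂(ν k)) * I3 ≤ 9 * (9 ^ d * B ^ 2) :=
      mul_le_mul (hν k).m4 hB hI3 (by norm_num)
    calc _ ≤ 9 ^ (d + 1) * A ^ 2 + 6 * (9 ^ d * 3 * (A * B)) + 9 * (9 ^ d * B ^ 2) := by gcongr
      _ = 9 ^ (d + 1) * (A + B) ^ 2 := by ring

/-- Bonami's lemma: low-degree polynomials have bounded fourth moments. -/
theorem integral_peval_pow_four {n d : ℕ} {ν : Fin n → Measure ℝ} (hν : ∀ i, NiceLaw (ν i))
    {f : Finset (Fin n) → ℝ} (hf : degLE f d) :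
    ∫ x, peval f x ^ 4 ∂(Measure.pi ν) ≤ 9 ^ d * (∑ S, f S ^ 2) ^ 2 :=
  integral_peval_pow_four_aux hν Finset.univ f d hf (by simp)

/-- The standard Gaussian measure on `ℝ^n`. -/
noncomputable abbrev gaussPi (n : ℕ) : Measure (Fin n → ℝ) :=
  Measure.pi fun _ => gaussianReal 0 1

theorem integral_pow_mul_exp_gaussianReal (k : ℕ) {p p' : ℝ → ℝ}
    (h : ∀ t, ∫ x, x ^ k * Real.exp (t * x) ∂(gaussianReal 0 1) = p t * Real.exp (t ^ 2 / 2))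
    (hp : ∀ t, HasDerivAt p (p' t) t) (t : ℝ) :
    ∫ x, x ^ (k + 1) * Real.exp (t * x) ∂(gaussianReal 0 1)
      = (p' t + t * p t) * Real.exp (t ^ 2 / 2) := by
  have h1 := hasDerivAt_integral_pow_mul_exp_real (X := id) (μ := gaussianReal 0 1) (t := t)
    (by simp) k
  simp only [id] at h1
  rw [funext h] at h1
  have h2 : HasDerivAt (fun t => p t * Real.exp (t ^ 2 / 2))
      (p' t * Real.exp (t ^ 2 / 2) + p t * (Real.exp (t ^ 2 / 2) * t)) t := by
    refine (hp t).mul ?_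
    have := ((hasDerivAt_pow 2 t).div_const 2).exp
    have e : (2 : ℕ) * t ^ (2 - 1) / 2 = t := by norm_num
    rwa [e] at this
  rw [h1.unique h2]
  ring

theorem niceLaw_gaussianReal : NiceLaw (gaussianReal 0 1) := by
  have h0 : ∀ t, ∫ x, x ^ 0 * Real.exp (t * x) ∂(gaussianReal 0 1)
      = (fun _ => 1) t * Real.exp (t ^ 2 / 2) := by
    intro t
    have := congrFun (mgf_id_gaussianReal (μ := 0) (v := 1)) t
    simp only [mgf, id] at this
    simpa using this
  have h1 := integral_pow_mul_exp_gaussianReal 0 h0 (p' := fun _ => 0)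
    (fun t => hasDerivAt_const t 1)
  have h2 := integral_pow_mul_exp_gaussianReal 1 (p := fun t => t) (p' := fun _ => 1)
    (fun t => by rw [h1 t]; simp) (fun t => hasDerivAt_id t)
  have h3 := integral_pow_mul_exp_gaussianReal 2 (p := fun t => 1 + t ^ 2) (p' := fun t => 2 * t)
    (fun t => by rw [h2 t]; ring) (fun t => by
      simpa using (hasDerivAt_pow 2 t).const_add 1)
  have h4 := integral_pow_mul_exp_gaussianReal 3 (p := fun t => 3 * t + t ^ 3)
    (p' := fun t => 3 + 3 * t ^ 2)
    (fun t => by rw [h3 t]; ring) (fun t => by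
      have := ((hasDerivAt_id t).const_mul 3).fun_add (hasDerivAt_pow 3 t)
      simpa using this)
  refine ⟨inferInstance, fun k => ?_, ?_, ?_, ?_, ?_⟩
  · have := (memLp_id_gaussianReal (μ := 0) (v := 1) k).integrable_norm_pow'
    rw [← integrable_norm_iff (by fun_prop)]
    simpa using this
  · simp
  · simpa using h2 0
  · simpa using h3 0
  · have := h4 0
    norm_num at this
    rw [this]; norm_num

/-- The uniform distribution on `Bool`. -/
noncomputable def boolUnif : Measure Bool := (2⁻¹ : ENNReal) • Measure.count

/-- The sign attached to a boolean. -/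
noncomputable def boolSign (b : Bool) : ℝ := if b then 1 else -1

instance : IsProbabilityMeasure boolUnif := by
  constructor
  have : (Measure.count : Measure Bool) Set.univ = 2 := by
    rw [Measure.count_apply_finite _ Set.finite_univ]; simp
  rw [boolUnif, Measure.smul_apply, this, smul_eq_mul]
  exact ENNReal.inv_mul_cancel two_ne_zero ENNReal.ofNat_ne_top

/-- The uniform distribution on `{-1, 1}`. -/
noncomputable def rademacher : Measure ℝ := boolUnif.map boolSign

theorem measurable_boolSign : Measurable boolSign := measurable_of_finite _

theorem boolUnif_singleton (b : Bool) : boolUnif {b} = 2⁻¹ := by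
  simp [boolUnif]

theorem integral_rademacher (F : ℝ → ℝ) (hF : Measurable F) :
    ∫ y, F y ∂rademacher = (F 1 + F (-1)) / 2 := by
  rw [rademacher, integral_map measurable_boolSign.aemeasurable hF.aestronglyMeasurable,
    integral_fintype (Integrable.of_finite)]
  simp [boolUnif_singleton, Measure.real, boolSign]
  ring

theorem niceLaw_rademacher : NiceLaw rademacher := by
  refine ⟨?_, fun k => ?_, ?_, ?_, ?_, ?_⟩
  · exact Measure.isProbabilityMeasure_map measurable_boolSign.aemeasurable
  · rw [rademacher, integrable_map_measure (by fun_prop) measurable_boolSign.aemeasurable]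
    exact Integrable.of_finite
  all_goals
    rw [integral_rademacher _ (by fun_prop)]
    norm_num

theorem integral_pi_rademacher {n : ℕ} (F : (Fin n → ℝ) → ℝ) (hF : Measurable F) :
    ∫ x, F x ∂(Measure.pi fun _ : Fin n => rademacher)
      = (∑ x : Fin n → Bool, F (fun i => if x i then 1 else -1)) / 2 ^ n := by
  have : ∀ i : Fin n, SigmaFinite ((fun _ : Fin n => boolUnif.map boolSign) i) := fun i => by
    have := niceLaw_rademacher.prob
    unfold rademacher at this
    infer_instance
  have h : (Measure.pi fun _ : Fin n => rademacher)
      = (Measure.pi fun _ : Fin n => boolUnif).map (fun x i => boolSign (x i)) := by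
    unfold rademacher
    rw [Measure.pi_map_pi (fun i => measurable_boolSign.aemeasurable)]
  rw [h, integral_map (measurable_of_finite _).aemeasurable hF.aestronglyMeasurable,
    integral_fintype (Integrable.of_finite), Finset.sum_div]
  refine Finset.sum_congr rfl fun x _ => ?_
  simp only [Measure.real, Measure.pi_singleton, boolUnif_singleton, boolSign]
  simp
  field_simp

theorem abs_cos_add_sub_taylor_le (a b : ℝ) :
    |Real.cos (a + b) - (Real.cos a - b * Real.sin a - b ^ 2 / 2 * Real.cos a
      + b ^ 3 / 6 * Real.sin a)| ≤ 4 * b ^ 4 := by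
  have hc := Real.abs_cos_le_one a
  have hs := Real.abs_sin_le_one a
  by_cases hb : |b| ≤ 1
  · have h1 := Real.cos_bound hb
    have h2 := Real.sin_bound hb
    have e : Real.cos (a + b) - (Real.cos a - b * Real.sin a - b ^ 2 / 2 * Real.cos a
      + b ^ 3 / 6 * Real.sin a) = Real.cos a * (Real.cos b - (1 - b ^ 2 / 2))
        - Real.sin a * (Real.sin b - (b - b ^ 3 / 6)) := by
      rw [Real.cos_add]; ring
    rw [e]
    have h4 : |b| ^ 5 ≤ |b| ^ 4 := pow_le_pow_of_le_one (abs_nonneg b) hb (by norm_num)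
    have h5 : |b| ^ 4 = b ^ 4 := by rw [← abs_pow]; exact abs_of_nonneg (by positivity)
    calc _ ≤ |Real.cos a * (Real.cos b - (1 - b ^ 2 / 2))|
          + |Real.sin a * (Real.sin b - (b - b ^ 3 / 6))| := abs_sub _ _
      _ ≤ 1 * (|b| ^ 4 * (5 / 96)) + 1 * (|b| ^ 5 / 100) := by
          rw [abs_mul, abs_mul]; gcongr
      _ ≤ 4 * b ^ 4 := by
          rw [← h5]
          nlinarith [pow_nonneg (abs_nonneg b) 4]
  · push Not at hb
    have h5 : |b| ^ 4 = b ^ 4 := by rw [← abs_pow]; exact abs_of_nonneg (by positivity)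
    have g1 : |b| ≤ |b| ^ 4 := le_self_pow₀ hb.le (by norm_num)
    have g2 : |b| ^ 2 ≤ |b| ^ 4 := pow_le_pow_right₀ hb.le (by norm_num)
    have g3 : |b| ^ 3 ≤ |b| ^ 4 := pow_le_pow_right₀ hb.le (by norm_num)
    have g0 : 1 ≤ |b| ^ 4 := one_le_pow₀ hb.le
    have hcab := Real.abs_cos_le_one (a + b)
    have t1 : |b * Real.sin a| ≤ |b| * 1 := by rw [abs_mul]; gcongr
    have t2 : |b ^ 2 / 2 * Real.cos a| ≤ |b| ^ 2 / 2 * 1 := by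
      rw [abs_mul, abs_div, abs_pow, abs_two]; gcongr
    have t3 : |b ^ 3 / 6 * Real.sin a| ≤ |b| ^ 3 / 6 * 1 := by
      rw [abs_mul, abs_div, abs_pow, abs_of_pos (by norm_num : (0 : ℝ) < 6)]; gcongr
    rw [← h5]
    rw [abs_le] at hc hcab t1 t2 t3 ⊢
    constructor <;> linarith [hc.1, hc.2]

theorem NiceLaw.integrable_cos {ν : Measure ℝ} (hν : NiceLaw ν) (a b : ℝ) :
    Integrable (fun y => Real.cos (a + y * b)) ν := by
  have := hν.prob
  refine Integrable.of_bound (by fun_prop) 1 (ae_of_all _ fun y => ?_)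
  exact Real.abs_cos_le_one _

theorem NiceLaw.abs_integral_cos_sub_le {ν : Measure ℝ} (hν : NiceLaw ν) (a b : ℝ) :
    |∫ y, Real.cos (a + y * b) ∂ν - (Real.cos a - b ^ 2 / 2 * Real.cos a)| ≤ 36 * b ^ 4 := by
  have := hν.prob
  have m1 : ∫ y, y ^ 1 ∂ν = 0 := by simpa using hν.m1
  have j := fun k c => (hν.int k).const_mul c
  have e : ∫ y, (Real.cos a + (-b * Real.sin a) * y ^ 1 + (- b ^ 2 / 2 * Real.cos a) * y ^ 2
      + (b ^ 3 / 6 * Real.sin a) * y ^ 3) ∂ν = Real.cos a - b ^ 2 / 2 * Real.cos a := by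
    rw [integral_add (((integrable_const _).fun_add (j 1 _)).fun_add (j 2 _)) (j 3 _),
    integral_add ((integrable_const _).fun_add (j 1 _)) (j 2 _),
    integral_add (integrable_const _) (j 1 _)]
    simp only [integral_const_mul, hν.m2, hν.m3, m1]
    simp
    ring
  rw [← e, ← integral_sub (hν.integrable_cos a b)
    ((((integrable_const _).fun_add (j 1 _)).fun_add (j 2 _)).fun_add (j 3 _))]
  calc _ ≤ ∫ y, 4 * b ^ 4 * y ^ 4 ∂ν := by
        rw [← Real.norm_eq_abs]
        refine norm_integral_le_of_norm_le (j 4 _) (ae_of_all _ fun y => ?_)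
        have := abs_cos_add_sub_taylor_le a (y * b)
        rw [Real.norm_eq_abs]
        calc _ = |Real.cos (a + y * b) - (Real.cos a - y * b * Real.sin a
              - (y * b) ^ 2 / 2 * Real.cos a + (y * b) ^ 3 / 6 * Real.sin a)| := by
              congr 1; ring
          _ ≤ 4 * (y * b) ^ 4 := this
          _ = _ := by ring
    _ = 4 * b ^ 4 * ∫ y, y ^ 4 ∂ν := integral_const_mul _ _
    _ ≤ 4 * b ^ 4 * 9 := by gcongr; exact hν.m4
    _ = _ := by ring

theorem integrable_cos_peval {n : ℕ} {ν : Fin n → Measure ℝ} [∀ i, IsProbabilityMeasure (ν i)]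
    (f : Finset (Fin n) → ℝ) : Integrable (fun x => Real.cos (peval f x)) (Measure.pi ν) := by
  refine Integrable.of_bound ?_ 1 (ae_of_all _ fun y => Real.abs_cos_le_one _)
  exact (Real.continuous_cos.comp (continuous_peval f)).aestronglyMeasurable

theorem niceLaw_update {n : ℕ} {ν : Fin n → Measure ℝ} (hν : ∀ i, NiceLaw (ν i)) {m : Measure ℝ}
    (hm : NiceLaw m) (k i : Fin n) : NiceLaw (Function.update ν k m i) := by
  by_cases h : i = k
  · subst h; simpa
  · simpa [h] using hν i

/-- Replacing one coordinate's law changes the characteristic function little. -/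
theorem abs_integral_cos_swap_le {n d : ℕ} {ν : Fin n → Measure ℝ} (hν : ∀ i, NiceLaw (ν i))
    {m m' : Measure ℝ} (hm : NiceLaw m) (hm' : NiceLaw m') (k : Fin n)
    {f : Finset (Fin n) → ℝ} (hf : degLE f d) :
    |∫ x, Real.cos (peval f x) ∂(Measure.pi (Function.update ν k m))
      - ∫ x, Real.cos (peval f x) ∂(Measure.pi (Function.update ν k m'))|
      ≤ 72 * 9 ^ d * binf f k ^ 2 := by
  have := fun i => (hν i).prob
  have hp := hm.prob
  have hp' := hm'.prob
  have hu := fun i => (niceLaw_update hν hm k i).prob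
  have hu' := fun i => (niceLaw_update hν hm' k i).prob
  have aux : ∀ {m : Measure ℝ}, NiceLaw m → Integrable (fun x => ∫ y, Real.cos
      (peval (freeCoef f k) x + y * peval (dcoef f {k}) x) ∂m) (Measure.pi ν) := by
    intro m hm
    have := hm.prob
    refine Integrable.of_bound ?_ 1 (ae_of_all _ fun y => ?_)
    · have hc : Continuous (fun p : (Fin n → ℝ) × ℝ => Real.cos
        (peval (freeCoef f k) p.1 + p.2 * peval (dcoef f {k}) p.1)) := by
        have h1 := continuous_peval (freeCoef f k)
        have h2 := continuous_peval (dcoef f {k})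
        fun_prop
      exact (hc.stronglyMeasurable.integral_prod_right (ν := m)).aestronglyMeasurable
    · refine (norm_integral_le_of_norm_le_const (C := 1) (ae_of_all _ fun z => ?_)).trans ?_
      · exact Real.abs_cos_le_one _
      · simp
  rw [integral_pi_update ν m k _ (integrable_cos_peval f),
    integral_pi_update ν m' k _ (integrable_cos_peval f)]
  simp_rw [peval_update]
  rw [← integral_sub (aux hm) (aux hm'), ← Real.norm_eq_abs]
  have hb := integral_peval_pow_four hν (d := d) (f := dcoef f {k}) (by
    intro S hS
    refine degLE_dcoef hf {k} S ?_
    omega)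
  rw [sum_sq_dcoef_singleton] at hb
  calc _ ≤ ∫ x, 72 * peval (dcoef f {k}) x ^ 4 ∂(Measure.pi ν) := by
        refine norm_integral_le_of_norm_le ((integrable_polyFun hν
          (pow_mem_polyFun (peval_mem_polyFun _) 4)).const_mul _) (ae_of_all _ fun x => ?_)
        have h1 := hm.abs_integral_cos_sub_le (peval (freeCoef f k) x) (peval (dcoef f {k}) x)
        have h2 := hm'.abs_integral_cos_sub_le (peval (freeCoef f k) x) (peval (dcoef f {k}) x)
        rw [Real.norm_eq_abs]
        rw [abs_le] at *
        constructor <;> linarith [h1.1, h1.2, h2.1, h2.2]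
    _ ≤ 72 * (9 ^ d * binf f k ^ 2) := by
        rw [integral_const_mul]; gcongr
    _ = _ := by ring

theorem abs_integral_cos_hybrid_le {n d : ℕ} {m m' : Measure ℝ} (hm : NiceLaw m)
    (hm' : NiceLaw m') {f : Finset (Fin n) → ℝ} (hf : degLE f d) (s : Finset (Fin n)) :
    |∫ x, Real.cos (peval f x) ∂(Measure.pi fun i => if i ∈ s then m else m')
      - ∫ x, Real.cos (peval f x) ∂(Measure.pi fun _ => m')|
      ≤ ∑ i ∈ s, 72 * 9 ^ d * binf f i ^ 2 := by
  induction s using Finset.induction_on with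
  | empty => simp
  | insert k s hk ih =>
    have hν : ∀ i, NiceLaw ((fun i => if i ∈ s then m else m') i) := by
      intro i; dsimp only; split_ifs <;> assumption
    have e1 : (fun i => if i ∈ insert k s then m else m')
        = Function.update (fun i => if i ∈ s then m else m') k m := by
      ext1 i
      by_cases h : i = k
      · subst h; simp
      · simp [h]
    have e2 : (fun i => if i ∈ s then m else m')
        = Function.update (fun i => if i ∈ s then m else m') k m' := by
      ext1 i
      by_cases h : i = k
      · subst h; simp [hk]
      · simp [h]
    have := abs_integral_cos_swap_le hν hm hm' k hf
    rw [← e1, ← e2] at this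
    rw [Finset.sum_insert hk]
    exact (abs_sub_le _ _ _).trans (add_le_add this ih)

theorem sum_binf_le {n d : ℕ} {f : Finset (Fin n) → ℝ} (hf : degLE f d) :
    ∑ i, binf f i ≤ d * bvar f := by
  unfold binf bvar
  rw [Finset.sum_comm, Finset.mul_sum]
  refine Finset.sum_le_sum fun S _ => ?_
  have : ∑ i : Fin n, (if i ∈ S then f S ^ 2 else 0) = S.card * f S ^ 2 := by
    rw [← Finset.sum_filter]; simp
  rw [this]
  by_cases hS : d < S.card
  · simp [hf S hS]
  · push Not at hS
    by_cases h : S = ∅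
    · simp [h]
    · simp only [ne_eq, h, not_false_eq_true, if_true]
      gcongr

theorem binf_nonneg {n : ℕ} (f : Finset (Fin n) → ℝ) (i : Fin n) : 0 ≤ binf f i := by
  unfold binf
  exact Finset.sum_nonneg fun S _ => by split_ifs <;> positivity

theorem sum_binf_sq_le {n d : ℕ} {f : Finset (Fin n) → ℝ} {τ : ℝ} (hf : degLE f d)
    (hτ : ∀ i, binf f i ≤ τ) (hv : bvar f = 1) (hτ0 : 0 ≤ τ) : ∑ i, binf f i ^ 2 ≤ τ * d := by
  calc ∑ i, binf f i ^ 2 ≤ ∑ i, τ * binf f i := by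
        refine Finset.sum_le_sum fun i _ => ?_
        rw [pow_two]
        exact mul_le_mul_of_nonneg_right (hτ i) (binf_nonneg f i)
    _ ≤ τ * d := by
        rw [← Finset.mul_sum]
        have := sum_binf_le hf
        rw [hv, mul_one] at this
        gcongr

theorem peval_smul {n : ℕ} (f : Finset (Fin n) → ℝ) (c : ℝ) (x : Fin n → ℝ) :
    peval (fun S => c * f S) x = c * peval f x := by
  simp [peval, Finset.mul_sum, mul_assoc]

theorem binf_smul {n : ℕ} (f : Finset (Fin n) → ℝ) (c : ℝ) (i : Fin n) :
    binf (fun S => c * f S) i = c ^ 2 * binf f i := by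
  simp only [binf, Finset.mul_sum]
  refine Finset.sum_congr rfl fun S _ => ?_
  split_ifs <;> ring

/-- The invariance principle for characteristic functions of regular polynomials. -/
theorem abs_integral_cos_mul_sub_le {n d : ℕ} {f : Finset (Fin n) → ℝ} {τ : ℝ} (hf : degLE f d)
    (hτ : ∀ i, binf f i ≤ τ) (hv : bvar f = 1) (hτ0 : 0 ≤ τ) (c : ℝ) :
    |∫ x, Real.cos (c * peval f x) ∂(Measure.pi fun _ : Fin n => rademacher)
      - ∫ x, Real.cos (c * peval f x) ∂(gaussPi n)| ≤ 72 * 9 ^ d * (τ * d) * c ^ 4 := by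
  have h := abs_integral_cos_hybrid_le niceLaw_rademacher niceLaw_gaussianReal (d := d)
    (f := fun S => c * f S) (fun S hS => by simp [hf S hS]) Finset.univ
  simp only [Finset.mem_univ, if_true, peval_smul, binf_smul] at h
  refine h.trans ?_
  have := sum_binf_sq_le hf hτ hv hτ0
  calc _ = 72 * 9 ^ d * c ^ 4 * ∑ i, binf f i ^ 2 := by
        rw [Finset.mul_sum]
        exact Finset.sum_congr rfl fun i _ => by ring
    _ ≤ 72 * 9 ^ d * c ^ 4 * (τ * d) := by gcongr
    _ = _ := by ring

theorem integral_cos_mul_gaussianReal (z : ℝ) :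
    ∫ s, Real.cos (s * z) ∂(gaussianReal 0 1) = Real.exp (-z ^ 2 / 2) := by
  have h := charFun_gaussianReal (μ := 0) (v := 1) z
  rw [charFun_apply_real] at h
  have h2 := congrArg Complex.re h
  rw [← Complex.reCLM_apply, ← ContinuousLinearMap.integral_comp_comm] at h2
  · simp only [Complex.reCLM_apply] at h2
    have e1 : ∀ x : ℝ, (Complex.exp (z * x * Complex.I)).re = Real.cos (x * z) := by
      intro x
      rw [← Complex.ofReal_mul, Complex.exp_ofReal_mul_I_re, mul_comm]
    simp_rw [e1] at h2
    rw [h2]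
    have : (z * (0 : ℝ) * Complex.I - ((1 : NNReal) : ℝ) * z ^ 2 / 2 : ℂ)
        = ((-z ^ 2 / 2 : ℝ) : ℂ) := by push_cast; ring
    rw [this, Complex.exp_ofReal_re]
  · refine Integrable.of_bound (by fun_prop) 1 (ae_of_all _ fun x => ?_)
    rw [← Complex.ofReal_mul, Complex.norm_exp_ofReal_mul_I]

theorem integral_exp_neg_sq_eq {n : ℕ} (μ : Measure (Fin n → ℝ)) [IsProbabilityMeasure μ]
    (f : Finset (Fin n) → ℝ) (r : ℝ) :
    ∫ x, Real.exp (-(peval f x / r) ^ 2 / 2) ∂μ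
      = ∫ s, ∫ x, Real.cos (s / r * peval f x) ∂μ ∂(gaussianReal 0 1) := by
  rw [integral_integral_swap]
  · refine integral_congr_ae (ae_of_all _ fun x => ?_)
    dsimp only
    rw [← integral_cos_mul_gaussianReal]
    refine integral_congr_ae (ae_of_all _ fun s => ?_)
    dsimp only
    congr 1
    ring
  · refine Integrable.of_bound ?_ 1 (ae_of_all _ fun y => Real.abs_cos_le_one _)
    have : Continuous (fun p : ℝ × (Fin n → ℝ) => Real.cos (p.1 / r * peval f p.2)) := by
      have h1 := continuous_peval f
      fun_prop
    exact this.aestronglyMeasurable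

theorem integral_exp_neg_sq_rademacher_le {n d : ℕ} {f : Finset (Fin n) → ℝ} {τ : ℝ}
    (hf : degLE f d) (hτ : ∀ i, binf f i ≤ τ) (hv : bvar f = 1) (hτ0 : 0 ≤ τ) (r : ℝ) :
    ∫ x, Real.exp (-(peval f x / r) ^ 2 / 2) ∂(Measure.pi fun _ : Fin n => rademacher)
      ≤ ∫ x, Real.exp (-(peval f x / r) ^ 2 / 2) ∂(gaussPi n)
        + 648 * 9 ^ d * (τ * d) / r ^ 4 := by
  have hr := niceLaw_rademacher.prob
  have hg : IsProbabilityMeasure (gaussPi n) := by unfold gaussPi; infer_instance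
  have hcont : ∀ (μ : Measure (Fin n → ℝ)) [IsProbabilityMeasure μ],
      Integrable (fun s => ∫ x, Real.cos (s / r * peval f x) ∂μ) (gaussianReal 0 1) := by
    intro μ _
    refine Integrable.of_bound ?_ 1 (ae_of_all _ fun s => ?_)
    · have : Continuous (fun p : ℝ × (Fin n → ℝ) => Real.cos (p.1 / r * peval f p.2)) := by
        have h1 := continuous_peval f
        fun_prop
      exact (this.stronglyMeasurable.integral_prod_right (ν := μ)).aestronglyMeasurable
    · refine (norm_integral_le_of_norm_le_const (C := 1) (ae_of_all _ fun z => ?_)).trans ?_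
      · exact Real.abs_cos_le_one _
      · simp
  rw [integral_exp_neg_sq_eq, integral_exp_neg_sq_eq, ← sub_le_iff_le_add',
    ← integral_sub (hcont _) (hcont _)]
  have hi4 := (niceLaw_gaussianReal.int 4).const_mul (72 * 9 ^ d * (τ * d) / r ^ 4)
  calc _ ≤ ∫ s, 72 * 9 ^ d * (τ * d) / r ^ 4 * s ^ 4 ∂(gaussianReal 0 1) := by
        refine integral_mono ((hcont _).sub (hcont _)) hi4 fun s => ?_
        refine (le_abs_self _).trans
          ((abs_integral_cos_mul_sub_le hf hτ hv hτ0 (s / r)).trans_eq ?_)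
        rw [div_pow]; ring
    _ ≤ 72 * 9 ^ d * (τ * d) / r ^ 4 * 9 := by
        rw [integral_const_mul]
        gcongr
        exact niceLaw_gaussianReal.m4
    _ = _ := by ring

theorem bprob_le_integral {n : ℕ} (f : Finset (Fin n) → ℝ) {r : ℝ} (hr : 0 < r) :
    bprob n (fun x => |peval f x| ≤ r) ≤ Real.exp (1 / 2) *
      ∫ x, Real.exp (-(peval f x / r) ^ 2 / 2) ∂(Measure.pi fun _ : Fin n => rademacher) := by
  rw [integral_pi_rademacher _ (by have := measurable_peval f; fun_prop), bprob,
    ← mul_div_assoc]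
  gcongr
  rw [Finset.card_filter, Finset.mul_sum]
  push_cast
  refine Finset.sum_le_sum fun x _ => ?_
  rw [← Real.exp_add]
  split_ifs with h
  · rw [Real.one_le_exp_iff]
    have : (peval f (fun i => if x i then 1 else -1) / r) ^ 2 ≤ 1 := by
      rw [sq_le_one_iff_abs_le_one, abs_div, abs_of_pos hr]
      exact (div_le_one hr).2 h
    linarith
  · positivity

/-- Lebesgue measure on one period of the circle. -/
noncomputable abbrev circleMeas : Measure ℝ := volume.restrict (Set.Ioc 0 (2 * Real.pi))

/-- A sum of Cayley transforms, a function of nonnegative real part on the unit disc. -/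
noncomputable def cayleySum (s : Multiset ℂ) (z : ℂ) : ℂ :=
  (s.map fun a => (1 + a * z) / (1 - a * z)).sum

theorem re_cayley_nonneg {w : ℂ} (hw : ‖w‖ ≤ 1) : 0 ≤ ((1 + w) / (1 - w)).re := by
  rw [Complex.div_re, ← add_div]
  apply div_nonneg _ (Complex.normSq_nonneg _)
  have h : w.re * w.re + w.im * w.im ≤ 1 := by
    rw [← Complex.normSq_apply, Complex.normSq_eq_norm_sq]
    nlinarith [norm_nonneg w]
  simp only [Complex.add_re, Complex.one_re, Complex.sub_re, Complex.add_im, Complex.one_im,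
    Complex.sub_im]
  nlinarith

theorem re_cayleySum_nonneg {s : Multiset ℂ} (hs : ∀ a ∈ s, ‖a‖ ≤ 1) {z : ℂ} (hz : ‖z‖ ≤ 1) :
    0 ≤ (cayleySum s z).re := by
  unfold cayleySum
  induction s using Multiset.induction_on with
  | empty => simp
  | cons a s ih =>
    simp only [Multiset.map_cons, Multiset.sum_cons, Complex.add_re]
    refine add_nonneg (re_cayley_nonneg ?_) (ih fun b hb => hs b (Multiset.mem_cons_of_mem hb))
    rw [norm_mul]
    exact mul_le_one₀ (hs a (Multiset.mem_cons_self a s)) (norm_nonneg _) hz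

theorem continuousAt_cayleySum {s : Multiset ℂ} {z : ℂ} (h : ∀ a ∈ s, 1 - a * z ≠ 0) :
    ContinuousAt (cayleySum s) z := by
  unfold cayleySum
  induction s using Multiset.induction_on with
  | empty => simpa using continuousAt_const
  | cons a s ih =>
    simp only [Multiset.map_cons, Multiset.sum_cons]
    refine ContinuousAt.add (ContinuousAt.div (by fun_prop) (by fun_prop)
      (h a (Multiset.mem_cons_self a s))) (ih fun b hb => h b (Multiset.mem_cons_of_mem hb))

theorem differentiableAt_cayleySum {s : Multiset ℂ} {z : ℂ} (h : ∀ a ∈ s, 1 - a * z ≠ 0) :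
    DifferentiableAt ℂ (cayleySum s) z := by
  unfold cayleySum
  induction s using Multiset.induction_on with
  | empty => simp
  | cons a s ih =>
    simp only [Multiset.map_cons, Multiset.sum_cons]
    refine DifferentiableAt.add (DifferentiableAt.div (by fun_prop) (by fun_prop)
      (h a (Multiset.mem_cons_self a s))) (ih fun b hb => h b (Multiset.mem_cons_of_mem hb))

theorem measurable_cayleySum (s : Multiset ℂ) : Measurable (cayleySum s) := by
  unfold cayleySum
  induction s using Multiset.induction_on with
  | empty => simp
  | cons a s ih =>
    simp only [Multiset.map_cons, Multiset.sum_cons]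
    exact Measurable.add (by fun_prop) ih

theorem one_sub_mul_ne_zero {a z : ℂ} (ha : ‖a‖ ≤ 1) (hz : ‖z‖ < 1) : 1 - a * z ≠ 0 := by
  intro h
  have : ‖a * z‖ = 1 := by rw [← sub_eq_zero.1 h]; simp
  rw [norm_mul] at this
  nlinarith [norm_nonneg a, norm_nonneg z]

theorem norm_div_add_le_one {u : ℝ} (hu : 0 < u) {w : ℂ} (hw : 0 ≤ w.re) :
    ‖w / (u + w)‖ ≤ 1 := by
  rw [norm_div]
  apply div_le_one_of_le₀ _ (norm_nonneg _)
  rw [Complex.norm_def, Complex.norm_def]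
  apply Real.sqrt_le_sqrt
  simp only [Complex.normSq_apply, Complex.add_re, Complex.ofReal_re, Complex.add_im,
    Complex.ofReal_im, zero_add]
  nlinarith

theorem re_div_add {u : ℝ} (w : ℂ) :
    (w / (u + w)).re = (u * w.re + ‖w‖ ^ 2) / ‖(u + w : ℂ)‖ ^ 2 := by
  rw [Complex.div_re, ← add_div, ← Complex.normSq_eq_norm_sq, ← Complex.normSq_eq_norm_sq]
  congr 1
  simp [Complex.normSq_apply]
  ring

theorem add_ne_zero_of_re_nonneg {u : ℝ} (hu : 0 < u) {w : ℂ} (hw : 0 ≤ w.re) :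
    (u + w : ℂ) ≠ 0 := by
  intro h
  have := congrArg Complex.re h
  simp at this
  linarith

theorem re_div_add_nonneg {u : ℝ} (hu : 0 < u) {w : ℂ} (hw : 0 ≤ w.re) :
    0 ≤ (w / (u + w)).re := by
  rw [re_div_add]; positivity

theorem quarter_le_re_div_add {u : ℝ} (hu : 0 < u) {w : ℂ} (hw : 0 ≤ w.re) (h : u ≤ ‖w‖) :
    1 / 4 ≤ (w / (u + w)).re := by
  rw [re_div_add]
  have h0 : 0 < ‖(u + w : ℂ)‖ := norm_pos_iff.2 (add_ne_zero_of_re_nonneg hu hw)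
  rw [le_div_iff₀ (by positivity)]
  have h1 : ‖(u + w : ℂ)‖ ≤ 2 * ‖w‖ := by
    calc _ ≤ ‖(u : ℂ)‖ + ‖w‖ := norm_add_le _ _
      _ ≤ 2 * ‖w‖ := by rw [Complex.norm_real, Real.norm_of_nonneg hu.le]; linarith
  have : 0 ≤ u * w.re := by positivity
  nlinarith

theorem circleAverage_cayley {s : Multiset ℂ} (hs : ∀ a ∈ s, ‖a‖ ≤ 1) {u : ℝ} (hu : 0 < u) {r : ℝ}
    (hr0 : 0 < r) (hr : r < 1) :
    ∫ t in (0 : ℝ)..2 * Real.pi, cayleySum s (circleMap 0 r t) / (u + cayleySum s (circleMap 0 r t))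
      = 2 * Real.pi * (s.card / (u + s.card)) := by
  have hd : DifferentiableOn ℂ (fun z => cayleySum s z / (u + cayleySum s z))
      (Metric.closedBall 0 r) := by
    intro z hz
    have hz1 : ‖z‖ < 1 := lt_of_le_of_lt (by simpa using hz) hr
    have h1 : DifferentiableAt ℂ (cayleySum s) z :=
      differentiableAt_cayleySum fun a ha => one_sub_mul_ne_zero (hs a ha) hz1
    refine (h1.div (h1.const_add _) ?_).differentiableWithinAt
    exact add_ne_zero_of_re_nonneg hu (re_cayleySum_nonneg hs hz1.le)
  have hd2 : DiffContOnCl ℂ (fun z => cayleySum s z / (u + cayleySum s z)) (Metric.ball 0 |r|) := by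
    rw [abs_of_pos hr0]
    exact hd.diffContOnCl_ball subset_rfl
  have := hd2.circleAverage
  rw [Real.circleAverage_def] at this
  have h0 : cayleySum s 0 = s.card := by simp [cayleySum]
  rw [h0, inv_smul_eq_iff₀ (by positivity)] at this
  rw [this, Complex.real_smul]
  push_cast
  ring

theorem integral_re_cayley {s : Multiset ℂ} (hs : ∀ a ∈ s, ‖a‖ ≤ 1) {u : ℝ} (hu : 0 < u) :
    ∫ t, (cayleySum s (circleMap 0 1 t) / (u + cayleySum s (circleMap 0 1 t))).re ∂circleMeas
      = 2 * Real.pi * (s.card / (u + s.card)) := by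
  have hm : ∀ r : ℝ, Measurable fun t : ℝ =>
      cayleySum s (circleMap 0 r t) / (u + cayleySum s (circleMap 0 r t)) := by
    intro r
    have h1 : Measurable fun t : ℝ => cayleySum s (circleMap 0 r t) :=
      (measurable_cayleySum s).comp (by unfold circleMap; fun_prop)
    fun_prop
  have hb : ∀ r : ℝ, 0 < r → r ≤ 1 → ∀ t,
      ‖cayleySum s (circleMap 0 r t) / (u + cayleySum s (circleMap 0 r t))‖ ≤ 1 := by
    intro r h0 h1 t
    apply norm_div_add_le_one hu (re_cayleySum_nonneg hs _)
    simpa [abs_of_pos h0] using h1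
  have hev : ∀ᶠ r in nhdsWithin (1 : ℝ) (Set.Iio 1), 0 < r ∧ r < 1 := by
    filter_upwards [self_mem_nhdsWithin, nhdsWithin_le_nhds (lt_mem_nhds one_pos)] with r h1 h2
    exact ⟨h2, h1⟩
  have hlim : Filter.Tendsto (fun r : ℝ => ∫ t, cayleySum s (circleMap 0 r t)
        / (u + cayleySum s (circleMap 0 r t)) ∂circleMeas) (nhdsWithin 1 (Set.Iio 1))
      (nhds (∫ t, cayleySum s (circleMap 0 1 t)
        / (u + cayleySum s (circleMap 0 1 t)) ∂circleMeas)) := by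
    refine tendsto_integral_filter_of_dominated_convergence (fun _ => 1)
      (Filter.Eventually.of_forall fun r => (hm r).aestronglyMeasurable) ?_ (integrable_const _) ?_
    · filter_upwards [hev] with r hr
      exact ae_of_all _ (hb r hr.1 hr.2.le)
    · have hc : ((circleMap 0 1) ⁻¹' {z : ℂ | ∃ a ∈ s, 1 - a * z = 0}).Countable := by
        apply Set.Countable.preimage_circleMap _ 0 one_ne_zero
        have : {z : ℂ | ∃ a ∈ s, 1 - a * z = 0} ⊆ (fun a => a⁻¹) '' {a | a ∈ s} := by
          rintro z ⟨a, ha, h⟩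
          refine ⟨a, ha, ?_⟩
          exact inv_eq_of_mul_eq_one_right (sub_eq_zero.1 h).symm
        refine Set.Countable.mono this (Set.Countable.image ?_ _)
        exact (Multiset.finite_toSet s).countable
      have hae : ∀ᵐ t ∂circleMeas, t ∉ (circleMap 0 1) ⁻¹' {z : ℂ | ∃ a ∈ s, 1 - a * z = 0} :=
        ae_restrict_of_ae (hc.ae_notMem _)
      filter_upwards [hae] with t ht
      simp only [Set.mem_preimage, Set.mem_ofPred_eq, not_exists, not_and] at ht
      have h1 : ContinuousAt (cayleySum s) (circleMap 0 1 t) := continuousAt_cayleySum ht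
      have h2 : ContinuousAt (fun r : ℝ => circleMap 0 r t) 1 := by
        unfold circleMap; fun_prop
      have h3 : ContinuousAt (fun r : ℝ => cayleySum s (circleMap 0 r t)) 1 :=
        ContinuousAt.comp (f := fun r : ℝ => circleMap 0 r t) h1 h2
      have h4 : ContinuousAt (fun r : ℝ => cayleySum s (circleMap 0 r t)
          / (u + cayleySum s (circleMap 0 r t))) 1 := by
        refine h3.div (continuousAt_const.add h3) ?_
        exact add_ne_zero_of_re_nonneg hu (re_cayleySum_nonneg hs (by simp))
      exact h4.tendsto.mono_left nhdsWithin_le_nhds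
  have hconst : ∀ᶠ r in nhdsWithin (1 : ℝ) (Set.Iio 1), (∫ t, cayleySum s (circleMap 0 r t)
        / (u + cayleySum s (circleMap 0 r t)) ∂circleMeas)
      = 2 * Real.pi * (s.card / (u + s.card)) := by
    filter_upwards [hev] with r hr
    rw [← circleAverage_cayley hs hu hr.1 hr.2, intervalIntegral.integral_of_le (by positivity)]
  have hval := tendsto_nhds_unique (hlim.congr' hconst) tendsto_const_nhds
  have hre := congrArg Complex.re hval
  rw [← Complex.reCLM_apply, ← ContinuousLinearMap.integral_comp_comm] at hre
  · simp only [Complex.reCLM_apply] at hre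
    rw [hre]
    have : (2 * Real.pi * (s.card / (u + s.card)) : ℂ)
        = ((2 * Real.pi * (s.card / (u + s.card)) : ℝ) : ℂ) := by push_cast; ring
    rw [this, Complex.ofReal_re]
  · exact Integrable.of_bound (hm 1).aestronglyMeasurable 1 (ae_of_all _ (hb 1 one_pos le_rfl))

/-- Weak-type bound for sums of Cayley transforms on the unit circle. -/
theorem measure_cayleySum_ge_le {s : Multiset ℂ} (hs : ∀ a ∈ s, ‖a‖ ≤ 1) {u : ℝ} (hu : 0 < u) :
    circleMeas.real {t | u ≤ ‖cayleySum s (circleMap 0 1 t)‖} ≤ 2 * Real.pi * (4 * s.card / u) := by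
  have hre : ∀ t, 0 ≤ (cayleySum s (circleMap 0 1 t)).re := fun t =>
    re_cayleySum_nonneg hs (by simp)
  have hm : Measurable fun t : ℝ => cayleySum s (circleMap 0 1 t) :=
    (measurable_cayleySum s).comp (by unfold circleMap; fun_prop)
  have h1 := mul_meas_ge_le_integral_of_nonneg (μ := circleMeas)
    (f := fun t => (cayleySum s (circleMap 0 1 t) / (u + cayleySum s (circleMap 0 1 t))).re)
    (ae_of_all _ fun t => re_div_add_nonneg hu (hre t))
    (by
      refine Integrable.of_bound ?_ 1 (ae_of_all _ fun t => ?_)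
      · exact (Complex.measurable_re.comp (by fun_prop)).aestronglyMeasurable
      · exact (Complex.abs_re_le_norm _).trans (norm_div_add_le_one hu (hre t))) (1 / 4)
  rw [integral_re_cayley hs hu] at h1
  have h2 : circleMeas.real {t | u ≤ ‖cayleySum s (circleMap 0 1 t)‖} ≤ circleMeas.real
      {t | 1 / 4 ≤ (cayleySum s (circleMap 0 1 t) / (u + cayleySum s (circleMap 0 1 t))).re} :=
    measureReal_mono fun t ht => quarter_le_re_div_add hu (hre t) ht
  have h3 : (s.card : ℝ) / (u + s.card) ≤ s.card / u := by
    gcongr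
    linarith [(s.card.cast_nonneg : (0 : ℝ) ≤ s.card)]
  calc _ ≤ 4 * (2 * Real.pi * (s.card / (u + s.card))) := by linarith
    _ ≤ 4 * (2 * Real.pi * (s.card / u)) := by gcongr
    _ = _ := by ring

theorem sum_div_sub_eq_cayley {z : ℂ} (hz : ‖z‖ = 1) (R : Multiset ℂ) (hR : ∀ ζ ∈ R, z ≠ ζ) :
    (R.map fun ζ => z / (z - ζ)).sum = R.card / 2
      + 1 / 2 * ((starRingEnd ℂ) (cayleySum
          ((R.filter fun ζ => ‖ζ‖ ≤ 1).map (starRingEnd ℂ)) z)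
        - cayleySum ((R.filter fun ζ => ¬ ‖ζ‖ ≤ 1).map (·⁻¹)) z) := by
  have hzz : z * (starRingEnd ℂ) z = 1 := by
    rw [Complex.mul_conj, Complex.normSq_eq_norm_sq, hz]; simp
  have hz0 : z ≠ 0 := by rintro rfl; simp at hz
  have hc0 : (starRingEnd ℂ) z ≠ 0 := by simpa using hz0
  induction R using Multiset.induction_on with
  | empty => simp [cayleySum]
  | cons ζ R ih =>
    have ih' := ih fun b hb => hR b (Multiset.mem_cons_of_mem hb)
    have hne : z - ζ ≠ 0 := sub_ne_zero.2 (hR ζ (Multiset.mem_cons_self ζ R))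
    simp only [Multiset.map_cons, Multiset.sum_cons, Multiset.card_cons]
    rw [ih']
    by_cases h : ‖ζ‖ ≤ 1
    · rw [Multiset.filter_cons_of_pos (p := fun ζ : ℂ => ‖ζ‖ ≤ 1) _ h,
        Multiset.filter_cons_of_neg (p := fun ζ : ℂ => ¬ ‖ζ‖ ≤ 1) _ (by simpa using h)]
      simp only [cayleySum, Multiset.map_cons, Multiset.sum_cons, map_add, map_div₀, map_sub,
        map_mul, map_one, Complex.conj_conj]
      have key : z / (z - ζ) = 1 / 2 + 1 / 2 * ((1 + ζ * (starRingEnd ℂ) z)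
          / (1 - ζ * (starRingEnd ℂ) z)) := by
        have e1 : 1 + ζ * (starRingEnd ℂ) z = (starRingEnd ℂ) z * (z + ζ) := by
          rw [← hzz]; ring
        have e2 : 1 - ζ * (starRingEnd ℂ) z = (starRingEnd ℂ) z * (z - ζ) := by
          rw [← hzz]; ring
        rw [e1, e2, mul_div_mul_left _ _ hc0]
        field_simp
        ring
      rw [key]
      push_cast
      ring
    · rw [Multiset.filter_cons_of_neg (p := fun ζ : ℂ => ‖ζ‖ ≤ 1) _ h,
        Multiset.filter_cons_of_pos (p := fun ζ : ℂ => ¬ ‖ζ‖ ≤ 1) _ h]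
      simp only [cayleySum, Multiset.map_cons, Multiset.sum_cons]
      have hζ : ζ ≠ 0 := by rintro rfl; simp at h
      have hne2 : ζ - z ≠ 0 := by rwa [← neg_sub, neg_ne_zero]
      have key : z / (z - ζ) = 1 / 2 - 1 / 2 * ((1 + ζ⁻¹ * z) / (1 - ζ⁻¹ * z)) := by
        have e1 : 1 + ζ⁻¹ * z = ζ⁻¹ * (ζ + z) := by field_simp
        have e2 : 1 - ζ⁻¹ * z = ζ⁻¹ * (ζ - z) := by field_simp
        rw [e1, e2, mul_div_mul_left _ _ (inv_ne_zero hζ)]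
        field_simp
        ring
      rw [key]
      push_cast
      ring

/-- Weak-type bound for the logarithmic derivative of a polynomial on the unit circle. -/
theorem measure_logDeriv_poly_le {P : Polynomial ℂ} {d : ℕ} (hP : P.natDegree ≤ 2 * d) {u : ℝ}
    (hu : 0 < u) :
    circleMeas.real {t | u * ‖P.eval (circleMap 0 1 t)‖
      < ‖circleMap 0 1 t * P.derivative.eval (circleMap 0 1 t) - d * P.eval (circleMap 0 1 t)‖}
      ≤ 2 * Real.pi * (16 * d / u) := by
  by_cases hP0 : P = 0
  · subst hP0
    simp
    positivity
  have htot : circleMeas.real Set.univ = 2 * Real.pi := by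
    simp [Measure.real, Real.pi_nonneg]
  by_cases hud : u < 2 * d
  · refine (measureReal_mono (Set.subset_univ _)).trans ?_
    rw [htot]
    apply le_mul_of_one_le_right (by positivity)
    rw [one_le_div hu]
    have : (0 : ℝ) ≤ d := by positivity
    linarith
  push Not at hud
  set R := P.roots
  have hcard : R.card ≤ 2 * d := (Polynomial.card_roots' P).trans hP
  set s1 := (R.filter fun ζ => ‖ζ‖ ≤ 1).map (starRingEnd ℂ) with hs1
  set s2 := (R.filter fun ζ => ¬ ‖ζ‖ ≤ 1).map (·⁻¹) with hs2
  have hcard2 : s1.card + s2.card = R.card := by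
    rw [hs1, hs2, Multiset.card_map, Multiset.card_map, ← Multiset.card_add,
      Multiset.filter_add_not]
  have h1 : ∀ a ∈ s1, ‖a‖ ≤ 1 := by
    intro a ha
    obtain ⟨b, hb, rfl⟩ := Multiset.mem_map.1 ha
    simpa using (Multiset.mem_filter.1 hb).2
  have h2 : ∀ a ∈ s2, ‖a‖ ≤ 1 := by
    intro a ha
    obtain ⟨b, hb, rfl⟩ := Multiset.mem_map.1 ha
    have := (Multiset.mem_filter.1 hb).2
    push Not at this
    rw [norm_inv]
    exact inv_le_one_of_one_le₀ this.le
  have hZ : circleMeas.real ((circleMap 0 1) ⁻¹' {z : ℂ | P.eval z = 0}) = 0 := by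
    have hfin : {z : ℂ | P.eval z = 0}.Countable := by
      have := P.roots.toFinset.countable_toSet
      refine this.mono fun z hz => ?_
      simpa [hP0] using hz
    have := (hfin.preimage_circleMap 0 one_ne_zero).measure_zero circleMeas
    rw [Measure.real, this, ENNReal.toReal_zero]
  have hsub : {t | u * ‖P.eval (circleMap 0 1 t)‖
      < ‖circleMap 0 1 t * P.derivative.eval (circleMap 0 1 t) - d * P.eval (circleMap 0 1 t)‖}
      ⊆ (circleMap 0 1) ⁻¹' {z : ℂ | P.eval z = 0}
        ∪ ({t | u / 2 ≤ ‖cayleySum s1 (circleMap 0 1 t)‖}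
          ∪ {t | u / 2 ≤ ‖cayleySum s2 (circleMap 0 1 t)‖}) := by
    intro t ht
    simp only [Set.mem_ofPred_eq] at ht
    by_contra hcon
    simp only [Set.mem_union, Set.mem_preimage, Set.mem_ofPred_eq, not_or, not_le] at hcon
    obtain ⟨hne, hc1, hc2⟩ := hcon
    set z := circleMap 0 1 t with hz
    have hz1 : ‖z‖ = 1 := by simp [hz]
    have hlog := (IsAlgClosed.splits P).eval_derivative_div_eval_of_ne_zero hne
    have hRne : ∀ ζ ∈ R, z ≠ ζ := by
      rintro ζ hζ rfl
      exact hne (Polynomial.isRoot_of_mem_roots hζ)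
    have hsum := sum_div_sub_eq_cayley hz1 R hRne
    have hmul : z * (P.derivative.eval z / P.eval z) = (R.map fun ζ => z / (z - ζ)).sum := by
      rw [hlog, ← Multiset.sum_map_mul_left]
      simp [div_eq_mul_inv, R]
    have hbig : u < ‖(R.map fun ζ => z / (z - ζ)).sum - d‖ := by
      rw [← hmul]
      have e : z * P.derivative.eval z - d * P.eval z
          = P.eval z * (z * (P.derivative.eval z / P.eval z) - d) := by
        field_simp
      rw [e, norm_mul, mul_comm u] at ht
      exact lt_of_mul_lt_mul_left ht (norm_nonneg _)
    rw [hsum] at hbig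
    have hb1 : ‖((R.card : ℂ) / 2 - d)‖ ≤ d := by
      have : ((R.card : ℂ) / 2 - d) = (((R.card : ℝ) / 2 - d : ℝ) : ℂ) := by push_cast; ring
      rw [this, Complex.norm_real, Real.norm_eq_abs, abs_le]
      have c0 : (0 : ℝ) ≤ R.card := by positivity
      have c1 : (R.card : ℝ) ≤ 2 * d := by exact_mod_cast hcard
      constructor <;> linarith
    have hb2 : ‖(1 / 2 * ((starRingEnd ℂ) (cayleySum s1 z) - cayleySum s2 z) : ℂ)‖
        ≤ 1 / 2 * (‖cayleySum s1 z‖ + ‖cayleySum s2 z‖) := by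
      rw [norm_mul]
      have : ‖(starRingEnd ℂ) (cayleySum s1 z)‖ = ‖cayleySum s1 z‖ := Complex.norm_conj _
      rw [← this]
      gcongr
      · simp
      · exact norm_sub_le _ _
    have hb3 := norm_add_le ((R.card : ℂ) / 2 - d)
      (1 / 2 * ((starRingEnd ℂ) (cayleySum s1 z) - cayleySum s2 z))
    have e : (R.card : ℂ) / 2 + 1 / 2 * ((starRingEnd ℂ) (cayleySum s1 z) - cayleySum s2 z) - d
      = ((R.card : ℂ) / 2 - d) + 1 / 2 * ((starRingEnd ℂ) (cayleySum s1 z) - cayleySum s2 z) := by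
      ring
    rw [e] at hbig
    linarith
  calc _ ≤ _ := measureReal_mono hsub
    _ ≤ 0 + (2 * Real.pi * (4 * s1.card / (u / 2)) + 2 * Real.pi * (4 * s2.card / (u / 2))) := by
        refine (measureReal_union_le _ _).trans (add_le_add hZ.le ?_)
        exact (measureReal_union_le _ _).trans (add_le_add
          (measure_cayleySum_ge_le h1 (by positivity)) (measure_cayleySum_ge_le h2 (by positivity)))
    _ = 2 * Real.pi * (8 * (R.card : ℝ) / u) := by
        rw [← hcard2]; push_cast; field_simp; ring
    _ ≤ 2 * Real.pi * (8 * (2 * d) / u) := by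
        gcongr
        exact_mod_cast hcard
    _ = _ := by ring

/-- The rotated point `cos t • x + sin t • y`. -/
noncomputable def rot {n : ℕ} (x y : Fin n → ℝ) (t : ℝ) : Fin n → ℝ :=
  fun i => Real.cos t * x i + Real.sin t * y i

/-- The complex polynomial representing `peval g` along a circle. -/
noncomputable def circlePoly {n : ℕ} (g : Finset (Fin n) → ℝ) (d : ℕ) (x y : Fin n → ℝ) :
    Polynomial ℂ :=
  ∑ S : Finset (Fin n), Polynomial.C (g S : ℂ) * (Polynomial.X ^ (d - S.card) *
    ∏ i ∈ S, (Polynomial.C ((x i - y i * Complex.I) / 2) * Polynomial.X ^ 2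
      + Polynomial.C ((x i + y i * Complex.I) / 2)))

theorem natDegree_circlePoly_le {n d : ℕ} {g : Finset (Fin n) → ℝ} (hg : degLE g d)
    (x y : Fin n → ℝ) : (circlePoly g d x y).natDegree ≤ 2 * d := by
  unfold circlePoly
  refine Polynomial.natDegree_sum_le_of_forall_le _ _ fun S _ => ?_
  by_cases hS : d < S.card
  · simp [hg S hS]
  push Not at hS
  refine (Polynomial.natDegree_C_mul_le _ _).trans (Polynomial.natDegree_mul_le.trans ?_)
  have h1 : (∏ i ∈ S, (Polynomial.C ((x i - y i * Complex.I) / 2) * Polynomial.X ^ 2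
      + Polynomial.C ((x i + y i * Complex.I) / 2))).natDegree ≤ ∑ i ∈ S, 2 := by
    refine (Polynomial.natDegree_prod_le _ _).trans (Finset.sum_le_sum fun i _ => ?_)
    compute_degree
  rw [Finset.sum_const, smul_eq_mul] at h1
  rw [Polynomial.natDegree_X_pow]
  omega

theorem eval_circlePoly {n d : ℕ} {g : Finset (Fin n) → ℝ} (hg : degLE g d)
    (x y : Fin n → ℝ) (t : ℝ) : (circlePoly g d x y).eval (circleMap 0 1 t)
      = circleMap 0 1 t ^ d * (peval g (rot x y t) : ℂ) := by
  unfold circlePoly peval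
  rw [Polynomial.eval_finsetSum]
  push_cast
  rw [Finset.mul_sum]
  refine Finset.sum_congr rfl fun S _ => ?_
  by_cases hS : d < S.card
  · simp [hg S hS]
  push Not at hS
  have hi : ∀ i, ((x i - y i * Complex.I) / 2 * circleMap 0 1 t ^ 2 + (x i + y i * Complex.I) / 2)
      = circleMap 0 1 t * (rot x y t i : ℂ) := by
    intro i
    have e : circleMap 0 1 t = Complex.cos t + Complex.sin t * Complex.I := by
      simp [circleMap, Complex.exp_mul_I]
    rw [e]
    unfold rot
    push_cast
    have h1 := Complex.sin_sq_add_cos_sq (t : ℂ)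
    have h2 := Complex.I_sq
    linear_combination (-(x i + y i * Complex.I) / 2 ) * h1 + (- (y i) * (Complex.cos t) * (Complex.sin t) + (x i) * (Complex.sin t)^2/2 - y i * Complex.I * (Complex.sin t) ^ 2 / 2) * h2
  simp only [Polynomial.eval_mul, Polynomial.eval_C, Polynomial.eval_pow, Polynomial.eval_X,
    Polynomial.eval_prod, Polynomial.eval_add]
  simp_rw [hi]
  rw [Finset.prod_mul_distrib, Finset.prod_const]
  have : circleMap 0 1 t ^ d = circleMap 0 1 t ^ (d - S.card) * circleMap 0 1 t ^ S.card := by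
    rw [← pow_add]; congr 1; omega
  rw [this]
  ring

/-- Weak-type bound for the derivative of a polynomial along a rotation. -/
theorem measure_deriv_rot_le {n d : ℕ} {g : Finset (Fin n) → ℝ} (hg : degLE g d)
    (x y : Fin n → ℝ) {f' : ℝ → ℝ}
    (hf' : ∀ t, HasDerivAt (fun t => peval g (rot x y t)) (f' t) t) {u : ℝ} (hu : 0 < u) :
    circleMeas.real {t | u * |peval g (rot x y t)| < |f' t|} ≤ 2 * Real.pi * (16 * d / u) := by
  convert measure_logDeriv_poly_le (natDegree_circlePoly_le hg x y) hu using 3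
  ext t
  have hz1 : ‖circleMap 0 1 t‖ = 1 := by simp
  have hz0 : circleMap 0 1 t ≠ 0 := by intro h; simp [h] at hz1
  have hder : HasDerivAt (fun t : ℝ => (circlePoly g d x y).eval (circleMap 0 1 t))
      ((circlePoly g d x y).derivative.eval (circleMap 0 1 t) * (circleMap 0 1 t * Complex.I)) t :=
    ((circlePoly g d x y).hasDerivAt _).comp t (hasDerivAt_circleMap 0 1 t)
  have hder2 : HasDerivAt (fun t : ℝ => circleMap 0 1 t ^ d * (peval g (rot x y t) : ℂ))
      (d * circleMap 0 1 t ^ (d - 1) * (circleMap 0 1 t * Complex.I)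
        * (peval g (rot x y t) : ℂ) + circleMap 0 1 t ^ d * (f' t : ℂ)) t :=
    ((hasDerivAt_circleMap 0 1 t).fun_pow d).mul (hf' t).ofReal_comp
  rw [funext (eval_circlePoly hg x y)] at hder
  have heq := hder.unique hder2
  have e1 : (d : ℂ) * circleMap 0 1 t ^ (d - 1) * circleMap 0 1 t = d * circleMap 0 1 t ^ d := by
    rcases d with _ | d
    · simp
    · simp [pow_succ, mul_assoc]
  have e2 : Complex.I * (circleMap 0 1 t * (circlePoly g d x y).derivative.eval (circleMap 0 1 t)
      - d * (circlePoly g d x y).eval (circleMap 0 1 t)) = circleMap 0 1 t ^ d * (f' t : ℂ) := by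
    rw [eval_circlePoly hg]
    linear_combination heq + Complex.I * (peval g (rot x y t) : ℂ) * e1
  have e3 := congrArg norm e2
  rw [norm_mul, norm_mul, norm_pow, hz1, one_pow, Complex.norm_I, one_mul, one_mul,
    Complex.norm_real, Real.norm_eq_abs] at e3
  rw [e3, eval_circlePoly hg, norm_mul, norm_pow, hz1, one_pow, one_mul, Complex.norm_real,
    Real.norm_eq_abs]

theorem isGaussian_gaussPi (n : ℕ) : IsGaussian (gaussPi n) := by
  have h2 : iIndepFun (fun (i : Fin n) (ω : Fin n → ℝ) => ω i) (gaussPi n) :=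
    iIndepFun_pi (μ := fun _ : Fin n => gaussianReal 0 1) (X := fun _ (x : ℝ) => x)
      fun _ => aemeasurable_id
  have h1 : ∀ i : Fin n, HasGaussianLaw (fun ω : Fin n → ℝ => ω i) (gaussPi n) := by
    intro i
    constructor
    have := (measurePreserving_eval (fun _ : Fin n => gaussianReal 0 1) i).map_eq
    change IsGaussian (Measure.map (Function.eval (β := fun _ : Fin n => ℝ) i) _)
    rw [this]
    infer_instance
  have := (iIndepFun.hasGaussianLaw h1 h2).isGaussian_map
  rwa [show (fun (ω : Fin n → ℝ) => (fun i => ω i)) = id from rfl, Measure.map_id] at this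

/-- The derivative direction `-sin t • x + cos t • y` of the rotation. -/
noncomputable def rotD {n : ℕ} (x y : Fin n → ℝ) (t : ℝ) : Fin n → ℝ :=
  fun i => -Real.sin t * x i + Real.cos t * y i

theorem map_rot_gaussPi (n : ℕ) (t : ℝ) :
    ((gaussPi n).prod (gaussPi n)).map (fun p => (rot p.1 p.2 t, rotD p.1 p.2 t))
      = (gaussPi n).prod (gaussPi n) := by
  have := isGaussian_gaussPi n
  have h0 : ∫ x, x ∂(gaussPi n) = 0 := by
    ext i
    rw [eval_integral fun i => ?_]
    · have := (measurePreserving_eval (fun _ : Fin n => gaussianReal 0 1) i)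
      have h := integral_map (μ := gaussPi n) (φ := Function.eval i)
        this.measurable.aemeasurable (f := fun y : ℝ => y) (by fun_prop)
      rw [this.map_eq, integral_id_gaussianReal] at h
      exact h.symm
    · exact integrable_polyFun (fun _ => niceLaw_gaussianReal) (coord_mem_polyFun i)
  exact IsGaussian.map_rotation_eq_self h0 t

theorem hasDerivAt_peval_rot {n : ℕ} (g : Finset (Fin n) → ℝ) (x y : Fin n → ℝ) (t : ℝ) :
    HasDerivAt (fun t => peval g (rot x y t))
      (∑ i, rotD x y t i * peval (dcoef g {i}) (rot x y t)) t := by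
  have hr : ∀ i, HasDerivAt (fun t => rot x y t i) (rotD x y t i) t := by
    intro i
    exact ((Real.hasDerivAt_cos t).mul_const (x i)).add ((Real.hasDerivAt_sin t).mul_const (y i))
  have h1 : HasDerivAt (fun t => peval g (rot x y t))
      (∑ S, g S * ∑ i ∈ S, (∏ j ∈ S.erase i, rot x y t j) • rotD x y t i) t := by
    unfold peval
    exact HasDerivAt.fun_sum fun S _ =>
      (HasDerivAt.fun_finsetProd fun i _ => hr i).const_mul (g S)
  convert h1 using 1
  have h2 : ∀ S : Finset (Fin n), g S * ∑ i ∈ S, (∏ j ∈ S.erase i, rot x y t j) • rotD x y t i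
      = ∑ i, if i ∈ S then rotD x y t i * (g S * ∏ j ∈ S.erase i, rot x y t j) else 0 := by
    intro S
    rw [← Finset.sum_filter, Finset.mul_sum]
    simp only [smul_eq_mul]
    refine Finset.sum_congr (by ext; simp) fun i _ => by ring
  simp_rw [h2]
  rw [Finset.sum_comm]
  refine Finset.sum_congr rfl fun i _ => ?_
  rw [sum_split_coord i, peval, Finset.mul_sum]
  refine Finset.sum_congr rfl fun S _ => ?_
  rw [dcoef_singleton]
  by_cases h : i ∈ S <;> simp [h]

/-- Coefficients of a linear form. -/
noncomputable def linCoef {m : ℕ} (a : Fin m → ℝ) : Finset (Fin m) → ℝ :=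
  fun S => ∑ i, if S = {i} then a i else 0

theorem peval_linCoef {m : ℕ} (a h : Fin m → ℝ) : peval (linCoef a) h = ∑ i, a i * h i := by
  simp only [peval, linCoef, Finset.sum_mul]
  rw [Finset.sum_comm]
  simp

theorem sum_linCoef_sq {m : ℕ} (a : Fin m → ℝ) : ∑ S, linCoef a S ^ 2 = ∑ i, a i ^ 2 := by
  simp only [linCoef, pow_two, Finset.sum_mul_sum]
  rw [Finset.sum_comm]
  refine Finset.sum_congr rfl fun i _ => ?_
  rw [Finset.sum_comm]
  simp [Finset.singleton_inj]

theorem degLE_linCoef {m : ℕ} (a : Fin m → ℝ) : degLE (linCoef a) 1 := by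
  intro S hS
  refine Finset.sum_eq_zero fun i _ => if_neg ?_
  rintro rfl
  simp at hS

/-- A Paley–Zygmund inequality. -/
theorem paley_zygmund {α : Type*} [MeasurableSpace α] {μ : Measure α} [IsProbabilityMeasure μ]
    {Z : α → ℝ} (hZm : Measurable Z) (hZ0 : ∀ x, 0 ≤ Z x) (hZ1 : Integrable Z μ)
    (hZ2 : Integrable (fun x => Z x ^ 2) μ) (hZ : ∫ x, Z x ^ 2 ∂μ ≤ 9 * (∫ x, Z x ∂μ) ^ 2) :
    1 / 16 ≤ μ.real {x | (∫ x, Z x ∂μ) / 4 ≤ Z x} := by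
  set m := ∫ x, Z x ∂μ with hm
  have hm0 : 0 ≤ m := integral_nonneg hZ0
  rcases hm0.eq_or_lt with h | hpos
  · rw [← h]
    simp [hZ0]
    norm_num
  set A := {x | m / 4 ≤ Z x} with hA
  have hAm : MeasurableSet A := measurableSet_le measurable_const hZm
  have hpt : ∀ x, Z x ≤ m / 4 + 1 / (24 * m) * Z x ^ 2 + 6 * m * A.indicator 1 x := by
    intro x
    by_cases hx : x ∈ A
    · rw [Set.indicator_of_mem hx, Pi.one_apply]
      have : 0 ≤ (Z x - 12 * m) ^ 2 / (24 * m) := by positivity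
      have e : (Z x - 12 * m) ^ 2 / (24 * m) = 1 / (24 * m) * Z x ^ 2 - Z x + 6 * m := by
        field_simp; ring
      linarith
    · rw [Set.indicator_of_notMem hx]
      have h1 : Z x < m / 4 := not_le.1 hx
      have : 0 ≤ 1 / (24 * m) * Z x ^ 2 := by positivity
      linarith
  have i1 : Integrable (fun x => A.indicator (1 : α → ℝ) x) μ :=
    (integrable_const (1 : ℝ)).indicator hAm
  have i2 : Integrable (fun x => m / 4 + 1 / (24 * m) * Z x ^ 2) μ :=
    (integrable_const _).add (hZ2.const_mul _)
  have h1 := integral_mono hZ1 (i2.add (i1.const_mul (6 * m))) hpt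
  simp only [Pi.add_apply] at h1
  rw [integral_add i2 (i1.const_mul _), integral_add (integrable_const _) (hZ2.const_mul _),
    integral_const_mul, integral_const_mul, integral_indicator_one hAm] at h1
  simp only [integral_const, probReal_univ, one_smul] at h1
  have h2 : 1 / (24 * m) * ∫ x, Z x ^ 2 ∂μ ≤ 1 / (24 * m) * (9 * m ^ 2) := by gcongr
  have e : 1 / (24 * m) * (9 * m ^ 2) = 3 / 8 * m := by field_simp; norm_num
  have h3 : m * (1 / 16) ≤ m * μ.real A := by linarith
  exact le_of_mul_le_mul_left h3 hpos

/-- A sum of squares of linear forms is, with probability bounded below, at least a quarter of its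
mean. -/
theorem measure_sum_sq_ge {m : ℕ} {ι : Type*} [Fintype ι] (b : ι → Fin m → ℝ) :
    1 / 16 ≤ (gaussPi m).real {h | (∑ a, ∑ i, b a i ^ 2) / 4 ≤ ∑ a, (∑ i, b a i * h i) ^ 2} := by
  have hν : ∀ _ : Fin m, NiceLaw (gaussianReal 0 1) := fun _ => niceLaw_gaussianReal
  have hpf : ∀ a, (fun h : Fin m → ℝ => (∑ i, b a i * h i) ^ 2) ∈ polyFun m := fun a =>
    pow_mem_polyFun (sum_mem_polyFun _ fun i _ =>
      mul_mem_polyFun (const_mem_polyFun _) (coord_mem_polyFun i)) 2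
  have hpF : (fun h : Fin m → ℝ => ∑ a, (∑ i, b a i * h i) ^ 2) ∈ polyFun m :=
    sum_mem_polyFun _ fun a _ => hpf a
  have h2 : ∀ a, ∫ h, (∑ i, b a i * h i) ^ 2 ∂(gaussPi m) = ∑ i, b a i ^ 2 := by
    intro a
    simp_rw [← peval_linCoef]
    rw [integral_peval_sq hν, sum_linCoef_sq]
  have h4 : ∀ a, ∫ h, ((∑ i, b a i * h i) ^ 2) ^ 2 ∂(gaussPi m) ≤ 9 * (∑ i, b a i ^ 2) ^ 2 := by
    intro a
    simp_rw [← pow_mul, ← peval_linCoef]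
    have := integral_peval_pow_four hν (degLE_linCoef (b a))
    rwa [sum_linCoef_sq, pow_one] at this
  have hmean : ∫ h, ∑ a, (∑ i, b a i * h i) ^ 2 ∂(gaussPi m) = ∑ a, ∑ i, b a i ^ 2 := by
    rw [integral_finsetSum _ fun a _ => integrable_polyFun hν (hpf a)]
    exact Finset.sum_congr rfl fun a _ => h2 a
  have hsq : ∫ h, (∑ a, (∑ i, b a i * h i) ^ 2) ^ 2 ∂(gaussPi m)
      ≤ 9 * (∑ a, ∑ i, b a i ^ 2) ^ 2 := by
    have e : ∀ h : Fin m → ℝ, (∑ a, (∑ i, b a i * h i) ^ 2) ^ 2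
        = ∑ a, ∑ a', (∑ i, b a i * h i) ^ 2 * (∑ i, b a' i * h i) ^ 2 := by
      intro h; rw [pow_two, Finset.sum_mul_sum]
    simp_rw [e]
    rw [integral_finsetSum _ fun a _ => integrable_finsetSum _ fun a' _ =>
      integrable_polyFun hν (mul_mem_polyFun (hpf a) (hpf a'))]
    rw [pow_two, Finset.sum_mul_sum, Finset.mul_sum]
    refine Finset.sum_le_sum fun a _ => ?_
    rw [integral_finsetSum _ fun a' _ => integrable_polyFun hν (mul_mem_polyFun (hpf a) (hpf a')),
      Finset.mul_sum]
    refine Finset.sum_le_sum fun a' _ => ?_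
    refine abs_le_of_sq_le_sq' ?_ (by positivity) |>.2
    refine (sq_integral_mul_le hν (hpf a) (hpf a')).trans ?_
    calc _ ≤ 9 * (∑ i, b a i ^ 2) ^ 2 * (9 * (∑ i, b a' i ^ 2) ^ 2) :=
          mul_le_mul (h4 a) (h4 a') (integral_nonneg fun _ => by positivity) (by positivity)
      _ = _ := by ring
  have := paley_zygmund (μ := gaussPi m) (Z := fun h => ∑ a, (∑ i, b a i * h i) ^ 2)
    (by fun_prop) (fun h => by positivity) (integrable_polyFun hν hpF)
    (integrable_polyFun hν (pow_mem_polyFun hpF 2)) (by rw [hmean]; exact hsq)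
  rwa [hmean] at this

/-- If every vertical section of `S` over `B` is large, then so is `S`. -/
theorem mul_measure_le_prod {α β : Type*} [MeasurableSpace α] [MeasurableSpace β]
    {μ : Measure α} [IsFiniteMeasure μ] {ν : Measure β} [IsProbabilityMeasure ν]
    {S : Set (α × β)} (hS : MeasurableSet S) {B : Set α} (hB : MeasurableSet B) {c : ℝ}
    (h1 : ∀ a ∈ B, c ≤ ν.real {b | (a, b) ∈ S}) : c * μ.real B ≤ (μ.prod ν).real S := by
  have e1 : (μ.prod ν).real S = ∫ a, ν.real {b | (a, b) ∈ S} ∂μ := by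
    rw [Measure.real, Measure.prod_apply hS, ← integral_toReal]
    · rfl
    · exact (measurable_measure_prodMk_left hS).aemeasurable
    · exact ae_of_all _ fun a => measure_lt_top _ _
  have i1 : Integrable (fun a => ν.real {b | (a, b) ∈ S}) μ := by
    refine Integrable.of_bound
      (measurable_measure_prodMk_left hS).ennreal_toReal.aestronglyMeasurable 1
      (ae_of_all _ fun a => ?_)
    rw [Real.norm_of_nonneg measureReal_nonneg]
    exact measureReal_le_one
  have : c * μ.real B = ∫ a, B.indicator (fun _ => c) a ∂μ := by
    rw [integral_indicator hB]
    simp [mul_comm]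
  rw [this, e1]
  refine integral_mono ((integrable_const c).indicator hB) i1 fun a => ?_
  by_cases ha : a ∈ B
  · rw [Set.indicator_of_mem ha]; exact h1 a ha
  · rw [Set.indicator_of_notMem ha]; exact measureReal_nonneg

/-- If every horizontal section of `S` over `E` is small, and the others are null, then `S` is
small. -/
theorem prod_measure_le_mul {α β : Type*} [MeasurableSpace α] [MeasurableSpace β]
    {μ : Measure α} [IsFiniteMeasure μ] {ν : Measure β} [IsProbabilityMeasure ν]
    {S : Set (α × β)} (hS : MeasurableSet S) {E : Set β} (hE : MeasurableSet E) {M : ℝ}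
    (h2 : ∀ b ∈ E, μ.real {a | (a, b) ∈ S} ≤ M) (h3 : ∀ b ∉ E, μ.real {a | (a, b) ∈ S} ≤ 0) :
    (μ.prod ν).real S ≤ M * ν.real E := by
  have e2 : (μ.prod ν).real S = ∫ b, μ.real {a | (a, b) ∈ S} ∂ν := by
    rw [Measure.real, Measure.prod_apply_symm hS, ← integral_toReal]
    · rfl
    · exact (measurable_measure_prodMk_right hS).aemeasurable
    · exact ae_of_all _ fun a => measure_lt_top _ _
  have i2 : Integrable (fun b => μ.real {a | (a, b) ∈ S}) ν := by
    refine Integrable.of_bound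
      (measurable_measure_prodMk_right hS).ennreal_toReal.aestronglyMeasurable
      (μ.real Set.univ) (ae_of_all _ fun a => ?_)
    rw [Real.norm_of_nonneg measureReal_nonneg]
    exact measureReal_mono (Set.subset_univ _)
  have : M * ν.real E = ∫ a, E.indicator (fun _ => M) a ∂ν := by
    rw [integral_indicator hE]
    simp [mul_comm]
  rw [this, e2]
  refine integral_mono i2 ((integrable_const M).indicator hE) fun a => ?_
  by_cases ha : a ∈ E
  · rw [Set.indicator_of_mem ha]; exact h2 a ha
  · rw [Set.indicator_of_notMem ha]; exact h3 a ha

/-- Averaging: if every vertical section over `B` is large and every horizontal section is small,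
then `B` is small. -/
theorem mul_measure_le_of_sections {α β : Type*} [MeasurableSpace α] [MeasurableSpace β]
    {μ : Measure α} [IsFiniteMeasure μ] {ν : Measure β} [IsProbabilityMeasure ν]
    {S : Set (α × β)} (hS : MeasurableSet S) {B : Set α} (hB : MeasurableSet B) {c M : ℝ}
    (h1 : ∀ a ∈ B, c ≤ ν.real {b | (a, b) ∈ S}) (h2 : ∀ b, μ.real {a | (a, b) ∈ S} ≤ M) :
    c * μ.real B ≤ M := by
  have h := (mul_measure_le_prod (μ := μ) hS hB h1).trans
    (prod_measure_le_mul hS MeasurableSet.univ (fun b _ => h2 b) (by simp))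
  simpa using h

theorem measure_linear_form_sq_gt_le {m : ℕ} (a : Fin m → ℝ) :
    (gaussPi m).real {h | 36 * ∑ i, a i ^ 2 < (∑ i, a i * h i) ^ 2} ≤ 1 / 36 := by
  have hν : ∀ _ : Fin m, NiceLaw (gaussianReal 0 1) := fun _ => niceLaw_gaussianReal
  have hpf : (fun h : Fin m → ℝ => (∑ i, a i * h i) ^ 2) ∈ polyFun m :=
    pow_mem_polyFun (sum_mem_polyFun _ fun i _ =>
      mul_mem_polyFun (const_mem_polyFun _) (coord_mem_polyFun i)) 2
  have h2 : ∫ h, (∑ i, a i * h i) ^ 2 ∂(gaussPi m) = ∑ i, a i ^ 2 := by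
    simp_rw [← peval_linCoef]
    rw [integral_peval_sq hν, sum_linCoef_sq]
  have hs : 0 ≤ ∑ i, a i ^ 2 := by positivity
  rcases hs.eq_or_lt with h | hpos
  · have h0 : ∀ i, a i = 0 := by
      intro i
      have := (Finset.sum_eq_zero_iff_of_nonneg fun i _ => sq_nonneg (a i)).1 h.symm i
        (Finset.mem_univ i)
      simpa using this
    simp [h0]
  · have := mul_meas_ge_le_integral_of_nonneg (μ := gaussPi m)
      (ae_of_all _ fun h => sq_nonneg (∑ i, a i * h i)) (integrable_polyFun hν hpf)
      (36 * ∑ i, a i ^ 2)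
    rw [h2] at this
    have hmono : (gaussPi m).real {h | 36 * ∑ i, a i ^ 2 < (∑ i, a i * h i) ^ 2}
        ≤ (gaussPi m).real {h | 36 * ∑ i, a i ^ 2 ≤ (∑ i, a i * h i) ^ 2} :=
      by
      refine measureReal_mono fun h hh => ?_
      simp only [Set.mem_ofPred_eq] at hh ⊢
      exact hh.le
    refine hmono.trans ?_
    rw [le_div_iff₀ (by norm_num)]
    refine le_of_mul_le_mul_left ?_ hpos
    linarith

/-- A weak-type inequality holding for all linear combinations of a family of pairs of functions
holds for the Euclidean norms of the family. -/
theorem measure_norm_lt_of_linear {m : ℕ} {μ : Measure ℝ} [IsFiniteMeasure μ]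
    {v v' : Fin m → ℝ → ℝ} (hv : ∀ a, Measurable (v a)) (hv' : ∀ a, Measurable (v' a)) {u M : ℝ}
    (hu : 0 < u)
    (H : ∀ h : Fin m → ℝ, μ.real {t | u / 12 * |∑ a, v a t * h a| < |∑ a, v' a t * h a|} ≤ M) :
    μ.real {t | u ^ 2 * ∑ a, v a t ^ 2 < ∑ a, v' a t ^ 2} ≤ 32 * M := by
  have key := mul_measure_le_of_sections (μ := μ) (ν := gaussPi m)
    (S := {p : ℝ × (Fin m → ℝ) | u / 12 * |∑ a, v a p.1 * p.2 a| < |∑ a, v' a p.1 * p.2 a|})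
    (measurableSet_lt (by fun_prop) (by fun_prop))
    (B := {t | u ^ 2 * ∑ a, v a t ^ 2 < ∑ a, v' a t ^ 2})
    (measurableSet_lt (by fun_prop) (by fun_prop)) (c := 1 / 32) (M := M) ?_ H
  · linarith
  intro t ht
  simp only [Set.mem_ofPred_eq] at ht ⊢
  have h1 := measure_sum_sq_ge (ι := Unit) fun _ a => v' a t
  simp only [Finset.univ_unique, Finset.sum_const, Finset.card_singleton, one_smul] at h1
  have h2 := measure_linear_form_sq_gt_le fun a => v a t
  have hsub : {h : Fin m → ℝ | (∑ a, v' a t ^ 2) / 4 ≤ (∑ a, v' a t * h a) ^ 2}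
      ⊆ {h | u / 12 * |∑ a, v a t * h a| < |∑ a, v' a t * h a|}
        ∪ {h | 36 * ∑ a, v a t ^ 2 < (∑ a, v a t * h a) ^ 2} := by
    intro h hh
    by_contra hcon
    simp only [Set.mem_union, Set.mem_ofPred_eq, not_or, not_lt] at hcon hh
    obtain ⟨c1, c2⟩ := hcon
    have c3 : (∑ a, v' a t * h a) ^ 2 ≤ (u / 12 * |∑ a, v a t * h a|) ^ 2 := by
      rw [← sq_abs]
      gcongr
    rw [mul_pow, sq_abs] at c3
    have : (u / 12) ^ 2 * (∑ a, v a t * h a) ^ 2 ≤ (u / 12) ^ 2 * (36 * ∑ a, v a t ^ 2) := by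
      gcongr
    linarith
  have h3 := (measureReal_mono hsub).trans (measureReal_union_le (μ := gaussPi m) _ _)
  linarith

/-- Vector-valued weak-type bound for derivatives of polynomials along rotations. -/
theorem measure_deriv_rot_family_le {n d : ℕ} {ι : Type*} [Fintype ι]
    {g : ι → Finset (Fin n) → ℝ} (hg : ∀ a, degLE (g a) d) (x y : Fin n → ℝ) {u : ℝ} (hu : 0 < u) :
    circleMeas.real {t | u ^ 2 * ∑ a, peval (g a) (rot x y t) ^ 2
      < ∑ a, (∑ i, rotD x y t i * peval (dcoef (g a) {i}) (rot x y t)) ^ 2}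
      ≤ 2 * Real.pi * (6144 * d / u) := by
  set e := (Fintype.equivFin ι).symm
  have hrot : Continuous fun t => rot x y t := by unfold rot; fun_prop
  have hrotD : ∀ i, Continuous fun t => rotD x y t i := by unfold rotD; fun_prop
  have hpe : ∀ f : Finset (Fin n) → ℝ, Continuous fun t => peval f (rot x y t) := fun f =>
    (continuous_peval f).comp hrot
  have key := measure_norm_lt_of_linear (μ := circleMeas)
    (v := fun a t => peval (g (e a)) (rot x y t))
    (v' := fun a t => ∑ i, rotD x y t i * peval (dcoef (g (e a)) {i}) (rot x y t))
    (fun a => (hpe _).measurable)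
    (fun a => (continuous_finsetSum _ fun i _ => (hrotD i).mul (hpe _)).measurable) hu
    (M := 2 * Real.pi * (16 * d / (u / 12))) ?_
  · have e1 : ∀ t, ∑ a, peval (g (e a)) (rot x y t) ^ 2 = ∑ a, peval (g a) (rot x y t) ^ 2 :=
      fun t => Equiv.sum_comp e fun a => peval (g a) (rot x y t) ^ 2
    have e2 : ∀ t, ∑ a, (∑ i, rotD x y t i * peval (dcoef (g (e a)) {i}) (rot x y t)) ^ 2
        = ∑ a, (∑ i, rotD x y t i * peval (dcoef (g a) {i}) (rot x y t)) ^ 2 :=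
      fun t => Equiv.sum_comp e
        fun a => (∑ i, rotD x y t i * peval (dcoef (g a) {i}) (rot x y t)) ^ 2
    simp_rw [e1, e2] at key
    refine key.trans (le_of_eq ?_)
    field_simp
    ring
  · intro h
    have hdeg : degLE (fun S => ∑ a, g (e a) S * h a) d := by
      intro S hS
      exact Finset.sum_eq_zero fun a _ => by rw [hg _ S hS, zero_mul]
    have hpev : ∀ t, peval (fun S => ∑ a, g (e a) S * h a) (rot x y t)
        = ∑ a, peval (g (e a)) (rot x y t) * h a := by
      intro t
      simp only [peval, Finset.sum_mul]
      rw [Finset.sum_comm]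
      exact Finset.sum_congr rfl fun a _ => Finset.sum_congr rfl fun S _ => by ring
    have hder : ∀ t, HasDerivAt (fun t => peval (fun S => ∑ a, g (e a) S * h a) (rot x y t))
        (∑ a, (∑ i, rotD x y t i * peval (dcoef (g (e a)) {i}) (rot x y t)) * h a) t := by
      intro t
      simp_rw [hpev]
      exact HasDerivAt.fun_sum fun a _ => (hasDerivAt_peval_rot _ x y t).mul_const (h a)
    have := measure_deriv_rot_le hdeg x y hder (u := u / 12) (by positivity)
    simp_rw [hpev] at this
    exact this

/-- The set where the gradient of a family of polynomials dominates the family is small, even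
relative to a set `B`. -/
theorem measure_gradient_gt_le {n d : ℕ} {ι : Type*} [Fintype ι]
    {g : ι → Finset (Fin n) → ℝ} (hg : ∀ a, degLE (g a) d) {B : Set (Fin n → ℝ)}
    (hB : MeasurableSet B) {E : Set ((Fin n → ℝ) × (Fin n → ℝ))} (hE : MeasurableSet E)
    (hBE : ∀ x y, ∀ t ∈ Set.Ioc 0 (2 * Real.pi), rot x y t ∈ B → (x, y) ∈ E) {u : ℝ}
    (hu : 0 < u) :
    (gaussPi n).real (B ∩ {x | u ^ 2 * ∑ a, peval (g a) x ^ 2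
      < ∑ a, ∑ i, peval (dcoef (g a) {i}) x ^ 2})
      ≤ 196608 * (d / u) * ((gaussPi n).prod (gaussPi n)).real E := by
  have hpm := fun f : Finset (Fin n) → ℝ => measurable_peval f
  set H : Set ((Fin n → ℝ) × (Fin n → ℝ)) := {p | p.1 ∈ B ∧
    (u / 2) ^ 2 * ∑ a, peval (g a) p.1 ^ 2
      < ∑ a, (∑ i, p.2 i * peval (dcoef (g a) {i}) p.1) ^ 2} with hHdef
  have hH : MeasurableSet H := by
    refine (hB.preimage measurable_fst).inter ?_
    exact measurableSet_lt (f := fun p : (Fin n → ℝ) × (Fin n → ℝ) =>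
        (u / 2) ^ 2 * ∑ a, peval (g a) p.1 ^ 2)
      (g := fun p => ∑ a, (∑ i, p.2 i * peval (dcoef (g a) {i}) p.1) ^ 2)
      (by fun_prop) (by fun_prop)
  have hG : MeasurableSet (B ∩ {x | u ^ 2 * ∑ a, peval (g a) x ^ 2
      < ∑ a, ∑ i, peval (dcoef (g a) {i}) x ^ 2}) :=
    hB.inter (measurableSet_lt (by fun_prop) (by fun_prop))
  set γ2 := (gaussPi n).prod (gaussPi n)
  have decoupling : 1 / 16 * (gaussPi n).real (B ∩ {x | u ^ 2 * ∑ a, peval (g a) x ^ 2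
      < ∑ a, ∑ i, peval (dcoef (g a) {i}) x ^ 2}) ≤ γ2.real H := by
    refine mul_measure_le_prod hH hG ?_
    rintro x ⟨hxB, hx⟩
    simp only [Set.mem_ofPred_eq] at hx
    refine (measure_sum_sq_ge fun a i => peval (dcoef (g a) {i}) x).trans
      (measureReal_mono fun y hy => ⟨hxB, ?_⟩)
    simp only [Set.mem_ofPred_eq] at hy
    simp only [mul_comm (y _)]
    refine lt_of_lt_of_le ?_ hy
    linarith
  set S : Set (ℝ × ((Fin n → ℝ) × (Fin n → ℝ))) :=
    (fun q => (rot q.2.1 q.2.2 q.1, rotD q.2.1 q.2.2 q.1)) ⁻¹' H with hSdef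
  have hmS : Measurable fun q : ℝ × ((Fin n → ℝ) × (Fin n → ℝ)) =>
      (rot q.2.1 q.2.2 q.1, rotD q.2.1 q.2.2 q.1) := by
    unfold rot rotD; fun_prop
  have hS : MeasurableSet S := hH.preimage hmS
  have invariance : γ2.real H * circleMeas.real Set.univ ≤ (circleMeas.prod γ2).real S := by
    refine mul_measure_le_prod hS MeasurableSet.univ fun t _ => le_of_eq ?_
    have hmt : Measurable fun p : (Fin n → ℝ) × (Fin n → ℝ) =>
        (rot p.1 p.2 t, rotD p.1 p.2 t) := by
      unfold rot rotD; fun_prop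
    have h := map_rot_gaussPi n t
    conv_lhs => rw [Measure.real, show γ2 = _ from h.symm, Measure.map_apply hmt hH]
    rfl
  have averaging : (circleMeas.prod γ2).real S
      ≤ 2 * Real.pi * (6144 * d / (u / 2)) * γ2.real E := by
    refine prod_measure_le_mul hS hE (fun p _ => ?_) fun p hp => ?_
    · refine le_trans (measureReal_mono ?_)
        (measure_deriv_rot_family_le hg p.1 p.2 (u := u / 2) (by positivity))
      exact fun t ht => ht.2
    · refine le_of_eq ?_
      rw [Measure.real, Measure.restrict_apply' measurableSet_Ioc]
      have : {t | (t, p) ∈ S} ∩ Set.Ioc 0 (2 * Real.pi) = ∅ := by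
        ext t
        simp only [Set.mem_inter_iff, Set.mem_empty_iff_false, iff_false, not_and]
        exact fun h1 h2 => hp (hBE p.1 p.2 t h2 h1.1)
      rw [this]; simp
  have htot : circleMeas.real Set.univ = 2 * Real.pi := by
    simp [Measure.real, Real.pi_nonneg]
  rw [htot] at invariance
  have h5 : γ2.real H * (2 * Real.pi) ≤ 6144 * d / (u / 2) * γ2.real E * (2 * Real.pi) := by
    refine (invariance.trans averaging).trans (le_of_eq (by ring))
  have h6 := le_of_mul_le_mul_right h5 (by positivity)
  have h7 : 6144 * (d : ℝ) / (u / 2) * γ2.real E = 12288 * (d / u) * γ2.real E := by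
    field_simp; ring
  linarith

/-- The weight `η ^ (2 k) / k !`. -/
noncomputable def wt (η : ℝ) (k : ℕ) : ℝ := η ^ (2 * k) / k.factorial

theorem wt_nonneg (η : ℝ) (k : ℕ) : 0 ≤ wt η k := by
  unfold wt; rw [pow_mul]; positivity

/-- The weighted sum of squares of all derivatives. -/
noncomputable def wsum {n : ℕ} (f : Finset (Fin n) → ℝ) (η : ℝ) (x : Fin n → ℝ) : ℝ :=
  ∑ T : Finset (Fin n), wt η T.card * peval (dcoef f T) x ^ 2

theorem dcoef_smul {n : ℕ} (f : Finset (Fin n) → ℝ) (c : ℝ) (T : Finset (Fin n)) :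
    dcoef (fun S => c * f S) T = fun S => c * dcoef f T S := by
  ext U; simp [dcoef]

theorem dcoef_dcoef_singleton {n : ℕ} (f : Finset (Fin n) → ℝ) (T : Finset (Fin n)) (i : Fin n) :
    dcoef (dcoef f T) {i} = if i ∈ T then 0 else dcoef f (insert i T) := by
  ext U
  rw [dcoef_singleton]
  by_cases h : i ∈ T
  · simp [dcoef, h]
  · by_cases h' : i ∈ U
    · simp [dcoef, h, h']
    · simp [dcoef, h, h', Finset.insert_union, Finset.union_insert]

theorem dcoef_empty {n : ℕ} (f : Finset (Fin n) → ℝ) : dcoef f ∅ = f := by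
  ext U; simp [dcoef]

theorem mul_wt_pred {η : ℝ} (hη : 0 < η) (k : ℕ) :
    k * wt η (k - 1) = η⁻¹ ^ 2 * (k ^ 2 * wt η k) := by
  rcases k with _ | k
  · simp
  · have h1 : (k.factorial : ℝ) ≠ 0 := by positivity
    simp only [wt, Nat.add_sub_cancel, Nat.factorial_succ]
    push_cast
    field_simp
    ring

theorem sum_gradient_sq {n : ℕ} (f : Finset (Fin n) → ℝ) {η : ℝ} (hη : 0 < η) (x : Fin n → ℝ) :
    ∑ T : Finset (Fin n), ∑ i,
      peval (dcoef (fun S => √(wt η T.card) * dcoef f T S) {i}) x ^ 2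
      = η⁻¹ ^ 2 * ∑ T : Finset (Fin n),
        (T.card : ℝ) ^ 2 * (wt η T.card * peval (dcoef f T) x ^ 2) := by
  have h1 : ∀ (T : Finset (Fin n)) i,
      peval (dcoef (fun S => √(wt η T.card) * dcoef f T S) {i}) x ^ 2
      = if i ∈ T then 0 else wt η T.card * peval (dcoef f (insert i T)) x ^ 2 := by
    intro T i
    rw [dcoef_smul, peval_smul, mul_pow, Real.sq_sqrt (wt_nonneg _ _), dcoef_dcoef_singleton]
    split_ifs
    · simp [peval]
    · rfl
  simp_rw [h1]
  rw [Finset.sum_comm]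
  have h2 : ∀ i : Fin n, ∑ T : Finset (Fin n),
      (if i ∈ T then 0 else wt η T.card * peval (dcoef f (insert i T)) x ^ 2)
      = ∑ T : Finset (Fin n),
        if i ∈ T then wt η (T.card - 1) * peval (dcoef f T) x ^ 2 else 0 := by
    intro i
    rw [sum_split_coord i fun T : Finset (Fin n) =>
      if i ∈ T then wt η (T.card - 1) * peval (dcoef f T) x ^ 2 else 0]
    refine Finset.sum_congr rfl fun T _ => ?_
    by_cases h : i ∈ T <;> simp [h]
  simp_rw [h2]
  rw [Finset.sum_comm, Finset.mul_sum]
  refine Finset.sum_congr rfl fun T _ => ?_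
  rw [← Finset.sum_filter, Finset.sum_const, nsmul_eq_mul]
  have : (Finset.univ.filter fun i => i ∈ T) = T := by ext; simp
  rw [this]
  linear_combination (mul_wt_pred hη T.card) * peval (dcoef f T) x ^ 2

theorem sum_mul_quarter_pow_ge {ι : Type*} [Fintype ι] {p : ι → ℝ} (hp : ∀ a, 0 ≤ p a)
    (k : ι → ℕ) {κ : ℝ} (hκ : 0 < κ) (h : ∑ a, (k a : ℝ) ^ 2 * p a ≤ κ ^ 2 * ∑ a, p a) :
    Real.exp (-(Real.log 4 * κ)) * ∑ a, p a ≤ ∑ a, p a * (1 / 4) ^ k a := by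
  have hlog : 0 < Real.log 4 := Real.log_pos (by norm_num)
  have hmean : ∑ a, (k a : ℝ) * p a ≤ κ * ∑ a, p a := by
    have h1 : ∑ a, (k a : ℝ) * p a ≤ ∑ a, (1 / (2 * κ) * ((k a : ℝ) ^ 2 * p a) + κ / 2 * p a) := by
      refine Finset.sum_le_sum fun a _ => ?_
      have : 0 ≤ ((k a : ℝ) - κ) ^ 2 / (2 * κ) * p a := mul_nonneg (by positivity) (hp a)
      have e : ((k a : ℝ) - κ) ^ 2 / (2 * κ) * p a
        = 1 / (2 * κ) * ((k a : ℝ) ^ 2 * p a) + κ / 2 * p a - k a * p a := by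
        field_simp; ring
      linarith
    rw [Finset.sum_add_distrib, ← Finset.mul_sum, ← Finset.mul_sum] at h1
    have h2 : 1 / (2 * κ) * ∑ a, (k a : ℝ) ^ 2 * p a ≤ 1 / (2 * κ) * (κ ^ 2 * ∑ a, p a) := by
      gcongr
    have e : 1 / (2 * κ) * (κ ^ 2 * ∑ a, p a) = κ / 2 * ∑ a, p a := by field_simp
    linarith
  have hpt : ∀ a, p a * (Real.exp (-(Real.log 4 * κ)) * (1 - Real.log 4 * (k a - κ)))
      ≤ p a * (1 / 4) ^ k a := by
    intro a
    refine mul_le_mul_of_nonneg_left ?_ (hp a)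
    have e1 : ((1 : ℝ) / 4) ^ k a = Real.exp (-(Real.log 4 * κ))
        * Real.exp (-(Real.log 4 * (k a - κ))) := by
      rw [← Real.exp_add, one_div, inv_pow, ← Real.exp_log (show (0 : ℝ) < 4 by norm_num),
        ← Real.exp_nat_mul, ← Real.exp_neg, Real.log_exp]
      congr 1; ring
    rw [e1]
    refine mul_le_mul_of_nonneg_left ?_ (Real.exp_nonneg _)
    have := Real.add_one_le_exp (-(Real.log 4 * (k a - κ)))
    linarith
  refine le_trans ?_ (Finset.sum_le_sum fun a _ => hpt a)
  have e2 : ∑ a, p a * (Real.exp (-(Real.log 4 * κ)) * (1 - Real.log 4 * (k a - κ)))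
      = Real.exp (-(Real.log 4 * κ)) * (∑ a, p a
        + Real.log 4 * (κ * ∑ a, p a - ∑ a, (k a : ℝ) * p a)) := by
    rw [Finset.mul_sum Finset.univ p κ, ← Finset.sum_sub_distrib, Finset.mul_sum,
      ← Finset.sum_add_distrib, Finset.mul_sum]
    exact Finset.sum_congr rfl fun a _ => by ring
  rw [e2]
  refine mul_le_mul_of_nonneg_left ?_ (Real.exp_nonneg _)
  have := mul_nonneg hlog.le (sub_nonneg.2 hmean)
  linarith

theorem wsum_half {n : ℕ} (f : Finset (Fin n) → ℝ) (η : ℝ) (x : Fin n → ℝ) :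
    wsum f (η / 2) x
      = ∑ T : Finset (Fin n), wt η T.card * peval (dcoef f T) x ^ 2 * (1 / 4) ^ T.card := by
  unfold wsum wt
  refine Finset.sum_congr rfl fun T _ => ?_
  rw [div_pow, pow_mul 2 2, show (2 : ℝ) ^ 2 = 4 by norm_num, one_div, inv_pow]
  field_simp

theorem wsum_zero {n : ℕ} (f : Finset (Fin n) → ℝ) (x : Fin n → ℝ) :
    wsum f 0 x = peval f x ^ 2 := by
  unfold wsum
  rw [Finset.sum_eq_single ∅]
  · simp [wt, dcoef_empty]
  · intro T _ hT
    have : T.card ≠ 0 := by simpa using hT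
    simp [wt, this]
  · simp

theorem continuous_wsum {n : ℕ} (f : Finset (Fin n) → ℝ) (x : Fin n → ℝ) :
    Continuous fun η => wsum f η x := by
  unfold wsum wt; fun_prop

theorem wsum_nonneg {n : ℕ} (f : Finset (Fin n) → ℝ) (η : ℝ) (x : Fin n → ℝ) :
    0 ≤ wsum f η x :=
  Finset.sum_nonneg fun _ _ => mul_nonneg (wt_nonneg _ _) (sq_nonneg _)

/-- If the derivatives are controlled at all dyadic scales, then the polynomial is not much smaller
than its weighted derivative norm. -/
theorem sq_peval_ge_of_forall_scale {n d : ℕ} (hd : 0 < d) (f : Finset (Fin n) → ℝ) (ε : ℝ)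
    (x : Fin n → ℝ)
    (h : ∀ i : ℕ, ∑ T : Finset (Fin n),
        (T.card : ℝ) ^ 2 * (wt (ε / 2 ^ i) T.card * peval (dcoef f T) x ^ 2)
      ≤ (d * (3 / 4) ^ i) ^ 2 * wsum f (ε / 2 ^ i) x) :
    (1 / 256) ^ d * wsum f ε x ≤ peval f x ^ 2 := by
  have hd' : (0 : ℝ) < d := by exact_mod_cast hd
  have hlog : 0 < Real.log 4 := Real.log_pos (by norm_num)
  have hstep : ∀ I : ℕ, Real.exp (-(Real.log 4 * (d * ∑ i ∈ Finset.range I, (3 / 4 : ℝ) ^ i)))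
      * wsum f ε x ≤ wsum f (ε / 2 ^ I) x := by
    intro I
    induction I with
    | zero => simp
    | succ I ih =>
      have h1 := sum_mul_quarter_pow_ge
        (fun T : Finset (Fin n) => mul_nonneg (wt_nonneg (ε / 2 ^ I) T.card)
          (sq_nonneg (peval (dcoef f T) x))) (fun T => T.card) (κ := d * (3 / 4) ^ I)
        (by positivity) (h I)
      rw [← wsum_half] at h1
      rw [pow_succ, ← div_div]
      refine le_trans ?_ h1
      change _ ≤ _ * wsum f (ε / 2 ^ I) x
      rw [Finset.sum_range_succ]
      calc _ = Real.exp (-(Real.log 4 * (d * (3 / 4) ^ I)))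
            * (Real.exp (-(Real.log 4 * (d * ∑ i ∈ Finset.range I, (3 / 4 : ℝ) ^ i)))
              * wsum f ε x) := by
            rw [← mul_assoc (Real.exp _) (Real.exp _), ← Real.exp_add]; congr 2; ring
        _ ≤ _ := by gcongr
  have hbound : ∀ I : ℕ, (1 / 256) ^ d * wsum f ε x ≤ wsum f (ε / 2 ^ I) x := by
    intro I
    refine le_trans ?_ (hstep I)
    refine mul_le_mul_of_nonneg_right ?_ (wsum_nonneg _ _ _)
    have e : ((1 : ℝ) / 256) ^ d = Real.exp (-(Real.log 4 * (d * 4))) := by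
      have : Real.log 4 * (d * 4) = (d : ℕ) * Real.log 256 := by
        rw [show (256 : ℝ) = 4 ^ 4 by norm_num, Real.log_pow]; push_cast; ring
      rw [this, Real.exp_neg, Real.exp_nat_mul, Real.exp_log (by norm_num), one_div, inv_pow]
    rw [e]
    have hgeo : ∑ i ∈ Finset.range I, (3 / 4 : ℝ) ^ i ≤ 4 := by
      rw [geom_sum_eq (by norm_num)]
      have : (0 : ℝ) ≤ (3 / 4) ^ I := by positivity
      rw [div_le_iff_of_neg (by norm_num)]
      linarith
    gcongr
  have hlim : Filter.Tendsto (fun I : ℕ => wsum f (ε / 2 ^ I) x) Filter.atTop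
      (nhds (peval f x ^ 2)) := by
    rw [← wsum_zero]
    refine ((continuous_wsum f x).tendsto 0).comp ?_
    have : Filter.Tendsto (fun I : ℕ => ε * (1 / 2 : ℝ) ^ I) Filter.atTop (nhds (ε * 0)) :=
      (tendsto_pow_atTop_nhds_zero_of_lt_one (by norm_num) (by norm_num)).const_mul ε
    simpa [div_eq_mul_inv] using this
  exact ge_of_tendsto' hlim hbound

theorem measureReal_iUnion_le_tsum {α : Type*} [MeasurableSpace α] {μ : Measure α}
    [IsFiniteMeasure μ] {A : ℕ → Set α} {b : ℕ → ℝ} (hb : Summable b)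
    (hA : ∀ i, μ.real (A i) ≤ b i) : μ.real (⋃ i, A i) ≤ ∑' i, b i := by
  have hb0 : ∀ i, 0 ≤ b i := fun i => measureReal_nonneg.trans (hA i)
  refine ENNReal.toReal_le_of_le_ofReal (tsum_nonneg hb0) ?_
  rw [ENNReal.ofReal_tsum_of_nonneg hb0 hb]
  refine (measure_iUnion_le _).trans (ENNReal.tsum_le_tsum fun i => ?_)
  rw [← ofReal_measureReal]
  exact ENNReal.ofReal_le_ofReal (hA i)

/-- Relative to a set `B`, the polynomial is rarely much smaller than its weighted derivative
norm. -/
theorem measure_sq_peval_lt_wsum_le {n d : ℕ} (hd : 0 < d) {f : Finset (Fin n) → ℝ}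
    (hf : degLE f d) {B : Set (Fin n → ℝ)} (hB : MeasurableSet B)
    {E : Set ((Fin n → ℝ) × (Fin n → ℝ))} (hE : MeasurableSet E)
    (hBE : ∀ x y, ∀ t ∈ Set.Ioc 0 (2 * Real.pi), rot x y t ∈ B → (x, y) ∈ E) {ε : ℝ}
    (hε : 0 < ε) :
    (gaussPi n).real (B ∩ {x | peval f x ^ 2 < (1 / 256) ^ d * wsum f ε x})
      ≤ 589824 * ε * ((gaussPi n).prod (gaussPi n)).real E := by
  have hd' : (0 : ℝ) < d := by exact_mod_cast hd
  set P := ((gaussPi n).prod (gaussPi n)).real E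
  set A : ℕ → Set (Fin n → ℝ) := fun i => B ∩ {x | (d * (3 / 2) ^ i / ε) ^ 2 *
      ∑ T : Finset (Fin n), peval (fun S => √(wt (ε / 2 ^ i) T.card) * dcoef f T S) x ^ 2
      < ∑ T : Finset (Fin n), ∑ j,
        peval (dcoef (fun S => √(wt (ε / 2 ^ i) T.card) * dcoef f T S) {j}) x ^ 2}
  have hA : ∀ i, (gaussPi n).real (A i) ≤ 196608 * ε * P * (2 / 3) ^ i := by
    intro i
    refine (measure_gradient_gt_le (d := d) (fun T S hS => ?_) hB hE hBE
      (u := d * (3 / 2) ^ i / ε) (by positivity)).trans (le_of_eq ?_)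
    · rw [degLE_dcoef hf T S (by omega), mul_zero]
    · rw [show (2 / 3 : ℝ) = (3 / 2)⁻¹ by norm_num, inv_pow]
      field_simp
      rfl
  have hsub : B ∩ {x | peval f x ^ 2 < (1 / 256) ^ d * wsum f ε x} ⊆ ⋃ i, A i := by
    rintro x ⟨hxB, hx⟩
    simp only [Set.mem_ofPred_eq] at hx
    by_contra hcon
    simp only [Set.mem_iUnion, not_exists] at hcon
    refine absurd (sq_peval_ge_of_forall_scale hd f ε x fun i => ?_) (not_le.2 hx)
    have h1 := hcon i
    simp only [A, Set.mem_inter_iff, hxB, true_and, Set.mem_ofPred_eq, not_lt] at h1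
    have hη : 0 < ε / 2 ^ i := by positivity
    rw [sum_gradient_sq f hη] at h1
    have e : ∑ T : Finset (Fin n), peval (fun S => √(wt (ε / 2 ^ i) T.card) * dcoef f T S) x ^ 2
        = wsum f (ε / 2 ^ i) x := by
      unfold wsum
      refine Finset.sum_congr rfl fun T _ => ?_
      rw [peval_smul, mul_pow, Real.sq_sqrt (wt_nonneg _ _)]
    rw [e] at h1
    have h2 := mul_le_mul_of_nonneg_left h1 (sq_nonneg (ε / 2 ^ i))
    rw [← mul_assoc, ← mul_pow, mul_inv_cancel₀ hη.ne', one_pow, one_mul, ← mul_assoc,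
      ← mul_pow] at h2
    have e' : ε / 2 ^ i * (d * (3 / 2) ^ i / ε) = d * (3 / 4) ^ i := by
      rw [show (3 / 4 : ℝ) ^ i = (3 / 2) ^ i / 2 ^ i by rw [← div_pow]; norm_num]
      field_simp
    rw [e'] at h2
    exact h2
  have hsum : Summable fun i : ℕ => 196608 * ε * P * (2 / 3 : ℝ) ^ i :=
    (summable_geometric_of_lt_one (by norm_num) (by norm_num)).mul_left _
  refine ((measureReal_mono hsub).trans (measureReal_iUnion_le_tsum hsum hA)).trans (le_of_eq ?_)
  rw [tsum_mul_left, tsum_geometric_of_lt_one (by norm_num) (by norm_num)]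
  norm_num
  ring

/-- The coefficients of `∑ T, w_T f_T ∂_T q`, where `q` is the polynomial with coefficients `f`. -/
noncomputable def lcoef {n : ℕ} (f : Finset (Fin n) → ℝ) (η : ℝ) : Finset (Fin n) → ℝ :=
  fun U => ∑ T : Finset (Fin n), wt η T.card * (f T * dcoef f T U)

theorem lcoef_empty {n : ℕ} (f : Finset (Fin n) → ℝ) (η : ℝ) :
    lcoef f η ∅ = ∑ T : Finset (Fin n), wt η T.card * f T ^ 2 := by
  refine Finset.sum_congr rfl fun T _ => ?_
  simp [dcoef, pow_two]

theorem peval_lcoef {n : ℕ} (f : Finset (Fin n) → ℝ) (η : ℝ) (x : Fin n → ℝ) :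
    peval (lcoef f η) x = ∑ T : Finset (Fin n), wt η T.card * (f T * peval (dcoef f T) x) := by
  simp only [peval, lcoef, Finset.sum_mul, Finset.mul_sum]
  rw [Finset.sum_comm]
  exact Finset.sum_congr rfl fun a _ => Finset.sum_congr rfl fun S _ => by ring

theorem sq_sum_wt_mul_le {n : ℕ} (η : ℝ) (a b : Finset (Fin n) → ℝ) :
    (∑ T, wt η T.card * (a T * b T)) ^ 2
      ≤ (∑ T, wt η T.card * a T ^ 2) * ∑ T, wt η T.card * b T ^ 2 :=
  Finset.sum_sq_le_sum_mul_sum_of_sq_le_mul _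
    (fun T _ => mul_nonneg (wt_nonneg _ _) (sq_nonneg _))
    (fun T _ => mul_nonneg (wt_nonneg _ _) (sq_nonneg _)) fun T _ => le_of_eq (by ring)

theorem sq_peval_lcoef_le {n : ℕ} (f : Finset (Fin n) → ℝ) (η : ℝ) (x : Fin n → ℝ) :
    peval (lcoef f η) x ^ 2 ≤ lcoef f η ∅ * wsum f η x := by
  rw [peval_lcoef, lcoef_empty]
  exact sq_sum_wt_mul_le η f fun T => peval (dcoef f T) x

theorem one_le_wt {η : ℝ} {k : ℕ} (hη : 1 ≤ η) (hk : k ≤ η) : 1 ≤ wt η k := by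
  unfold wt
  rw [le_div_iff₀ (by positivity), one_mul]
  calc (k.factorial : ℝ) ≤ (k : ℝ) ^ k := by exact_mod_cast Nat.factorial_le_pow k
    _ ≤ η ^ k := by gcongr
    _ ≤ η ^ (2 * k) := pow_le_pow_right₀ hη (by omega)

theorem one_le_lcoef_empty {n d : ℕ} {f : Finset (Fin n) → ℝ} (hf : degLE f d)
    (hv : bvar f = 1) {η : ℝ} (h1 : 1 ≤ η) (hη : d ≤ η) : 1 ≤ lcoef f η ∅ := by
  rw [← hv, lcoef_empty]
  refine Finset.sum_le_sum fun T _ => ?_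
  have h0 : 0 ≤ wt η T.card * f T ^ 2 := mul_nonneg (wt_nonneg _ _) (sq_nonneg _)
  split_ifs with h
  · rcases le_or_gt T.card d with hT | hT
    · have := one_le_wt h1 (le_trans (by exact_mod_cast hT) hη : (T.card : ℝ) ≤ η)
      exact le_mul_of_one_le_left (sq_nonneg _) this
    · rw [hf T hT]; simp
  · exact h0

theorem choose_mul_wt_le {d s j : ℕ} {η : ℝ} (hη : 0 < η) (hs : s ≤ d) (hj : j ≤ s) (h0 : j ≠ 0) :
    (s.choose j : ℝ) * (j * wt η (s - j)) ≤ wt η s * ((d / η) ^ 2) ^ j := by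
  obtain ⟨k, rfl⟩ := Nat.exists_eq_add_of_le hj
  rw [Nat.add_sub_cancel_left]
  have hc : ((j + k).choose j : ℝ) * (j.factorial * k.factorial) = (j + k).factorial := by
    have := Nat.add_choose_mul_factorial_mul_factorial j k
    rw [← Nat.choose_symm_add] at this
    rw [← mul_assoc]; exact_mod_cast this
  have hk : ((j + k).factorial : ℝ) ≤ k.factorial * d ^ j := by
    have h1 : (j + k).factorial = k.factorial * (j + k).descFactorial j := by
      have := Nat.factorial_mul_descFactorial (n := j + k) (k := j) (by omega)
      rw [← this, Nat.add_sub_cancel_left]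
    have h2 : (j + k).descFactorial j ≤ d ^ j :=
      (Nat.descFactorial_le_pow _ _).trans (Nat.pow_le_pow_left hs j)
    rw [h1]
    push_cast
    gcongr
    exact_mod_cast h2
  have hjf : (j : ℝ) ≤ j.factorial := by exact_mod_cast Nat.self_le_factorial j
  have hjp : (0 : ℝ) < j.factorial := by positivity
  have hkp : (0 : ℝ) < k.factorial := by positivity
  have hsp : (0 : ℝ) < (j + k).factorial := by positivity
  have e1 : ((j + k).choose j : ℝ) = (j + k).factorial / (j.factorial * k.factorial) := by
    rw [← hc]; field_simp
  have e2 : wt η (j + k) * ((d / η) ^ 2) ^ j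
      = η ^ (2 * k) * ((d : ℝ) ^ j) ^ 2 / (j + k).factorial := by
    unfold wt
    rw [div_pow, div_pow, mul_add, pow_add]
    field_simp
    ring
  rw [e1, e2, le_div_iff₀ hsp]
  unfold wt
  have e3 : ((j + k).factorial : ℝ) / (j.factorial * k.factorial)
      * (j * (η ^ (2 * k) / k.factorial)) * (j + k).factorial
      = η ^ (2 * k) * (j / j.factorial) * ((j + k).factorial / k.factorial) ^ 2 := by
    field_simp
  rw [e3, mul_assoc]
  gcongr
  have h1 : (j : ℝ) / j.factorial ≤ 1 := (div_le_one hjp).2 hjf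
  have h2 : ((j + k).factorial : ℝ) / k.factorial ≤ d ^ j := by
    rw [div_le_iff₀ hkp]; linarith
  calc _ ≤ 1 * ((d : ℝ) ^ j) ^ 2 := by gcongr
    _ = _ := one_mul _

theorem geom_sum_le_two {z : ℝ} (h0 : 0 ≤ z) (h : z ≤ 1 / 2) (s : ℕ) :
    ∑ j ∈ Finset.range s, z ^ j ≤ 2 := by
  have h1 := mul_neg_geom_sum z s
  have h2 : 0 ≤ z ^ s := by positivity
  have h3 : 0 ≤ ∑ j ∈ Finset.range s, z ^ j := Finset.sum_nonneg fun j _ => by positivity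
  nlinarith

theorem sum_powerset_card_mul_wt_le {n d : ℕ} {η : ℝ} (hη : 0 < η) (hd : 2 * d ≤ η)
    {S : Finset (Fin n)} (hS : S.card ≤ d) :
    ∑ U ∈ S.powerset, (U.card : ℝ) * wt η (S.card - U.card)
      ≤ wt η S.card * (2 * (d / η) ^ 2) := by
  set z : ℝ := (d / η) ^ 2 with hz
  have hz0 : 0 ≤ z := by positivity
  have hz1 : z ≤ 1 / 2 := by
    have h1 : d / η ≤ 1 / 2 := by rw [div_le_iff₀ hη]; linarith
    have h2 : 0 ≤ d / η := by positivity
    nlinarith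
  rw [Finset.sum_powerset_apply_card fun j : ℕ => (j : ℝ) * wt η (S.card - j)]
  simp only [nsmul_eq_mul]
  rw [Finset.sum_range_succ']
  simp only [Nat.cast_zero, zero_mul, mul_zero, add_zero]
  calc _ ≤ ∑ j ∈ Finset.range S.card, wt η S.card * z ^ (j + 1) := by
        refine Finset.sum_le_sum fun j hj => ?_
        rw [Finset.mem_range] at hj
        exact choose_mul_wt_le hη hS hj (by omega)
    _ = wt η S.card * (z * ∑ j ∈ Finset.range S.card, z ^ j) := by
        simp only [pow_succ', Finset.mul_sum]
    _ ≤ wt η S.card * (z * 2) := by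
        have := geom_sum_le_two hz0 hz1 S.card
        have := wt_nonneg η S.card
        gcongr
    _ = _ := by ring

theorem sum_card_mul_dcoef_sq {n : ℕ} (f : Finset (Fin n) → ℝ) (η : ℝ) :
    ∑ U : Finset (Fin n), (U.card : ℝ) * ∑ T, wt η T.card * dcoef f T U ^ 2
      = ∑ S : Finset (Fin n), f S ^ 2
          * ∑ U ∈ S.powerset, (U.card : ℝ) * wt η (S.card - U.card) := by
  have h1 : ∀ U : Finset (Fin n), (U.card : ℝ) * ∑ T, wt η T.card * dcoef f T U ^ 2
      = ∑ S : Finset (Fin n), if U ⊆ S then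
          f S ^ 2 * ((U.card : ℝ) * wt η (S.card - U.card)) else 0 := by
    intro U
    rw [Finset.mul_sum, ← Finset.sum_filter]
    have : ∀ T : Finset (Fin n), (U.card : ℝ) * (wt η T.card * dcoef f T U ^ 2)
        = if Disjoint U T then (U.card : ℝ) * (wt η T.card * f (U ∪ T) ^ 2) else 0 := by
      intro T
      unfold dcoef
      split_ifs <;> simp
    simp_rw [this]
    rw [← Finset.sum_filter]
    refine Finset.sum_nbij' (fun T => U ∪ T) (fun S => S \ U) ?_ ?_ ?_ ?_ ?_
    · intro T _; simp
    · intro S _; simp [Finset.disjoint_sdiff]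
    · intro T hT
      simp only [Finset.mem_filter, Finset.mem_univ, true_and] at hT
      exact Finset.union_sdiff_cancel_left hT
    · intro S hS
      simp only [Finset.mem_filter, Finset.mem_univ, true_and] at hS
      exact Finset.union_sdiff_of_subset hS
    · intro T hT
      simp only [Finset.mem_filter, Finset.mem_univ, true_and] at hT
      rw [Finset.card_union_of_disjoint hT, Nat.add_sub_cancel_left]
      ring
  simp_rw [h1]
  rw [Finset.sum_comm]
  refine Finset.sum_congr rfl fun S _ => ?_
  rw [← Finset.sum_filter, Finset.mul_sum]
  exact Finset.sum_congr (by ext; simp) fun U _ => rfl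

theorem sum_card_mul_lcoef_sq_le {n d : ℕ} {f : Finset (Fin n) → ℝ} (hf : degLE f d) {η : ℝ}
    (hη : 0 < η) (hd : 2 * d ≤ η) :
    ∑ U : Finset (Fin n), (U.card : ℝ) * lcoef f η U ^ 2
      ≤ 2 * (d / η) ^ 2 * lcoef f η ∅ ^ 2 := by
  have hm : 0 ≤ lcoef f η ∅ := by
    rw [lcoef_empty]
    exact Finset.sum_nonneg fun T _ => mul_nonneg (wt_nonneg _ _) (sq_nonneg _)
  calc _ ≤ ∑ U : Finset (Fin n), (U.card : ℝ)
        * (lcoef f η ∅ * ∑ T, wt η T.card * dcoef f T U ^ 2) := by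
        refine Finset.sum_le_sum fun U _ => mul_le_mul_of_nonneg_left ?_ (Nat.cast_nonneg _)
        rw [lcoef_empty]
        exact sq_sum_wt_mul_le η f fun T => dcoef f T U
    _ = lcoef f η ∅ * ∑ S : Finset (Fin n), f S ^ 2
          * ∑ U ∈ S.powerset, (U.card : ℝ) * wt η (S.card - U.card) := by
        rw [← sum_card_mul_dcoef_sq, Finset.mul_sum]
        exact Finset.sum_congr rfl fun U _ => by ring
    _ ≤ lcoef f η ∅ * ∑ S : Finset (Fin n), f S ^ 2 * (wt η S.card * (2 * (d / η) ^ 2)) := by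
        refine mul_le_mul_of_nonneg_left (Finset.sum_le_sum fun S _ => ?_) hm
        rcases le_or_gt S.card d with hS | hS
        · exact mul_le_mul_of_nonneg_left (sum_powerset_card_mul_wt_le hη hd hS) (sq_nonneg _)
        · rw [hf S hS]; simp
    _ = _ := by
        rw [pow_two (lcoef f η ∅), lcoef_empty f η]
        simp only [Finset.mul_sum, Finset.sum_mul]
        rw [Finset.sum_comm]
        exact Finset.sum_congr rfl fun _ _ => Finset.sum_congr rfl fun _ _ => by ring

theorem sum_binf {n : ℕ} (f : Finset (Fin n) → ℝ) :
    ∑ i, binf f i = ∑ S : Finset (Fin n), (S.card : ℝ) * f S ^ 2 := by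
  unfold binf
  rw [Finset.sum_comm]
  refine Finset.sum_congr rfl fun S _ => ?_
  rw [← Finset.sum_filter, Finset.sum_const, nsmul_eq_mul]
  congr 3
  ext; simp

theorem bvar_le_sum_binf {n : ℕ} (f : Finset (Fin n) → ℝ) : bvar f ≤ ∑ i, binf f i := by
  rw [sum_binf]
  refine Finset.sum_le_sum fun S _ => ?_
  split_ifs with h
  · have : (1 : ℝ) ≤ S.card := by
      exact_mod_cast Finset.card_pos.2 (Finset.nonempty_iff_ne_empty.2 h)
    exact le_mul_of_one_le_left (sq_nonneg _) this
  · positivity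

theorem integral_sq_peval_sub_mean {n : ℕ} (f : Finset (Fin n) → ℝ) :
    ∫ x, (peval f x - f ∅) ^ 2 ∂(gaussPi n) = bvar f := by
  have h1 : ∀ x, peval f x - f ∅ = peval (fun S => if S ≠ ∅ then f S else 0) x := by
    intro x
    unfold peval
    rw [← Finset.add_sum_erase _ _ (Finset.mem_univ (∅ : Finset (Fin n))),
      ← Finset.add_sum_erase (a := (∅ : Finset (Fin n))) _ _ (Finset.mem_univ _)]
    simp only [Finset.prod_empty, mul_one, add_sub_cancel_left, ne_eq, not_true_eq_false, if_false,
      zero_add]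
    refine Finset.sum_congr rfl fun S hS => ?_
    rw [if_pos (Finset.mem_erase.1 hS).1]
  simp_rw [h1]
  rw [integral_peval_sq fun _ => niceLaw_gaussianReal]
  unfold bvar
  refine Finset.sum_congr rfl fun S _ => ?_
  split_ifs <;> simp

/-- The derivative of the polynomial with coefficients `g` along the direction `p.2` at `p.1`. -/
noncomputable def dirDeriv {n : ℕ} (g : Finset (Fin n) → ℝ) (p : (Fin n → ℝ) × (Fin n → ℝ)) : ℝ :=
  ∑ i, p.2 i * peval (dcoef g {i}) p.1

theorem continuous_dirDeriv {n : ℕ} (g : Finset (Fin n) → ℝ) : Continuous (dirDeriv g) := by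
  have := fun f : Finset (Fin n) → ℝ => continuous_peval f
  unfold dirDeriv; fun_prop

theorem lintegral_dirDeriv_sq {n : ℕ} (g : Finset (Fin n) → ℝ) :
    ∫⁻ p, ENNReal.ofReal (dirDeriv g p ^ 2) ∂((gaussPi n).prod (gaussPi n))
      = ENNReal.ofReal (∑ i, binf g i) := by
  have hν : ∀ _ : Fin n, NiceLaw (gaussianReal 0 1) := fun _ => niceLaw_gaussianReal
  rw [lintegral_prod _ (by have := continuous_dirDeriv g; fun_prop)]
  have h1 : ∀ x : Fin n → ℝ, ∫⁻ y, ENNReal.ofReal (dirDeriv g (x, y) ^ 2) ∂(gaussPi n)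
      = ENNReal.ofReal (∑ i, peval (dcoef g {i}) x ^ 2) := by
    intro x
    have e : ∀ y, dirDeriv g (x, y) = peval (linCoef fun i => peval (dcoef g {i}) x) y := by
      intro y
      rw [peval_linCoef]
      exact Finset.sum_congr rfl fun i _ => mul_comm _ _
    simp_rw [e]
    rw [← ofReal_integral_eq_lintegral_ofReal
      (integrable_polyFun hν (pow_mem_polyFun (peval_mem_polyFun _) 2))
      (ae_of_all _ fun _ => sq_nonneg _), integral_peval_sq hν, sum_linCoef_sq]
  simp_rw [h1]
  have hpf : ∀ i : Fin n, (fun x => peval (dcoef g {i}) x ^ 2) ∈ polyFun n := fun i =>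
    pow_mem_polyFun (peval_mem_polyFun _) 2
  rw [← ofReal_integral_eq_lintegral_ofReal
    (integrable_polyFun hν (sum_mem_polyFun _ fun i _ => hpf i))
    (ae_of_all _ fun _ => Finset.sum_nonneg fun _ _ => sq_nonneg _),
    integral_finsetSum _ fun i _ => integrable_polyFun hν (hpf i)]
  congr 1
  refine Finset.sum_congr rfl fun i _ => ?_
  rw [integral_peval_sq hν, sum_sq_dcoef_singleton]

theorem continuous_rot_pair (n : ℕ) :
    Continuous fun q : ((Fin n → ℝ) × (Fin n → ℝ)) × ℝ =>
      (rot q.1.1 q.1.2 q.2, rotD q.1.1 q.1.2 q.2) := by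
  unfold rot rotD; fun_prop

theorem lintegral_lintegral_dirDeriv_rot_sq {n : ℕ} (g : Finset (Fin n) → ℝ) :
    ∫⁻ p, ∫⁻ t, ENNReal.ofReal (dirDeriv g (rot p.1 p.2 t, rotD p.1 p.2 t) ^ 2) ∂circleMeas
      ∂((gaussPi n).prod (gaussPi n)) = ENNReal.ofReal (∑ i, binf g i * (2 * Real.pi)) := by
  have hc := (continuous_dirDeriv g).comp (continuous_rot_pair n)
  rw [lintegral_lintegral_swap (by
    refine (ENNReal.measurable_ofReal.comp ?_).aemeasurable
    exact (hc.pow 2).measurable)]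
  have h1 : ∀ t, ∫⁻ p, ENNReal.ofReal (dirDeriv g (rot p.1 p.2 t, rotD p.1 p.2 t) ^ 2)
      ∂((gaussPi n).prod (gaussPi n)) = ENNReal.ofReal (∑ i, binf g i) := by
    intro t
    rw [← lintegral_dirDeriv_sq]
    conv_rhs => rw [← map_rot_gaussPi n t]
    rw [lintegral_map]
    · exact ENNReal.measurable_ofReal.comp ((continuous_dirDeriv g).pow 2).measurable
    · exact ((continuous_rot_pair n).comp (Continuous.prodMk_left t)).measurable
  simp_rw [h1]
  rw [lintegral_const, ← Finset.sum_mul,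
    ENNReal.ofReal_mul (Finset.sum_nonneg fun i _ => binf_nonneg g i)]
  simp

theorem sq_intervalIntegral_le {D : ℝ → ℝ} (hD : Continuous D) {t s : ℝ} (h0 : 0 ≤ t)
    (hts : t ≤ s) : (∫ u in (0 : ℝ)..t, D u) ^ 2 ≤ s * ∫ u in (0 : ℝ)..s, D u ^ 2 := by
  have hmono : ∫ u in (0 : ℝ)..t, D u ^ 2 ≤ ∫ u in (0 : ℝ)..s, D u ^ 2 :=
    intervalIntegral.integral_mono_interval le_rfl h0 hts (ae_of_all _ fun _ => sq_nonneg _)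
      ((hD.pow 2).intervalIntegrable _ _)
  have hnn : 0 ≤ ∫ u in (0 : ℝ)..s, D u ^ 2 :=
    intervalIntegral.integral_nonneg (h0.trans hts) fun _ _ => sq_nonneg _
  rcases h0.eq_or_lt with rfl | hpos
  · simp only [intervalIntegral.integral_same]
    have := mul_nonneg hts hnn
    linarith [this]
  set A := ∫ u in (0 : ℝ)..t, D u
  have h1 : 0 ≤ ∫ u in (0 : ℝ)..t, (D u - A / t) ^ 2 :=
    intervalIntegral.integral_nonneg h0 fun _ _ => sq_nonneg _
  have h2 : ∫ u in (0 : ℝ)..t, (D u - A / t) ^ 2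
      = (∫ u in (0 : ℝ)..t, D u ^ 2) - A ^ 2 / t := by
    have e : ∀ u, (D u - A / t) ^ 2 = D u ^ 2 - 2 * (A / t) * D u + (A / t) ^ 2 := fun u => by ring
    simp_rw [e]
    rw [intervalIntegral.integral_add, intervalIntegral.integral_sub,
      intervalIntegral.integral_const_mul, intervalIntegral.integral_const]
    · simp only [sub_zero, smul_eq_mul]
      change _ - 2 * (A / t) * A + _ = _
      field_simp
      ring
    all_goals exact Continuous.intervalIntegrable (by fun_prop) _ _
  have h3 : A ^ 2 / t ≤ ∫ u in (0 : ℝ)..s, D u ^ 2 := by linarith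
  rw [div_le_iff₀ hpos] at h3
  nlinarith

theorem sq_peval_rot_sub_le {n : ℕ} (g : Finset (Fin n) → ℝ) (x y : Fin n → ℝ) {t : ℝ}
    (ht : t ∈ Set.Ioc 0 (2 * Real.pi)) :
    ENNReal.ofReal ((peval g (rot x y t) - peval g x) ^ 2) ≤ ENNReal.ofReal (2 * Real.pi)
      * ∫⁻ t, ENNReal.ofReal (dirDeriv g (rot x y t, rotD x y t) ^ 2) ∂circleMeas := by
  set D : ℝ → ℝ := fun t => dirDeriv g (rot x y t, rotD x y t) with hDdef
  have hD : Continuous D := (continuous_dirDeriv g).comp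
    (show Continuous fun t => (rot x y t, rotD x y t) by unfold rot rotD; fun_prop)
  have h0 : rot x y 0 = x := by ext i; simp [rot]
  have h1 : ∫ u in (0 : ℝ)..t, D u = peval g (rot x y t) - peval g x := by
    rw [intervalIntegral.integral_eq_sub_of_hasDerivAt (f := fun t => peval g (rot x y t))
      (f' := D) (fun u _ => hasDerivAt_peval_rot g x y u) (hD.intervalIntegrable _ _), h0]
  have h2 := sq_intervalIntegral_le hD ht.1.le ht.2
  have hi : Integrable (fun u => D u ^ 2) circleMeas := by
    have := (hD.pow 2).intervalIntegrable (μ := volume) 0 (2 * Real.pi)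
    rwa [intervalIntegrable_iff_integrableOn_Ioc_of_le (by positivity)] at this
  rw [← ofReal_integral_eq_lintegral_ofReal hi (ae_of_all _ fun _ => sq_nonneg _),
    ← ENNReal.ofReal_mul (by positivity), ← h1]
  rw [intervalIntegral.integral_of_le (by positivity : (0 : ℝ) ≤ 2 * Real.pi)] at h2
  exact ENNReal.ofReal_le_ofReal h2

theorem measure_abs_peval_sub_mean_ge_le {n : ℕ} (g : Finset (Fin n) → ℝ) {c : ℝ} (hc : 0 < c) :
    (gaussPi n).real {x | c ≤ |peval g x - g ∅|} ≤ (∑ i, binf g i) / c ^ 2 := by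
  have hi : Integrable (fun x => (peval g x - g ∅) ^ 2) (gaussPi n) := by
    refine integrable_polyFun (fun _ => niceLaw_gaussianReal) (pow_mem_polyFun ?_ 2)
    have := add_mem_polyFun (peval_mem_polyFun g) (const_mem_polyFun (-g ∅))
    simpa [sub_eq_add_neg] using this
  have h1 := mul_meas_ge_le_integral_of_nonneg (μ := gaussPi n)
    (ae_of_all _ fun x => sq_nonneg (peval g x - g ∅)) hi (c ^ 2)
  rw [integral_sq_peval_sub_mean] at h1
  have hmono : (gaussPi n).real {x | c ≤ |peval g x - g ∅|}
      ≤ (gaussPi n).real {x | c ^ 2 ≤ (peval g x - g ∅) ^ 2} := by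
    refine measureReal_mono fun x hx => ?_
    simp only [Set.mem_ofPred_eq] at hx ⊢
    rw [← sq_abs (peval g x - g ∅)]
    gcongr
  rw [le_div_iff₀ (by positivity)]
  have := bvar_le_sum_binf g
  nlinarith [sq_nonneg c]

/-- A polynomial of small total influence stays close to its mean on a whole random great circle
with high probability. -/
theorem exists_measurableSet_rot_close {n : ℕ} (g : Finset (Fin n) → ℝ) {c : ℝ} (hc : 0 < c) :
    ∃ E : Set ((Fin n → ℝ) × (Fin n → ℝ)), MeasurableSet E ∧
      (∀ x y, ∀ t ∈ Set.Ioc 0 (2 * Real.pi), c + c ≤ |peval g (rot x y t) - g ∅| → (x, y) ∈ E) ∧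
      ((gaussPi n).prod (gaussPi n)).real E ≤ 41 * (∑ i, binf g i) / c ^ 2 := by
  set I := ∑ i, binf g i with hI
  have hI0 : 0 ≤ I := Finset.sum_nonneg fun i _ => binf_nonneg g i
  set h : (Fin n → ℝ) × (Fin n → ℝ) → ENNReal := fun p =>
    ∫⁻ t, ENNReal.ofReal (dirDeriv g (rot p.1 p.2 t, rotD p.1 p.2 t) ^ 2) ∂circleMeas with hh
  have hm : Measurable h := by
    refine Measurable.lintegral_prod_right' (f := fun q : ((Fin n → ℝ) × (Fin n → ℝ)) × ℝ =>
      ENNReal.ofReal (dirDeriv g (rot q.1.1 q.1.2 q.2, rotD q.1.1 q.1.2 q.2) ^ 2)) ?_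
    exact ENNReal.measurable_ofReal.comp
      (((continuous_dirDeriv g).comp (continuous_rot_pair n)).pow 2).measurable
  have hpi := Real.pi_pos
  set E1 : Set ((Fin n → ℝ) × (Fin n → ℝ)) := {x | c ≤ |peval g x - g ∅|} ×ˢ Set.univ with hE1
  set E2 : Set ((Fin n → ℝ) × (Fin n → ℝ)) := {p | ENNReal.ofReal (c ^ 2 / (2 * Real.pi)) ≤ h p}
    with hE2
  have hm1 : MeasurableSet {x : Fin n → ℝ | c ≤ |peval g x - g ∅|} :=
    measurableSet_le measurable_const ((continuous_peval g).sub continuous_const).abs.measurable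
  refine ⟨E1 ∪ E2, (hm1.prod MeasurableSet.univ).union (measurableSet_le measurable_const hm), ?_, ?_⟩
  · intro x y t ht hp
    by_contra hcon
    simp only [hE1, hE2, Set.mem_union, Set.mem_prod, Set.mem_ofPred_eq, Set.mem_univ, and_true,
      not_or, not_le] at hcon
    obtain ⟨c1, c2⟩ := hcon
    have h1 := sq_peval_rot_sub_le g x y ht
    have h2 : ENNReal.ofReal (2 * Real.pi) * h (x, y) < ENNReal.ofReal (c ^ 2) := by
      have := ENNReal.mul_lt_mul_right (a := ENNReal.ofReal (2 * Real.pi)) (by simp [hpi])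
        ENNReal.ofReal_ne_top c2
      rwa [← ENNReal.ofReal_mul (by positivity), mul_div_cancel₀ _ (by positivity)] at this
    have h3 := (ENNReal.ofReal_lt_ofReal_iff (by positivity)).1 (h1.trans_lt h2)
    have h4 := abs_lt_of_sq_lt_sq h3 hc.le
    have := abs_sub_le (peval g (rot x y t)) (peval g x) (g ∅)
    linarith
  · have b1 : ((gaussPi n).prod (gaussPi n)).real E1 ≤ I / c ^ 2 := by
      rw [Measure.real, Measure.prod_prod, measure_univ, mul_one]
      exact measure_abs_peval_sub_mean_ge_le g hc
    have b2 : ((gaussPi n).prod (gaussPi n)).real E2 ≤ 40 * I / c ^ 2 := by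
      have h1 := mul_meas_ge_le_lintegral₀ (μ := (gaussPi n).prod (gaussPi n)) hm.aemeasurable
        (ENNReal.ofReal (c ^ 2 / (2 * Real.pi)))
      rw [lintegral_lintegral_dirDeriv_rot_sq, ← Finset.sum_mul, ← hI] at h1
      have h2 := ENNReal.toReal_mono ENNReal.ofReal_ne_top h1
      rw [ENNReal.toReal_mul, ENNReal.toReal_ofReal (by positivity),
        ENNReal.toReal_ofReal (by positivity)] at h2
      change c ^ 2 / (2 * Real.pi) * ((gaussPi n).prod (gaussPi n)).real E2 ≤ _ at h2
      rw [div_mul_eq_mul_div, div_le_iff₀ (by positivity)] at h2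
      rw [le_div_iff₀ (by positivity)]
      have hp : Real.pi ^ 2 ≤ 10 := by nlinarith [Real.pi_lt_d2]
      nlinarith [mul_le_mul_of_nonneg_left hp hI0]
    refine (measureReal_union_le _ _).trans ((add_le_add b1 b2).trans (le_of_eq ?_))
    ring

/-- At a scale much larger than the degree, the weighted derivative norm is bounded below on a
whole random great circle with high probability. -/
theorem exists_measurableSet_wsum_ge {n d : ℕ} {f : Finset (Fin n) → ℝ} (hf : degLE f d)
    (hv : bvar f = 1) {η : ℝ} (h1 : 1 ≤ η) (hd : 2 * d ≤ η) :
    ∃ (B : Set (Fin n → ℝ)) (E : Set ((Fin n → ℝ) × (Fin n → ℝ))),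
      MeasurableSet B ∧ MeasurableSet E ∧
      (∀ x y, ∀ t ∈ Set.Ioc 0 (2 * Real.pi), rot x y t ∈ B → (x, y) ∈ E) ∧
      (gaussPi n).real B ≤ 1312 * (d / η) ^ 2 ∧
      ((gaussPi n).prod (gaussPi n)).real E ≤ 1312 * (d / η) ^ 2 ∧
      ∀ x ∉ B, 1 / 4 ≤ wsum f η x := by
  set g := lcoef f η with hg
  set m := g ∅ with hmdef
  have hm : 1 ≤ m := one_le_lcoef_empty hf hv h1 (by linarith [(Nat.cast_nonneg d : (0 : ℝ) ≤ d)])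
  have hI : ∑ i, binf g i ≤ 2 * (d / η) ^ 2 * m ^ 2 := by
    rw [sum_binf]
    exact sum_card_mul_lcoef_sq_le hf (by linarith) hd
  have hI0 : 0 ≤ ∑ i, binf g i := Finset.sum_nonneg fun i _ => binf_nonneg g i
  obtain ⟨E, hE, hEr, hEm⟩ := exists_measurableSet_rot_close g (c := m / 4) (by linarith)
  refine ⟨{x | m / 2 ≤ |peval g x - m|}, E,
    measurableSet_le measurable_const ((continuous_peval g).sub continuous_const).abs.measurable,
    hE, ?_, ?_, ?_, ?_⟩
  · intro x y t ht hB
    simp only [Set.mem_ofPred_eq] at hB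
    exact hEr x y t ht (by linarith)
  · refine (measure_abs_peval_sub_mean_ge_le g (c := m / 2) (by linarith)).trans ?_
    rw [div_le_iff₀ (by positivity)]
    nlinarith [sq_nonneg (d / η * m)]
  · refine hEm.trans ?_
    rw [div_le_iff₀ (by positivity)]
    nlinarith
  · intro x hx
    simp only [Set.mem_ofPred_eq, not_le] at hx
    have h2 : m / 2 < peval g x := by linarith [(abs_lt.1 hx).1]
    have h3 : m * (m / 4) ≤ m * wsum f η x := by
      refine le_trans ?_ (sq_peval_lcoef_le f η x)
      change _ ≤ peval g x ^ 2
      nlinarith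
    have h4 := le_of_mul_le_mul_left h3 (by linarith)
    linarith

theorem pow_mul_wsum_le {n d : ℕ} {f : Finset (Fin n) → ℝ} (hf : degLE f d) {s : ℝ} (h0 : 0 ≤ s)
    (h1 : s ≤ 1) (η : ℝ) (x : Fin n → ℝ) : s ^ (2 * d) * wsum f η x ≤ wsum f (s * η) x := by
  unfold wsum
  rw [Finset.mul_sum]
  refine Finset.sum_le_sum fun T _ => ?_
  rcases le_or_gt T.card d with hT | hT
  · have e : wt (s * η) T.card = s ^ (2 * T.card) * wt η T.card := by
      unfold wt; rw [mul_pow]; ring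
    rw [e, ← mul_assoc]
    have := wt_nonneg η T.card
    have h2 : s ^ (2 * d) ≤ s ^ (2 * T.card) := pow_le_pow_of_le_one h0 h1 (by omega)
    gcongr
  · have : peval (dcoef f T) x = 0 := by
      refine Finset.sum_eq_zero fun U _ => ?_
      unfold dcoef
      split_ifs
      · rw [hf _ (hT.trans_le (Finset.card_le_card Finset.subset_union_right)), zero_mul]
      · rw [zero_mul]
    simp [this]

theorem measure_abs_peval_le_of_scale {n d : ℕ} (hd : 0 < d) {f : Finset (Fin n) → ℝ}
    (hf : degLE f d) (hv : bvar f = 1) {r ρ : ℝ} (hr0 : 0 < r) (hr1 : r ≤ 1) (hρ0 : 0 ≤ ρ)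
    (hρ : 2 * ρ < (r / 16) ^ d) :
    (gaussPi n).real {x | |peval f x| ≤ ρ} ≤ 3095396352 * (d * r) := by
  have hd' : (1 : ℝ) ≤ d := by exact_mod_cast hd
  have h2 : ∀ j : ℕ, (1 : ℝ) ≤ 2 ^ j := fun j => one_le_pow₀ (by norm_num)
  choose B E hB hE hBE hBm hEm hW using fun j : ℕ =>
    exists_measurableSet_wsum_ge hf hv (η := 2 ^ j * (2 * d))
      (by nlinarith [h2 j]) (by nlinarith [h2 j])
  have hscale : ∀ j : ℕ, 1312 * ((d : ℝ) / (2 ^ j * (2 * d))) ^ 2 = 1312 * (1 / 4) ^ (j + 1) := by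
    intro j
    have : (d : ℝ) / (2 ^ j * (2 * d)) = (1 / 2) ^ (j + 1) := by
      rw [one_div, inv_pow, pow_succ]; field_simp
    rw [this, show (1 / 4 : ℝ) = (1 / 2) ^ 2 by norm_num, ← pow_mul, ← pow_mul, mul_comm 2]
  let B' : ℕ → Set (Fin n → ℝ) := fun j => Nat.casesOn j Set.univ B
  let E' : ℕ → Set ((Fin n → ℝ) × (Fin n → ℝ)) := fun j => Nat.casesOn j Set.univ E
  have hB' : ∀ j, MeasurableSet (B' j) := fun j => by cases j; exacts [MeasurableSet.univ, hB _]
  have hE' : ∀ j, MeasurableSet (E' j) := fun j => by cases j; exacts [MeasurableSet.univ, hE _]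
  have hBE' : ∀ j x y, ∀ t ∈ Set.Ioc 0 (2 * Real.pi), rot x y t ∈ B' j → (x, y) ∈ E' j := by
    intro j
    cases j
    · exact fun _ _ _ _ _ => Set.mem_univ _
    · exact hBE _
  have hBm' : ∀ j, (gaussPi n).real (B' j) ≤ 1312 * (1 / 4) ^ j := by
    intro j
    cases j
    · exact measureReal_le_one.trans (by norm_num)
    · exact (hBm _).trans (hscale _).le
  have hEm' : ∀ j, ((gaussPi n).prod (gaussPi n)).real (E' j) ≤ 1312 * (1 / 4) ^ j := by
    intro j
    cases j
    · exact measureReal_le_one.trans (by norm_num)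
    · exact (hEm _).trans (hscale _).le
  set A : ℕ → Set (Fin n → ℝ) := fun j =>
    B' j ∩ {x | peval f x ^ 2 < (1 / 256) ^ d * wsum f (r * (2 ^ j * (2 * d))) x} with hAdef
  have hA : ∀ j, (gaussPi n).real (A j) ≤ 1547698176 * (d * r) * (1 / 2) ^ j := by
    intro j
    refine (measure_sq_peval_lt_wsum_le hd hf (hB' j) (hE' j) (hBE' j)
      (ε := r * (2 ^ j * (2 * d))) (by positivity)).trans ?_
    calc _ ≤ 589824 * (r * (2 ^ j * (2 * d))) * (1312 * (1 / 4) ^ j) := by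
          have := hEm' j
          gcongr
      _ = 1547698176 * (d * r) * (2 ^ j * (1 / 4) ^ j) := by ring
      _ = _ := by rw [← mul_pow]; norm_num
  have hsub : {x | |peval f x| ≤ ρ} ⊆ (⋃ j, A j) ∪ ⋂ j, B' j := by
    intro x hx
    simp only [Set.mem_ofPred_eq] at hx
    by_contra hcon
    simp only [Set.mem_union, Set.mem_iUnion, Set.mem_iInter, not_or, not_exists] at hcon
    obtain ⟨c1, c2⟩ := hcon
    refine c2 fun j => ?_
    induction j with
    | zero => exact Set.mem_univ _
    | succ j ih =>
      by_contra hj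
      refine c1 j ⟨ih, ?_⟩
      simp only [Set.mem_ofPred_eq]
      have w1 := hW j x hj
      have w2 := pow_mul_wsum_le hf hr0.le hr1 (2 ^ j * (2 * d)) x
      calc peval f x ^ 2 ≤ ρ ^ 2 := by rw [← sq_abs]; gcongr
        _ < ((r / 16) ^ d / 2) ^ 2 := by
            refine pow_lt_pow_left₀ (by linarith) hρ0 (by norm_num)
        _ = (1 / 256) ^ d * (r ^ (2 * d) * (1 / 4)) := by
            rw [div_pow r, div_pow, div_pow, ← pow_mul, ← pow_mul, mul_comm d 2, pow_mul 16 2,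
              div_pow 1]
            norm_num
            ring
        _ ≤ (1 / 256) ^ d * (r ^ (2 * d) * wsum f (2 ^ j * (2 * d)) x) := by gcongr
        _ ≤ _ := by gcongr
  have hnull : (gaussPi n).real (⋂ j, B' j) ≤ 0 := by
    have hlim : Filter.Tendsto (fun j : ℕ => 1312 * (1 / 4 : ℝ) ^ j) Filter.atTop
        (nhds (1312 * 0)) :=
      (tendsto_pow_atTop_nhds_zero_of_lt_one (by norm_num) (by norm_num)).const_mul 1312
    rw [mul_zero] at hlim
    exact ge_of_tendsto' hlim fun j =>
      (measureReal_mono (Set.iInter_subset _ j)).trans (hBm' j)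
  have hsum : Summable fun j : ℕ => 1547698176 * (d * r) * (1 / 2 : ℝ) ^ j :=
    (summable_geometric_of_lt_one (by norm_num) (by norm_num)).mul_left _
  have h5 := measureReal_iUnion_le_tsum hsum hA
  rw [tsum_mul_left, tsum_geometric_of_lt_one (by norm_num) (by norm_num)] at h5
  have h6 := (measureReal_mono hsub).trans (measureReal_union_le (μ := gaussPi n) _ _)
  norm_num at h5
  linarith

/-- Gaussian anti-concentration (Carbery–Wright) for multilinear polynomials. -/
theorem measure_abs_peval_le {n d : ℕ} (hd : 0 < d) {f : Finset (Fin n) → ℝ}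
    (hf : degLE f d) (hv : bvar f = 1) {ρ : ℝ} (hρ : 0 < ρ) :
    (gaussPi n).real {x | |peval f x| ≤ ρ} ≤ 148579024896 * (d * ρ ^ (1 / (d : ℝ))) := by
  have hd' : (1 : ℝ) ≤ d := by exact_mod_cast hd
  have hp : 0 < ρ ^ (1 / (d : ℝ)) := Real.rpow_pos_of_pos hρ _
  rcases le_or_gt (48 * ρ ^ (1 / (d : ℝ))) 1 with h | h
  · refine (measure_abs_peval_le_of_scale hd hf hv (r := 48 * ρ ^ (1 / (d : ℝ))) (by positivity) h
      hρ.le ?_).trans (le_of_eq (by ring))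
    have e : (48 * ρ ^ (1 / (d : ℝ)) / 16) ^ d = 3 ^ d * ρ := by
      rw [show 48 * ρ ^ (1 / (d : ℝ)) / 16 = 3 * ρ ^ (1 / (d : ℝ)) by ring, mul_pow,
        ← Real.rpow_natCast (ρ ^ (1 / (d : ℝ))), ← Real.rpow_mul hρ.le, one_div,
        inv_mul_cancel₀ (by positivity), Real.rpow_one]
    rw [e]
    have : (3 : ℝ) ≤ 3 ^ d := le_self_pow₀ (by norm_num) hd.ne'
    nlinarith
  · refine measureReal_le_one.trans ?_
    nlinarith

theorem exp_neg_sq_half_le_sum (z : ℝ) (J : ℕ) :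
    Real.exp (-z ^ 2 / 2) ≤ ∑ j ∈ Finset.range J, 8 * (1 / 4) ^ j *
      (Set.Icc (-2 ^ j : ℝ) (2 ^ j)).indicator 1 z + 8 * (1 / 4) ^ J := by
  induction J with
  | zero =>
    have : Real.exp (-z ^ 2 / 2) ≤ 1 := Real.exp_le_one_iff.2 (by nlinarith [sq_nonneg z])
    simp only [Finset.range_zero, Finset.sum_empty, pow_zero]
    linarith
  | succ J ih =>
    have hpos : ∀ j : ℕ, (0 : ℝ) < (1 / 4) ^ j := fun j => by positivity
    by_cases h : z ∈ Set.Icc (-2 ^ J : ℝ) (2 ^ J)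
    · rw [Finset.sum_range_succ, Set.indicator_of_mem h, Pi.one_apply, mul_one]
      linarith [hpos (J + 1)]
    · have h0 : 0 ≤ ∑ j ∈ Finset.range (J + 1), 8 * (1 / 4 : ℝ) ^ j *
          (Set.Icc (-2 ^ j : ℝ) (2 ^ j)).indicator 1 z :=
        Finset.sum_nonneg fun j _ => mul_nonneg (by positivity)
          (Set.indicator_nonneg (fun _ _ => zero_le_one) _)
      have h1 : (2 : ℝ) ^ J < |z| := by
        by_contra hc
        exact h (abs_le.1 (not_lt.1 hc))
      have h2 : (4 : ℝ) ^ J ≤ z ^ 2 := by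
        calc (4 : ℝ) ^ J = (2 ^ J) ^ 2 := by rw [← pow_mul, mul_comm, pow_mul]; norm_num
          _ ≤ |z| ^ 2 := by gcongr
          _ = z ^ 2 := sq_abs z
      have h4 : (0 : ℝ) < 4 ^ J := by positivity
      have h3 : Real.exp (-z ^ 2 / 2) ≤ 8 * (1 / 4) ^ (J + 1) := by
        have e1 : (8 : ℝ) * (1 / 4) ^ (J + 1) = (4 ^ J / 2)⁻¹ := by
          rw [one_div, inv_pow, pow_succ]; field_simp; norm_num
        rw [e1, neg_div, Real.exp_neg]
        refine inv_anti₀ (by positivity) ?_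
        have := Real.add_one_le_exp (z ^ 2 / 2)
        linarith
      linarith

theorem integral_exp_neg_sq_le_of_measure_le {α : Type*} [MeasurableSpace α] {μ : Measure α}
    [IsProbabilityMeasure μ] {q : α → ℝ} (hq : Measurable q) {M e : ℝ} (hM : 0 ≤ M)
    (he1 : e ≤ 1) (H : ∀ ρ : ℝ, 0 < ρ → μ.real {x | |q x| ≤ ρ} ≤ M * ρ ^ e) {ρ : ℝ}
    (hρ : 0 < ρ) : ∫ x, Real.exp (-(q x / ρ) ^ 2 / 2) ∂μ ≤ 16 * (M * ρ ^ e) := by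
  have hind : ∀ j : ℕ, Integrable (fun x => 8 * (1 / 4 : ℝ) ^ j *
      (Set.Icc (-2 ^ j : ℝ) (2 ^ j)).indicator 1 (q x / ρ)) μ := by
    intro j
    refine Integrable.const_mul ?_ _
    refine Integrable.of_bound ((measurable_one.indicator measurableSet_Icc).comp
      (hq.div_const ρ)).aestronglyMeasurable 1 (ae_of_all _ fun x => ?_)
    rw [Set.indicator_apply]
    split_ifs <;> simp
  have hbound : ∀ J : ℕ, ∫ x, Real.exp (-(q x / ρ) ^ 2 / 2) ∂μ
      ≤ 16 * (M * ρ ^ e) + 8 * (1 / 4) ^ J := by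
    intro J
    have hexp : Integrable (fun x => Real.exp (-(q x / ρ) ^ 2 / 2)) μ := by
      refine Integrable.of_bound (by fun_prop) 1 (ae_of_all _ fun x => ?_)
      rw [Real.norm_of_nonneg (Real.exp_nonneg _)]
      exact Real.exp_le_one_iff.2 (by nlinarith [sq_nonneg (q x / ρ)])
    have h1 := integral_mono hexp
      ((integrable_finsetSum (Finset.range J) fun j _ => hind j).fun_add (integrable_const _))
      fun x => exp_neg_sq_half_le_sum (q x / ρ) J
    rw [integral_add (integrable_finsetSum _ fun j _ => hind j) (integrable_const _),
      integral_finsetSum _ fun j _ => hind j] at h1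
    simp only [integral_const, probReal_univ, one_smul] at h1
    refine h1.trans (add_le_add ?_ le_rfl)
    have h2 : ∀ j : ℕ, ∫ x, 8 * (1 / 4 : ℝ) ^ j *
        (Set.Icc (-2 ^ j : ℝ) (2 ^ j)).indicator 1 (q x / ρ) ∂μ
        ≤ 8 * (M * ρ ^ e) * (1 / 2) ^ j := by
      intro j
      rw [integral_const_mul]
      have e1 : ∀ x, (Set.Icc (-2 ^ j : ℝ) (2 ^ j)).indicator (1 : ℝ → ℝ) (q x / ρ)
          = {x | |q x| ≤ 2 ^ j * ρ}.indicator (1 : α → ℝ) x := by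
        intro x
        rw [Set.indicator_apply, Set.indicator_apply]
        have : q x / ρ ∈ Set.Icc (-2 ^ j : ℝ) (2 ^ j) ↔ x ∈ {x | |q x| ≤ 2 ^ j * ρ} := by
          rw [Set.mem_Icc, ← abs_le, abs_div, abs_of_pos hρ, div_le_iff₀ hρ]
          rfl
        simp only [this, Pi.one_apply]
      simp_rw [e1]
      rw [integral_indicator_one (measurableSet_le hq.abs measurable_const)]
      have h3 : ((2 : ℝ) ^ j * ρ) ^ e ≤ 2 ^ j * ρ ^ e := by
        rw [Real.mul_rpow (by positivity) hρ.le]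
        refine mul_le_mul_of_nonneg_right ?_ (by positivity)
        exact Real.rpow_le_self_of_one_le (one_le_pow₀ (by norm_num)) he1
      calc _ ≤ 8 * (1 / 4 : ℝ) ^ j * (M * (2 ^ j * ρ ^ e)) := by
            refine mul_le_mul_of_nonneg_left ?_ (by positivity)
            exact (H _ (by positivity)).trans (by gcongr)
        _ = 8 * (M * ρ ^ e) * ((1 / 4) ^ j * 2 ^ j) := by ring
        _ = _ := by rw [← mul_pow]; norm_num
    refine (Finset.sum_le_sum fun j _ => h2 j).trans ?_
    rw [← Finset.mul_sum]
    have := geom_sum_le_two (z := 1 / 2) (by norm_num) le_rfl J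
    have h5 : 0 ≤ 8 * (M * ρ ^ e) := by positivity
    nlinarith
  have hlim : Filter.Tendsto (fun j : ℕ => 16 * (M * ρ ^ e) + 8 * (1 / 4 : ℝ) ^ j) Filter.atTop
      (nhds (16 * (M * ρ ^ e) + 8 * 0)) :=
    ((tendsto_pow_atTop_nhds_zero_of_lt_one (by norm_num) (by norm_num)).const_mul 8).const_add _
  rw [mul_zero, add_zero] at hlim
  exact ge_of_tendsto' hlim hbound

theorem bprob_le_one {n : ℕ} (P : (Fin n → ℝ) → Prop) : bprob n P ≤ 1 := by
  unfold bprob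
  rw [div_le_one (by positivity)]
  have := Finset.card_filter_le (Finset.univ : Finset (Fin n → Bool))
    fun x => P fun i => if x i then 1 else -1
  have e : (Finset.univ : Finset (Fin n → Bool)).card = 2 ^ n := by simp
  rw [e] at this
  exact_mod_cast this

theorem bprob_mono {n : ℕ} {P Q : (Fin n → ℝ) → Prop} (h : ∀ x, P x → Q x) :
    bprob n P ≤ bprob n Q := by
  unfold bprob
  gcongr
  exact h _

/-- Coefficients of the polynomial shifted by the constant `θ`. -/
noncomputable def shiftCoef {n : ℕ} (f : Finset (Fin n) → ℝ) (θ : ℝ) : Finset (Fin n) → ℝ :=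
  fun S => if S = ∅ then f ∅ - θ else f S

theorem peval_shiftCoef {n : ℕ} (f : Finset (Fin n) → ℝ) (θ : ℝ) (x : Fin n → ℝ) :
    peval (shiftCoef f θ) x = peval f x - θ := by
  unfold peval shiftCoef
  rw [← Finset.add_sum_erase _ _ (Finset.mem_univ (∅ : Finset (Fin n))),
    ← Finset.add_sum_erase (a := (∅ : Finset (Fin n))) _ _ (Finset.mem_univ _)]
  simp only [Finset.prod_empty, mul_one, if_true]
  rw [Finset.sum_congr rfl fun S hS => by rw [if_neg (Finset.mem_erase.1 hS).1]]
  ring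

theorem binf_shiftCoef {n : ℕ} (f : Finset (Fin n) → ℝ) (θ : ℝ) (i : Fin n) :
    binf (shiftCoef f θ) i = binf f i := by
  refine Finset.sum_congr rfl fun S _ => ?_
  split_ifs with h
  · rw [shiftCoef, if_neg (Finset.ne_empty_of_mem h)]
  · rfl

theorem bvar_shiftCoef {n : ℕ} (f : Finset (Fin n) → ℝ) (θ : ℝ) :
    bvar (shiftCoef f θ) = bvar f := by
  refine Finset.sum_congr rfl fun S _ => ?_
  split_ifs with h
  · rw [shiftCoef, if_neg h]
  · rfl

theorem degLE_shiftCoef {n d : ℕ} {f : Finset (Fin n) → ℝ} (hf : degLE f d) (θ : ℝ) :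
    degLE (shiftCoef f θ) d := by
  intro S hS
  have : S ≠ ∅ := by rintro rfl; simp at hS
  rw [shiftCoef, if_neg this, hf S hS]

theorem bprob_abs_peval_le {n d : ℕ} (hd : 0 < d) {f : Finset (Fin n) → ℝ} (hf : degLE f d)
    (hv : bvar f = 1) {τ ρ : ℝ} (hτ : ∀ i, binf f i ≤ τ) (hτ0 : 0 < τ) (hρ : 0 < ρ) :
    bprob n (fun x => |peval f x| ≤ ρ)
      ≤ 10 ^ 13 * (d * τ ^ (1 / (8 * (d : ℝ))) + d * ρ ^ (1 / (d : ℝ))) := by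
  have hd1 : (1 : ℝ) ≤ d := by exact_mod_cast hd
  set b := τ ^ (1 / (8 * (d : ℝ))) with hb
  have hb0 : 0 < b := Real.rpow_pos_of_pos hτ0 _
  have hρ' : 0 < ρ ^ (1 / (d : ℝ)) := Real.rpow_pos_of_pos hρ _
  rcases le_or_gt 1 (9 * b) with h9 | h9
  · refine (bprob_le_one _).trans ?_
    have : b ≤ d * b := le_mul_of_one_le_left hb0.le hd1
    have : 0 ≤ d * ρ ^ (1 / (d : ℝ)) := by positivity
    linarith
  set a := b ^ d with ha
  have ha0 : 0 < a := by positivity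
  have ha1 : a ≤ 1 := pow_le_one₀ hb0.le (by linarith)
  have haτ : a ^ 8 = τ := by
    rw [ha, hb, ← pow_mul, ← Real.rpow_natCast, ← Real.rpow_mul hτ0.le]
    push_cast
    rw [show 1 / (8 * (d : ℝ)) * (d * 8) = 1 by field_simp, Real.rpow_one]
  have hab : a ^ (1 / (d : ℝ)) = b := by
    rw [ha, ← Real.rpow_natCast, ← Real.rpow_mul hb0.le, mul_one_div_cancel (by positivity),
      Real.rpow_one]
  set r := max ρ a with hr
  have hr0 : 0 < r := lt_max_of_lt_left hρ
  have hrr : r ^ (1 / (d : ℝ)) ≤ ρ ^ (1 / (d : ℝ)) + b := by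
    rcases max_choice ρ a with h | h <;> rw [hr, h]
    · linarith
    · rw [hab]; linarith
  have h1 : bprob n (fun x => |peval f x| ≤ ρ) ≤ bprob n (fun x => |peval f x| ≤ r) :=
    bprob_mono fun x hx => hx.trans (le_max_left _ _)
  have h2 := bprob_le_integral f hr0
  have h3 := integral_exp_neg_sq_rademacher_le hf hτ hv hτ0.le r
  have h4 := integral_exp_neg_sq_le_of_measure_le (measurable_peval f) (μ := gaussPi n)
    (M := 148579024896 * d) (e := 1 / (d : ℝ)) (by positivity)
    ((div_le_one (by positivity)).2 hd1)
    (fun ρ hρ => (measure_abs_peval_le hd hf hv hρ).trans (le_of_eq (by ring))) hr0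
  have h5 : 648 * 9 ^ d * (τ * d) / r ^ 4 ≤ 5832 * (d * b) := by
    rw [div_le_iff₀ (by positivity)]
    have har : a ^ 4 ≤ r ^ 4 := by gcongr; exact le_max_right _ _
    have h9b : 9 ^ d * a ≤ 9 * b := by
      rw [ha, ← mul_pow]
      exact pow_le_of_le_one (by positivity) h9.le hd.ne'
    have ha4 : a ^ 4 ≤ a := pow_le_of_le_one ha0.le ha1 (by norm_num)
    calc 648 * 9 ^ d * (τ * d) = 648 * d * (9 ^ d * a ^ 4) * a ^ 4 := by rw [← haτ]; ring
      _ ≤ 648 * d * (9 ^ d * a) * r ^ 4 := by gcongr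
      _ ≤ 648 * d * (9 * b) * r ^ 4 := by gcongr
      _ = _ := by ring
  have h6 : Real.exp (1 / 2) ≤ 2 := by
    have h7 : Real.exp (1 / 2) ^ 2 = Real.exp 1 := by rw [← Real.exp_nat_mul]; norm_num
    nlinarith [Real.exp_one_lt_d9, Real.exp_pos (1 / 2)]
  have h7 : (d : ℝ) * r ^ (1 / (d : ℝ)) ≤ d * ρ ^ (1 / (d : ℝ)) + d * b := by
    rw [← mul_add]; gcongr
  have h8 : 0 ≤ (d : ℝ) * b := by positivity
  have h10 : 0 ≤ (d : ℝ) * ρ ^ (1 / (d : ℝ)) := by positivity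
  refine (h1.trans h2).trans ?_
  calc _ ≤ 2 * (16 * (148579024896 * (d * ρ ^ (1 / (d : ℝ)) + d * b)) + 5832 * (d * b)) := by
        refine mul_le_mul h6 ?_ (integral_nonneg fun _ => Real.exp_nonneg _) (by norm_num)
        rw [mul_assoc] at h4
        linarith
    _ ≤ _ := by linarith

/-- anti-concentration for regular low-degree polynomials over the Boolean
cube. -/
theorem stmt_11 :
    ∃ K : ℝ, 0 < K ∧
      ∀ (n d : ℕ) (τ ρ θ : ℝ) (f : Finset (Fin n) → ℝ),
        degLE f d →
        (∀ i : Fin n, binf f i ≤ τ * bvar f) →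
        bvar f = 1 →
        0 < ρ →
        bprob n (fun x => |peval f x - θ| ≤ ρ)
          ≤ K * ((d : ℝ) * τ ^ (1 / (8 * (d : ℝ))) + (d : ℝ) * ρ ^ (1 / (d : ℝ))) := by
  refine ⟨10 ^ 13, by norm_num, fun n d τ ρ θ f hf hτ hv hρ => ?_⟩
  simp only [hv, mul_one] at hτ
  have hI := bvar_le_sum_binf f
  rw [hv] at hI
  have hd : 0 < d := by
    rcases d.eq_zero_or_pos with rfl | hd
    · have := sum_binf_le hf
      rw [hv] at this
      simp at this
      linarith
    · exact hd
  have hτ0 : 0 < τ := by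
    by_contra hcon
    have := Finset.sum_nonpos fun i (_ : i ∈ Finset.univ) => (hτ i).trans (not_lt.1 hcon)
    linarith
  simpa only [peval_shiftCoef] using bprob_abs_peval_le hd (degLE_shiftCoef hf θ)
    ((bvar_shiftCoef f θ).trans hv) (fun i => (binf_shiftCoef f θ i).trans_le (hτ i)) hτ0 hρ
end

section
/- Let p : {-1,1}^n -> R be a multilinear degree-d polynomial that is kappa-regular, and let rho be a restriction fixing a single variable to a value in {-1,1}. Then the restricted polynomial p_rho satisfies Var[p_rho] >= (1 - 2*sqrt(kappa)) * Var[p]. -/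
open scoped Classical
open MeasureTheory ProbabilityTheory

theorem binf_eq_sum_insert {n : ℕ} (f : Finset (Fin n) → ℝ) (j : Fin n) :
    binf f j = ∑ U : Finset (Fin n), if j ∉ U then f (insert j U) ^ 2 else 0 := by
  rw [binf, ← Finset.sum_filter, ← Finset.sum_filter]
  refine Finset.sum_nbij' (fun S => S.erase j) (fun U => insert j U) ?_ ?_ ?_ ?_ ?_
  all_goals simp +contextual [Finset.insert_erase]

theorem bvar_eq_sum_add_binf {n : ℕ} (f : Finset (Fin n) → ℝ) (j : Fin n) :
    bvar f = (∑ U : Finset (Fin n), if U ≠ ∅ ∧ j ∉ U then f U ^ 2 else 0) + binf f j := by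
  rw [bvar, binf, ← Finset.sum_add_distrib]
  refine Finset.sum_congr rfl fun U _ => ?_
  by_cases hj : j ∈ U
  · simp [hj, Finset.ne_empty_of_mem hj]
  · simp [hj]

theorem bvar_nonneg {n : ℕ} (f : Finset (Fin n) → ℝ) : 0 ≤ bvar f :=
  Finset.sum_nonneg fun U _ => by split_ifs <;> positivity

theorem restrictC_singleton {n : ℕ} (f : Finset (Fin n) → ℝ) (j : Fin n) (b : ℝ)
    (U : Finset (Fin n)) :
    restrictC f {j} (fun _ => b) U = if j ∉ U then f U + f (insert j U) * b else 0 := by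
  have hp : ({j} : Finset (Fin n)).powerset = {∅, {j}} := by
    ext T; simp [Finset.subset_singleton_iff]
  have hne : (∅ : Finset (Fin n)) ≠ {j} := (Finset.singleton_ne_empty j).symm
  simp only [restrictC, Finset.disjoint_singleton_right, hp, Finset.sum_pair hne]
  simp

/-- Weighted AM-GM applied to each coefficient of a single-variable restriction. -/
theorem le_bvar_restrictC_singleton {n : ℕ} (f : Finset (Fin n) → ℝ) (j : Fin n) {b s : ℝ}
    (hb : b ^ 2 = 1) (hs : 0 < s) (hs1 : s ≤ 1) :
    (1 - s) * (bvar f - binf f j) + (1 - s⁻¹) * binf f j ≤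
      bvar (restrictC f {j} (fun _ => b)) := by
  rw [bvar_eq_sum_add_binf f j, add_sub_cancel_right, binf_eq_sum_insert, bvar,
    Finset.mul_sum, Finset.mul_sum, ← Finset.sum_add_distrib]
  have hinv : 1 - s⁻¹ ≤ 0 := sub_nonpos.2 ((one_le_inv₀ hs).2 hs1)
  refine Finset.sum_le_sum fun U _ => ?_
  rw [restrictC_singleton]
  by_cases hj : j ∈ U
  · simp [hj]
  by_cases hU : U = ∅
  · simpa [hj, hU] using mul_nonpos_of_nonpos_of_nonneg hinv (sq_nonneg (f {j}))
  simp only [hj, hU, ne_eq, not_false_eq_true, and_self, if_true]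
  set g := f U
  set h := f (insert j U)
  have key : (g + h * b) ^ 2 - ((1 - s) * g ^ 2 + (1 - s⁻¹) * h ^ 2) =
      s⁻¹ * (s * g + h * b) ^ 2 := by
    field_simp
    linear_combination (s - 1) * h ^ 2 * hb
  have : 0 ≤ s⁻¹ * (s * g + h * b) ^ 2 := by positivity
  linarith

theorem bvar_restrictC_singleton_ge {n : ℕ} (f : Finset (Fin n) → ℝ) (j : Fin n) {b s : ℝ}
    (hb : b ^ 2 = 1) (hs : 0 < s) (h : binf f j ≤ s ^ 2 * bvar f) :
    (1 - 2 * s) * bvar f ≤ bvar (restrictC f {j} (fun _ => b)) := by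
  have hV := bvar_nonneg f
  rcases le_total 1 s with hs1 | hs1
  · exact (mul_nonpos_of_nonpos_of_nonneg (by linarith) hV).trans (bvar_nonneg _)
  refine le_trans ?_ (le_bvar_restrictC_singleton f j hb hs hs1)
  have hinv : 0 ≤ s⁻¹ - s := sub_nonneg.2 (hs1.trans ((one_le_inv₀ hs).2 hs1))
  have hA := mul_le_mul_of_nonneg_left h hinv
  have hss : (s⁻¹ - s) * (s ^ 2 * bvar f) = s * bvar f - s ^ 3 * bvar f := by
    field_simp
  have : 0 ≤ s ^ 3 * bvar f := by positivity
  linarith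

/-- restricting a single variable of a `κ`-regular multilinear polynomial
cannot decrease the variance by much. -/
theorem stmt_14 (n d : ℕ) (κ : ℝ) (f : Finset (Fin n) → ℝ) (hf : degLE f d)
    (hreg : ∀ i : Fin n, binf f i ≤ κ * bvar f) (j : Fin n) (b : ℝ) (hb : b = 1 ∨ b = -1) :
    (1 - 2 * Real.sqrt κ) * bvar f ≤ bvar (restrictC f {j} (fun _ => b)) := by
  have hb2 : b ^ 2 = 1 := by rcases hb with rfl | rfl <;> norm_num
  have hV := bvar_nonneg f
  have hlim : Filter.Tendsto (fun s : ℝ => (1 - 2 * s) * bvar f)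
      (nhdsWithin (Real.sqrt κ) (Set.Ioi (Real.sqrt κ)))
      (nhds ((1 - 2 * Real.sqrt κ) * bvar f)) :=
    Continuous.continuousWithinAt (by fun_prop)
  refine le_of_tendsto hlim (Filter.eventually_of_mem self_mem_nhdsWithin fun s hs => ?_)
  have hs0 : 0 < s := (Real.sqrt_nonneg κ).trans_lt hs
  exact bvar_restrictC_singleton_ge f j hb2 hs0
    ((hreg j).trans (mul_le_mul_of_nonneg_right ((Real.sqrt_lt' hs0).1 hs).le hV))
end
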